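/- Let S be a recursively enumerable theory extending KP^P and let M be a countable model of S. Then there exists N ⊨ S such that N is a topless rank extension of M: N is a rank extension of M, M ≠ N, and every c ∈ N all of whose N-elements lie in M belongs to M. -/

import Mathlib

universe u

/-- de Bruijn-style formulas of the language of set theory, with primitive
bounded quantifiers (`∈`-bounded and `⊆`-bounded) and unbounded quantifiers.
`SF n` is the type of formulas with (at most) `n` free variables. -/
inductive SF : ℕ → Type
  | mem {n} (i j : Fin n) : SF n
  | eq {n} (i j : Fin n) : SF n
  | not {n} (φ : SF n) : SF n
  | and {n} (φ ψ : SF n) : SF n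
  | or {n} (φ ψ : SF n) : SF n
  | bexMem {n} (i : Fin n) (φ : SF (n + 1)) : SF n
  | ballMem {n} (i : Fin n) (φ : SF (n + 1)) : SF n
  | bexSub {n} (i : Fin n) (φ : SF (n + 1)) : SF n
  | ballSub {n} (i : Fin n) (φ : SF (n + 1)) : SF n
  | ex {n} (φ : SF (n + 1)) : SF n
  | all {n} (φ : SF (n + 1)) : SF n

variable {X : Type u}

/-- `a ⊆ b` in the structure `⟨X, E⟩`. -/
def SubE (E : X → X → Prop) (a b : X) : Prop := ∀ z, E z a → E z b

/-- Satisfaction of a formula in the structure `⟨X, E⟩` under a valuation. -/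
def SF.Eval (E : X → X → Prop) : {n : ℕ} → SF n → (Fin n → X) → Prop
  | _, .mem i j, v => E (v i) (v j)
  | _, .eq i j, v => v i = v j
  | _, .not φ, v => ¬ φ.Eval E v
  | _, .and φ ψ, v => φ.Eval E v ∧ ψ.Eval E v
  | _, .or φ ψ, v => φ.Eval E v ∨ ψ.Eval E v
  | _, .bexMem i φ, v => ∃ x, E x (v i) ∧ φ.Eval E (Fin.snoc v x)
  | _, .ballMem i φ, v => ∀ x, E x (v i) → φ.Eval E (Fin.snoc v x)
  | _, .bexSub i φ, v => ∃ x, SubE E x (v i) ∧ φ.Eval E (Fin.snoc v x)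
  | _, .ballSub i φ, v => ∀ x, SubE E x (v i) → φ.Eval E (Fin.snoc v x)
  | _, .ex φ, v => ∃ x, φ.Eval E (Fin.snoc v x)
  | _, .all φ, v => ∀ x, φ.Eval E (Fin.snoc v x)

/-- `Δ₀` formulas: only `∈`-bounded quantifiers. -/
def SF.IsDelta0 : {n : ℕ} → SF n → Prop
  | _, .mem _ _ => True
  | _, .eq _ _ => True
  | _, .not φ => φ.IsDelta0
  | _, .and φ ψ => φ.IsDelta0 ∧ ψ.IsDelta0
  | _, .or φ ψ => φ.IsDelta0 ∧ ψ.IsDelta0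
  | _, .bexMem _ φ => φ.IsDelta0
  | _, .ballMem _ φ => φ.IsDelta0
  | _, .bexSub _ _ => False
  | _, .ballSub _ _ => False
  | _, .ex _ => False
  | _, .all _ => False

/-- Takahashi's class `Δ₀^𝒫`: only `∈`-bounded and `⊆`-bounded quantifiers. -/
def SF.IsDelta0P : {n : ℕ} → SF n → Prop
  | _, .mem _ _ => True
  | _, .eq _ _ => True
  | _, .not φ => φ.IsDelta0P
  | _, .and φ ψ => φ.IsDelta0P ∧ ψ.IsDelta0P
  | _, .or φ ψ => φ.IsDelta0P ∧ ψ.IsDelta0P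
  | _, .bexMem _ φ => φ.IsDelta0P
  | _, .ballMem _ φ => φ.IsDelta0P
  | _, .bexSub _ φ => φ.IsDelta0P
  | _, .ballSub _ φ => φ.IsDelta0P
  | _, .ex _ => False
  | _, .all _ => False

def Delta0C : ∀ n, SF n → Prop := fun _ φ => φ.IsDelta0
def Delta0PC : ∀ n, SF n → Prop := fun _ φ => φ.IsDelta0P
def Sigma1C : ∀ n, SF n → Prop := fun _ φ => ∃ ψ, ψ.IsDelta0 ∧ φ = SF.ex ψ
def Pi1C : ∀ n, SF n → Prop := fun _ φ => ∃ ψ, ψ.IsDelta0 ∧ φ = SF.all ψ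
def Sigma1PC : ∀ n, SF n → Prop := fun _ φ => ∃ ψ, ψ.IsDelta0P ∧ φ = SF.ex ψ
def Pi1PC : ∀ n, SF n → Prop := fun _ φ => ∃ ψ, ψ.IsDelta0P ∧ φ = SF.all ψ
def FullC : ∀ n, SF n → Prop := fun _ _ => True

/-- A Gödel numbering of formulas. -/
def SF.encode : {n : ℕ} → SF n → ℕ
  | _, .mem i j => Nat.pair 0 (Nat.pair i.val j.val)
  | _, .eq i j => Nat.pair 1 (Nat.pair i.val j.val)
  | _, .not φ => Nat.pair 2 φ.encode
  | _, .and φ ψ => Nat.pair 3 (Nat.pair φ.encode ψ.encode)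
  | _, .or φ ψ => Nat.pair 4 (Nat.pair φ.encode ψ.encode)
  | _, .bexMem i φ => Nat.pair 5 (Nat.pair i.val φ.encode)
  | _, .ballMem i φ => Nat.pair 6 (Nat.pair i.val φ.encode)
  | _, .bexSub i φ => Nat.pair 7 (Nat.pair i.val φ.encode)
  | _, .ballSub i φ => Nat.pair 8 (Nat.pair i.val φ.encode)
  | _, .ex φ => Nat.pair 9 φ.encode
  | _, .all φ => Nat.pair 10 φ.encode

/-- A theory (set of sentences) is recursively enumerable if the set of Gödel
numbers of its members is the domain of a partial recursive function. -/
def REset (S : Set (SF 0)) : Prop :=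
  ∃ f : ℕ →. ℕ, Nat.Partrec f ∧ ∀ φ : SF 0, φ ∈ S ↔ SF.encode φ ∈ f.Dom

/-- `⟨X, E⟩ ⊨ S` for a set `S` of sentences. -/
def SatT (E : X → X → Prop) (S : Set (SF 0)) : Prop :=
  ∀ φ ∈ S, SF.Eval E φ (fun i => i.elim0)

/-! ## Axioms and axiom schemes -/

def ExtensionalityAx (E : X → X → Prop) : Prop := ∀ a b, (∀ z, E z a ↔ E z b) → a = b
def EmptySetAx (E : X → X → Prop) : Prop := ∃ a, ∀ z, ¬ E z a
def PairAx (E : X → X → Prop) : Prop := ∀ x y, ∃ a, ∀ z, E z a ↔ (z = x ∨ z = y)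
def UnionAx (E : X → X → Prop) : Prop := ∀ a, ∃ b, ∀ z, E z b ↔ ∃ y, E y a ∧ E z y
def SetDiffAx (E : X → X → Prop) : Prop := ∀ a b, ∃ c, ∀ z, E z c ↔ (E z a ∧ ¬ E z b)
def PowerAx (E : X → X → Prop) : Prop := ∀ a, ∃ p, ∀ z, E z p ↔ SubE E z a
def TransSet (E : X → X → Prop) (t : X) : Prop := ∀ y, E y t → ∀ z, E z y → E z t
def TCoAx (E : X → X → Prop) : Prop := ∀ a, ∃ t, TransSet E t ∧ SubE E a t
def SuccOf (E : X → X → Prop) (x s : X) : Prop := ∀ z, E z s ↔ (E z x ∨ z = x)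
def InductiveSet (E : X → X → Prop) (a : X) : Prop :=
  (∃ e, E e a ∧ ∀ z, ¬ E z e) ∧ ∀ x, E x a → ∃ s, E s a ∧ SuccOf E x s
def InfinityAx (E : X → X → Prop) : Prop := ∃ a, InductiveSet E a
def SetFoundationAx (E : X → X → Prop) : Prop :=
  ∀ z, (∃ x, E x z) → ∃ y, E y z ∧ ∀ x, E x y → ¬ E x z
/-- The axiom of choice: every set of pairwise disjoint nonempty sets has a transversal. -/
def ACAx (E : X → X → Prop) : Prop :=
  ∀ a, (∀ x, E x a → ∃ z, E z x) →
    (∀ x y, E x a → E y a → x ≠ y → ∀ z, E z x → ¬ E z y) →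
    ∃ c, ∀ x, E x a → ∃! z, E z c ∧ E z x

def SeparationScheme (E : X → X → Prop) (C : ∀ n, SF n → Prop) : Prop :=
  ∀ (n : ℕ) (φ : SF (n + 1)), C _ φ → ∀ (p : Fin n → X) (w : X),
    ∃ y, ∀ x, E x y ↔ (E x w ∧ φ.Eval E (Fin.snoc p x))

def CollectionScheme (E : X → X → Prop) (C : ∀ n, SF n → Prop) : Prop :=
  ∀ (n : ℕ) (φ : SF (n + 2)), C _ φ → ∀ (p : Fin n → X) (w : X),
    (∀ x, E x w → ∃ y, φ.Eval E (Fin.snoc (Fin.snoc p x) y)) →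
    ∃ c, ∀ x, E x w → ∃ y, E y c ∧ φ.Eval E (Fin.snoc (Fin.snoc p x) y)

def FoundationScheme (E : X → X → Prop) (C : ∀ n, SF n → Prop) : Prop :=
  ∀ (n : ℕ) (φ : SF (n + 1)), C _ φ → ∀ p : Fin n → X,
    (∃ x, φ.Eval E (Fin.snoc p x)) →
    ∃ y, φ.Eval E (Fin.snoc p y) ∧ ∀ x, E x y → ¬ φ.Eval E (Fin.snoc p x)

/-! ## Theories -/

def ModelMminus (E : X → X → Prop) : Prop :=
  ExtensionalityAx E ∧ EmptySetAx E ∧ PairAx E ∧ UnionAx E ∧ SetDiffAx E ∧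
    TCoAx E ∧ InfinityAx E ∧ SeparationScheme E Delta0C ∧ SetFoundationAx E

def ModelM (E : X → X → Prop) : Prop := ModelMminus E ∧ PowerAx E

def ModelKP (E : X → X → Prop) : Prop :=
  ExtensionalityAx E ∧ PairAx E ∧ UnionAx E ∧ SeparationScheme E Delta0C ∧
    CollectionScheme E Delta0C ∧ FoundationScheme E Pi1C

def ModelKPP (E : X → X → Prop) : Prop :=
  ModelM E ∧ CollectionScheme E Delta0PC ∧ FoundationScheme E Pi1PC

def ModelMOST (E : X → X → Prop) : Prop :=
  ModelM E ∧ SeparationScheme E Sigma1C ∧ ACAx E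

def ModelZF (E : X → X → Prop) : Prop :=
  ExtensionalityAx E ∧ EmptySetAx E ∧ PairAx E ∧ UnionAx E ∧ PowerAx E ∧
    InfinityAx E ∧ SeparationScheme E FullC ∧ CollectionScheme E FullC ∧
    FoundationScheme E FullC

/-! ## Internal set-theoretic machinery -/

/-- `p = {{x}, {x, y}}` (Kuratowski pair). -/
def IsPair (E : X → X → Prop) (p x y : X) : Prop :=
  ∀ z, E z p ↔ ((∀ w, E w z ↔ w = x) ∨ (∀ w, E w z ↔ (w = x ∨ w = y)))

def FunApp (E : X → X → Prop) (f x y : X) : Prop := ∃ q, E q f ∧ IsPair E q x y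

/-- `f` is a function with domain `d`. -/
def IsFuncOn (E : X → X → Prop) (f d : X) : Prop :=
  (∀ q, E q f → ∃ x y, IsPair E q x y ∧ E x d) ∧
  (∀ x y y', FunApp E f x y → FunApp E f x y' → y = y') ∧
  (∀ x, E x d → ∃ y, FunApp E f x y)

/-- `f` is an injective function from `dom` into `cod`. -/
def InjFunInto (E : X → X → Prop) (f dom cod : X) : Prop :=
  IsFuncOn E f dom ∧ (∀ x y, FunApp E f x y → E y cod) ∧
  (∀ x x' y, FunApp E f x y → FunApp E f x' y → x = x')

/-- `|t| ≤ |κ|`. -/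
def CardLe (E : X → X → Prop) (t κ : X) : Prop := ∃ f, InjFunInto E f t κ

def IsOrdinal (E : X → X → Prop) (x : X) : Prop :=
  TransSet E x ∧ ∀ y, E y x → TransSet E y

/-- An (initial ordinal =) cardinal: an ordinal that does not inject into any of
its members. -/
def IsCardinal (E : X → X → Prop) (κ : X) : Prop :=
  IsOrdinal E κ ∧ ∀ β, E β κ → ¬ CardLe E κ β

/-- `t` is the transitive closure of the set `x`. -/
def IsTCset (E : X → X → Prop) (t x : X) : Prop :=
  TransSet E t ∧ SubE E x t ∧ ∀ u, TransSet E u → SubE E x u → SubE E t u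

/-- `t` is the transitive closure of `{x}`. -/
def IsTCsingleton (E : X → X → Prop) (t x : X) : Prop :=
  TransSet E t ∧ E x t ∧ ∀ u, TransSet E u → E x u → SubE E t u

def IsOmega (E : X → X → Prop) (w : X) : Prop :=
  InductiveSet E w ∧ ∀ a, InductiveSet E a → SubE E w a

/-- `⟨X, E⟩` is `ω`-standard: its internal natural numbers are order-isomorphic
to the standard natural numbers. -/
def OmegaStandard (E : X → X → Prop) : Prop :=
  ∀ w, IsOmega E w → ∃ f : ℕ → X, (∀ n, E (f n) w) ∧ (∀ x, E x w → ∃ n, x = f n) ∧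
    ∀ m n : ℕ, (E (f m) (f n) ↔ m < n)

/-- `f` is (a function coding) the cumulative hierarchy `β ↦ V_β` for `β ∈ α`,
using `V_β = ⋃_{γ∈β} 𝒫(V_γ)`. -/
def IsRK (E : X → X → Prop) (α f : X) : Prop :=
  IsOrdinal E α ∧ IsFuncOn E f α ∧
  ∀ β vβ, E β α → FunApp E f β vβ →
    ∀ x, E x vβ ↔ ∃ γ, E γ β ∧ ∃ vγ, FunApp E f γ vγ ∧ SubE E x vγ

/-- Internal rank comparison `ρ(x) ≤ ρ(y)`: `x` belongs to every stage of the
cumulative hierarchy that `y` belongs to. -/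
def RankLe (E : X → X → Prop) (x y : X) : Prop :=
  ∀ α f β v, IsRK E α f → E β α → FunApp E f β v → E y v → E x v

/-- External `n`-th von Neumann natural number. -/
def IsVN (E : X → X → Prop) : ℕ → X → Prop
  | 0, x => ∀ z, ¬ E z x
  | (n + 1), x => ∃ y, IsVN E n y ∧ SuccOf E y x

/-- `a` is the `n`-th infinite cardinal `ℵ_n` (for external `n`, as computed in
the model): `ℵ₀ = ω`, and `ℵ_{n+1}` is the least cardinal above `ℵ_n`. -/
def IsAleph (E : X → X → Prop) : ℕ → X → Prop
  | 0, a => IsOmega E a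
  | (n + 1), a => ∃ b, IsAleph E n b ∧ IsCardinal E a ∧ E b a ∧
      ∀ c, IsCardinal E c → E b c → (c = a ∨ E a c)

/-- `a` is the cardinal `ℵ_ω` of the model: the least limit cardinal above `ω`. -/
def IsAlephOmega (E : X → X → Prop) (a : X) : Prop :=
  (IsCardinal E a ∧ (∃ w, IsOmega E w ∧ E w a) ∧
    (∀ β, E β a → ∃ μ, IsCardinal E μ ∧ E β μ ∧ E μ a)) ∧
  ∀ a', (IsCardinal E a' ∧ (∃ w, IsOmega E w ∧ E w a') ∧
    (∀ β, E β a' → ∃ μ, IsCardinal E μ ∧ E β μ ∧ E μ a')) → (a = a' ∨ E a a')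

/-! ## Internal satisfaction and the constructible hierarchy (for `V = L`) -/

/-- `c = ⟨n, a⟩` with the tag `n` an external natural (internally coded). -/
def TaggedBy (E : X → X → Prop) (c : X) (n : ℕ) (a : X) : Prop :=
  ∃ t, IsVN E n t ∧ IsPair E c t a

def CodeMem (E : X → X → Prop) (c i j : X) : Prop := ∃ p, IsPair E p i j ∧ TaggedBy E c 0 p
def CodeEq (E : X → X → Prop) (c i j : X) : Prop := ∃ p, IsPair E p i j ∧ TaggedBy E c 1 p
def CodeNot (E : X → X → Prop) (c' c : X) : Prop := TaggedBy E c' 2 c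
def CodeAnd (E : X → X → Prop) (c' c₁ c₂ : X) : Prop := ∃ p, IsPair E p c₁ c₂ ∧ TaggedBy E c' 3 p
def CodeEx (E : X → X → Prop) (c' i c : X) : Prop := ∃ p, IsPair E p i c ∧ TaggedBy E c' 4 p

/-- `d` is closed under the internal formation rules for codes of formulas with
variables indexed by elements of `w` (the internal `ω`). -/
def ClosedCode (E : X → X → Prop) (w d : X) : Prop :=
  (∀ i j c, E i w → E j w → CodeMem E c i j → E c d) ∧
  (∀ i j c, E i w → E j w → CodeEq E c i j → E c d) ∧
  (∀ c c', E c d → CodeNot E c' c → E c' d) ∧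
  (∀ c₁ c₂ c', E c₁ d → E c₂ d → CodeAnd E c' c₁ c₂ → E c' d) ∧
  (∀ i c c', E i w → E c d → CodeEx E c' i c → E c' d)

/-- `c` is an internal code of a first-order formula of the language of set theory. -/
def FormCode (E : X → X → Prop) (w c : X) : Prop := ∀ d, ClosedCode E w d → E c d

/-- An internal assignment of elements of `a` to the variables. -/
def IsAssign (E : X → X → Prop) (w a v : X) : Prop :=
  IsFuncOn E v w ∧ ∀ i y, FunApp E v i y → E y a

/-- `v' = v[i ↦ x]`. -/
def UpdateAssign (E : X → X → Prop) (w v : X) (i x v' : X) : Prop :=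
  FunApp E v' i x ∧ ∀ j, E j w → j ≠ i → ∀ y, (FunApp E v j y ↔ FunApp E v' j y)

def PairIn (E : X → X → Prop) (s c v : X) : Prop := ∃ q, E q s ∧ IsPair E q c v

/-- `s` is a (full) satisfaction class for the set structure `⟨a, E⟩`: a set of
pairs ⟨code, assignment⟩ obeying the Tarski conditions. -/
def SatSet (E : X → X → Prop) (w a s : X) : Prop :=
  (∀ q, E q s → ∃ c v, IsPair E q c v ∧ FormCode E w c ∧ IsAssign E w a v) ∧
  (∀ i j c v xi xj, E i w → E j w → CodeMem E c i j → IsAssign E w a v →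
    FunApp E v i xi → FunApp E v j xj → (PairIn E s c v ↔ E xi xj)) ∧
  (∀ i j c v xi xj, E i w → E j w → CodeEq E c i j → IsAssign E w a v →
    FunApp E v i xi → FunApp E v j xj → (PairIn E s c v ↔ xi = xj)) ∧
  (∀ c c' v, FormCode E w c → CodeNot E c' c → IsAssign E w a v →
    (PairIn E s c' v ↔ ¬ PairIn E s c v)) ∧
  (∀ c₁ c₂ c' v, FormCode E w c₁ → FormCode E w c₂ → CodeAnd E c' c₁ c₂ →
    IsAssign E w a v → (PairIn E s c' v ↔ (PairIn E s c₁ v ∧ PairIn E s c₂ v))) ∧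
  (∀ i c c' v, E i w → FormCode E w c → CodeEx E c' i c → IsAssign E w a v →
    (PairIn E s c' v ↔ ∃ x v', E x a ∧ IsAssign E w a v' ∧ UpdateAssign E w v i x v' ∧
      PairIn E s c v'))

/-- `b` is a subset of `a` definable over `⟨a, E⟩` (with parameters from `a`). -/
def DefSub (E : X → X → Prop) (w a s b : X) : Prop :=
  SubE E b a ∧ ∃ c, FormCode E w c ∧ ∃ v, IsAssign E w a v ∧ ∃ i, E i w ∧
    ∀ x, E x b ↔ (E x a ∧ ∃ v', IsAssign E w a v' ∧ UpdateAssign E w v i x v' ∧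
      PairIn E s c v')

/-- `f` codes the constructible hierarchy `β ↦ L_β` for `β ∈ α`, using
`L_β = ⋃_{γ∈β} Def(L_γ)`. -/
def IsLHier (E : X → X → Prop) (w f α : X) : Prop :=
  IsOrdinal E α ∧ IsFuncOn E f α ∧
  ∀ β vβ, E β α → FunApp E f β vβ →
    ∀ x, E x vβ ↔ ∃ γ, E γ β ∧ ∃ vγ, FunApp E f γ vγ ∧ ∃ s, SatSet E w vγ s ∧
      DefSub E w vγ s x

/-- The axiom `V = L`: every set belongs to some level of the constructible hierarchy. -/
def VeqL (E : X → X → Prop) : Prop :=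
  ∀ w, IsOmega E w → ∀ x, ∃ α f β vβ, IsLHier E w f α ∧ E β α ∧ FunApp E f β vβ ∧ E x vβ

/-! ## Extensions -/

/-- The substructure of `⟨X, E⟩` with underlying set `A`. -/
def restrict (E : X → X → Prop) (A : Set X) : A → A → Prop := fun a b => E a.1 b.1

/-- `B` is an end extension of `A` (both substructures of an ambient `⟨X, E⟩`). -/
def EndExtIn (E : X → X → Prop) (A B : Set X) : Prop :=
  A ⊆ B ∧ ∀ x y, x ∈ B → y ∈ A → E x y → x ∈ A

/-- `B` is a powerset-preserving end extension of `A` (within an ambient `⟨X, E⟩`);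
`x ⊆ y` is computed in `B`. -/
def PowExtIn (E : X → X → Prop) (A B : Set X) : Prop :=
  EndExtIn E A B ∧ ∀ x y, x ∈ B → y ∈ A → (∀ z, z ∈ B → E z x → E z y) → x ∈ A

/-- The whole structure `⟨X, E⟩` is an end extension of its substructure on `A`. -/
def EndExtSet (E : X → X → Prop) (A : Set X) : Prop :=
  ∀ x y, y ∈ A → E x y → x ∈ A

/-- `⟨X, E⟩` is a powerset-preserving end extension of its substructure on `A`. -/
def PowExtSet (E : X → X → Prop) (A : Set X) : Prop :=
  EndExtSet E A ∧ ∀ x y, y ∈ A → SubE E x y → x ∈ A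

/-- `⟨X, E⟩` is a rank extension of its substructure on `A`. -/
def RankExtSet (E : X → X → Prop) (A : Set X) : Prop :=
  PowExtSet E A ∧ ∀ x y, y ∈ A → RankLe E x y → x ∈ A

/-- The extension `⟨X, E⟩` of its substructure on `A` is proper and topless. -/
def ToplessSet (E : X → X → Prop) (A : Set X) : Prop :=
  A ≠ Set.univ ∧ ∀ c, (∀ x, E x c → x ∈ A) → c ∈ A

/-- The extension `⟨X, E⟩` of its substructure on `A` is proper and blunt (not topless). -/
def BluntSet (E : X → X → Prop) (A : Set X) : Prop :=
  A ≠ Set.univ ∧ ¬ ToplessSet E A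

/-! ## Weak dependent choice -/

/-- `δ_ω^φ(b, f, p)`: `f` is a function on `ω` with `f(0) = {b}` tracing the
`φ`-successor relation. -/
def IsWDCWitness (E : X → X → Prop) {n : ℕ} (φ : SF (n + 2)) (p : Fin n → X)
    (w b f : X) : Prop :=
  IsFuncOn E f w ∧
  (∃ z v, (∀ u, ¬ E u z) ∧ E z w ∧ FunApp E f z v ∧ ∀ t, E t v ↔ t = b) ∧
  ∀ m m' vm vm', E m w → SuccOf E m m' → E m' w → FunApp E f m vm → FunApp E f m' vm' →
    ((∀ x, E x vm → ∃ y, E y vm' ∧ φ.Eval E (Fin.snoc (Fin.snoc p x) y)) ∧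
     (∀ y, E y vm' → ∀ x, E x vm → φ.Eval E (Fin.snoc (Fin.snoc p x) y)))

/-- The scheme `Δ₀^𝒫-WDC_ω`. -/
def WDComega (E : X → X → Prop) : Prop :=
  ∀ (n : ℕ) (φ : SF (n + 2)), Delta0PC _ φ → ∀ p : Fin n → X,
    (∀ x, ∃ y, φ.Eval E (Fin.snoc (Fin.snoc p x) y)) →
    ∀ w, IsOmega E w → ∀ b, ∃ f, IsWDCWitness E φ p w b f

/-! ## Internal well-founded extensional relations (for `H_{≤κ}`) -/

def RRel (E : X → X → Prop) (R a b : X) : Prop := ∃ p, E p R ∧ IsPair E p a b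

def RelOn (E : X → X → Prop) (R k : X) : Prop :=
  ∀ p, E p R → ∃ a b, IsPair E p a b ∧ E a k ∧ E b k

/-- `BFEXT(R, k)`: `R ⊆ k × k` is extensional on `k`, has a top element, and every
nonempty subset of `k` has an `R`-minimal element. -/
def BFEXT (E : X → X → Prop) (R k : X) : Prop :=
  RelOn E R k ∧
  (∀ a b, E a k → E b k → (∀ c, E c k → (RRel E R c a ↔ RRel E R c b)) → a = b) ∧
  (∃ t, E t k ∧ ∀ b, E b k → b ≠ t → RRel E R b t) ∧
  (∀ S, SubE E S k → (∃ z, E z S) → ∃ m, E m S ∧ ∀ y, E y S → ¬ RRel E R y m)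

/-- `f` is an isomorphism of `⟨k, R⟩` with `⟨T, ∈⟩`. -/
def IsoOnto (E : X → X → Prop) (R k f T : X) : Prop :=
  IsFuncOn E f k ∧ (∀ x y, FunApp E f x y → E y T) ∧
  (∀ y, E y T → ∃ x, E x k ∧ FunApp E f x y) ∧
  (∀ x x' y, FunApp E f x y → FunApp E f x' y → x = x') ∧
  ∀ a b ya yb, E a k → E b k → FunApp E f a ya → FunApp E f b yb →
    (RRel E R a b ↔ E ya yb)

/-- The predicate `Xv = H_{≤κ} = {x : |TC(x)| ≤ κ}`. -/
def HleqPred (E : X → X → Prop) (Xv κ : X) : Prop :=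
  IsCardinal E κ ∧ ∀ x, E x Xv ↔ ∃ t, IsTCset E t x ∧ CardLe E t κ

/-- The explicit conjunction (i) ∧ (ii) ∧ (iii) asserting `Xv = H_{≤κ}`. -/
def ExplicitH (E : X → X → Prop) (Xv κ : X) : Prop :=
  IsCardinal E κ ∧
  (∀ R, BFEXT E R κ → ∃ x f T, E x Xv ∧ E f Xv ∧ E T Xv ∧ IsTCsingleton E T x ∧
    IsoOnto E R κ f T) ∧
  (∀ x, E x Xv → ∃ T f, E T Xv ∧ E f Xv ∧ IsTCsingleton E T x ∧ InjFunInto E f T κ)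


/-! # Part 1 : definability layer -/

set_option linter.unusedVariables false
set_option linter.unusedSectionVars false
set_option linter.unusedSimpArgs false
set_option linter.style.longLine false

namespace KPP

class MK (M : Type) where
  E : M → M → Prop
  kpp : ModelKPP E

infix:50 "∊" => MK.E

/-- subset -/
def Sub {M : Type} [MK M] (a b : M) : Prop := ∀ z, z ∊ a → z ∊ b

infix:50 "⊑" => Sub

/-- lifting of a renaming under a binder -/
def lft {n m : ℕ} (f : Fin n → Fin m) : Fin (n+1) → Fin (m+1) :=
  Fin.snoc (fun i => (f i).castSucc) (Fin.last m)

/-- renaming of variables -/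
def ren : {n : ℕ} → SF n → {m : ℕ} → (Fin n → Fin m) → SF m
  | _, .mem i j, _, f => .mem (f i) (f j)
  | _, .eq i j, _, f => .eq (f i) (f j)
  | _, .not φ, _, f => .not (ren φ f)
  | _, .and φ ψ, _, f => .and (ren φ f) (ren ψ f)
  | _, .or φ ψ, _, f => .or (ren φ f) (ren ψ f)
  | _, .bexMem i φ, _, f => .bexMem (f i) (ren φ (lft f))
  | _, .ballMem i φ, _, f => .ballMem (f i) (ren φ (lft f))
  | _, .bexSub i φ, _, f => .bexSub (f i) (ren φ (lft f))
  | _, .ballSub i φ, _, f => .ballSub (f i) (ren φ (lft f))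
  | _, .ex φ, _, f => .ex (ren φ (lft f))
  | _, .all φ, _, f => .all (ren φ (lft f))

theorem snoc_lft {X : Type} {n m : ℕ} (f : Fin n → Fin m) (v : Fin m → X) (x : X) :
    (fun i => (Fin.snoc v x : Fin (m+1) → X) (lft f i)) = Fin.snoc (fun i => v (f i)) x := by
  funext i
  refine Fin.lastCases ?_ (fun j => ?_) i
  · simp [lft]
  · simp [lft]

theorem eval_ren {X : Type} (E : X → X → Prop) {n : ℕ} (φ : SF n) :
    ∀ {m : ℕ} (f : Fin n → Fin m) (v : Fin m → X),
      (ren φ f).Eval E v ↔ φ.Eval E (fun i => v (f i)) := by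
  induction φ with
  | mem i j => intros; rfl
  | eq i j => intros; rfl
  | not φ ih => intro m f v; simp [ren, SF.Eval, ih]
  | and φ ψ ih1 ih2 => intro m f v; simp [ren, SF.Eval, ih1, ih2]
  | or φ ψ ih1 ih2 => intro m f v; simp [ren, SF.Eval, ih1, ih2]
  | bexMem i φ ih => intro m f v; simp only [ren, SF.Eval, ih, snoc_lft]
  | ballMem i φ ih => intro m f v; simp only [ren, SF.Eval, ih, snoc_lft]
  | bexSub i φ ih => intro m f v; simp only [ren, SF.Eval, ih, snoc_lft]
  | ballSub i φ ih => intro m f v; simp only [ren, SF.Eval, ih, snoc_lft]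
  | ex φ ih => intro m f v; simp only [ren, SF.Eval, ih, snoc_lft]
  | all φ ih => intro m f v; simp only [ren, SF.Eval, ih, snoc_lft]

theorem delta_ren {n : ℕ} (φ : SF n) :
    ∀ {m : ℕ} (f : Fin n → Fin m), φ.IsDelta0P → (ren φ f).IsDelta0P := by
  induction φ <;> intro m f h <;> simp_all [ren, SF.IsDelta0P]

/-- translation of a `Δ₀^𝒫` formula to a `Δ₀` formula, relative to a supertransitive set
(new variable number `0`) -/
def d0 : {n : ℕ} → SF n → SF (n+1)
  | _, .mem i j => .mem i.succ j.succ
  | _, .eq i j => .eq i.succ j.succ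
  | _, .not φ => .not (d0 φ)
  | _, .and φ ψ => .and (d0 φ) (d0 ψ)
  | _, .or φ ψ => .or (d0 φ) (d0 ψ)
  | _, .bexMem i φ => .bexMem i.succ (d0 φ)
  | _, .ballMem i φ => .ballMem i.succ (d0 φ)
  | n, .bexSub i φ => .bexMem 0 (.and
      (.ballMem (Fin.last (n+1)) (.mem (Fin.last (n+2)) i.succ.castSucc.castSucc)) (d0 φ))
  | n, .ballSub i φ => .ballMem 0 (.or
      (.not (.ballMem (Fin.last (n+1)) (.mem (Fin.last (n+2)) i.succ.castSucc.castSucc))) (d0 φ))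
  | _, .ex φ => .ex (d0 φ)
  | _, .all φ => .all (d0 φ)

theorem delta_d0 {n : ℕ} (φ : SF n) : φ.IsDelta0P → (d0 φ).IsDelta0 := by
  induction φ <;> intro h <;> simp_all [d0, SF.IsDelta0P, SF.IsDelta0]

theorem eval_d0 {X : Type} (E : X → X → Prop) (t : X) (h1 : ∀ x y, E x y → E y t → E x t)
    (h2 : ∀ x y, SubE E x y → E y t → E x t) {n : ℕ} (φ : SF n) :
    ∀ (v : Fin n → X), φ.IsDelta0P → (∀ i, E (v i) t) →
      ((d0 φ).Eval E (Fin.cons t v : Fin (n+1) → X) ↔ φ.Eval E v) := by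
  have key : ∀ {n : ℕ} (v : Fin n → X) (x : X), (Fin.snoc (Fin.cons t v : Fin (n+1) → X) x :
      Fin (n+2) → X) = Fin.cons t (Fin.snoc v x : Fin (n+1) → X) := by
    intro n v x; exact (Fin.cons_snoc_eq_snoc_cons t v x).symm
  have key2 : ∀ {n : ℕ} (v : Fin n → X) (x : X), (∀ i, E (v i) t) → E x t →
      ∀ i, E ((Fin.snoc v x : Fin (n+1) → X) i) t := by
    intro n v x hv hx i
    refine Fin.lastCases ?_ (fun j => ?_) i
    · simpa using hx
    · simpa using hv j
  have sub : ∀ {n : ℕ} (v : Fin n → X) (x : X) (i : Fin n),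
      (SF.ballMem (Fin.last (n+1)) (.mem (Fin.last (n+2)) i.succ.castSucc.castSucc)).Eval E
        (Fin.snoc (Fin.cons t v : Fin (n+1) → X) x : Fin (n+2) → X) ↔ SubE E x (v i) := by
    intro n v x i
    simp only [SF.Eval, SubE, Fin.snoc_last, Fin.snoc_castSucc, Fin.cons_succ]
  induction φ with
  | mem i j => intro v _ _; simp [d0, SF.Eval]
  | eq i j => intro v _ _; simp [d0, SF.Eval]
  | not φ ih => intro v hd hv; simp only [d0, SF.Eval, ih v hd hv]
  | and φ ψ ih1 ih2 => intro v hd hv; simp only [d0, SF.Eval, ih1 v hd.1 hv, ih2 v hd.2 hv]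
  | or φ ψ ih1 ih2 => intro v hd hv; simp only [d0, SF.Eval, ih1 v hd.1 hv, ih2 v hd.2 hv]
  | bexMem i φ ih =>
    intro v hd hv
    simp only [d0, SF.Eval, key, Fin.cons_succ]
    refine exists_congr fun x => and_congr_right fun hx => ?_
    exact ih _ hd (key2 v x hv (h1 _ _ hx (hv i)))
  | ballMem i φ ih =>
    intro v hd hv
    simp only [d0, SF.Eval, key, Fin.cons_succ]
    refine forall_congr' fun x => forall_congr' fun hx => ?_
    exact ih _ hd (key2 v x hv (h1 _ _ hx (hv i)))
  | bexSub i φ ih =>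
    intro v hd hv
    rw [d0]
    unfold SF.Eval
    refine exists_congr fun x => ?_
    rw [SF.Eval, sub, key]
    simp only [Fin.cons_zero]
    constructor
    · rintro ⟨a, b, c⟩; exact ⟨b, (ih _ hd (key2 v x hv a)).1 c⟩
    · rintro ⟨b, c⟩
      exact ⟨h2 _ _ b (hv i), b, (ih _ hd (key2 v x hv (h2 _ _ b (hv i)))).2 c⟩
  | ballSub i φ ih =>
    intro v hd hv
    rw [d0]
    unfold SF.Eval
    refine forall_congr' fun x => ?_
    rw [SF.Eval, SF.Eval, sub, key]
    simp only [Fin.cons_zero]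
    constructor
    · intro a b
      have hx := h2 _ _ b (hv i)
      exact (ih _ hd (key2 v x hv hx)).1 ((a hx).resolve_left (fun k => k b))
    · intro a hx
      by_cases b : SubE E x (v i)
      · exact Or.inr ((ih _ hd (key2 v x hv hx)).2 (a b))
      · exact Or.inl b
  | ex φ ih => intro v hd; exact hd.elim
  | all φ ih => intro v hd; exact hd.elim

section
variable {M : Type} [MK M]

theorem ext {a b : M} (h : ∀ z, z ∊ a ↔ z ∊ b) : a = b := MK.kpp.1.1.1 a b h

theorem sub_antisymm {a b : M} (h : a ⊑ b) (h' : b ⊑ a) : a = b := ext fun z => ⟨h z, h' z⟩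
theorem sub_refl (a : M) : a ⊑ a := fun _ h => h
theorem sub_trans {a b c : M} (h : a ⊑ b) (h' : b ⊑ c) : a ⊑ c := fun z hz => h' z (h z hz)

theorem emp_ex : ∃ a : M, ∀ z, ¬ z ∊ a := MK.kpp.1.1.2.1
theorem pair_ex (x y : M) : ∃ a : M, ∀ z, z ∊ a ↔ (z = x ∨ z = y) := MK.kpp.1.1.2.2.1 x y
theorem un_ex (a : M) : ∃ b : M, ∀ z, z ∊ b ↔ ∃ y, y ∊ a ∧ z ∊ y := MK.kpp.1.1.2.2.2.1 a
theorem pow_ex (a : M) : ∃ b : M, ∀ z, z ∊ b ↔ z ⊑ a := MK.kpp.1.2 a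
theorem tco_ex (a : M) : ∃ t : M, (∀ y, y ∊ t → ∀ z, z ∊ y → z ∊ t) ∧ a ⊑ t :=
  MK.kpp.1.1.2.2.2.2.2.1 a
theorem fnd (z : M) (h : ∃ x, x ∊ z) : ∃ y, y ∊ z ∧ ∀ x, x ∊ y → ¬ x ∊ z :=
  MK.kpp.1.1.2.2.2.2.2.2.2.2 z h

/-- choice of sets -/
noncomputable def emp : M := (emp_ex (M := M)).choose
theorem not_emp (z : M) : ¬ z ∊ emp := (emp_ex (M := M)).choose_spec z
noncomputable def upair (x y : M) : M := (pair_ex x y).choose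
theorem mem_upair (x y z : M) : z ∊ upair x y ↔ (z = x ∨ z = y) := (pair_ex x y).choose_spec z
noncomputable def Un (a : M) : M := (un_ex a).choose
theorem mem_Un (a z : M) : z ∊ Un a ↔ ∃ y, y ∊ a ∧ z ∊ y := (un_ex a).choose_spec z
noncomputable def Pow (a : M) : M := (pow_ex a).choose
theorem mem_Pow (a z : M) : z ∊ Pow a ↔ z ⊑ a := (pow_ex a).choose_spec z
noncomputable def bun (a b : M) : M := Un (upair a b)
theorem mem_bun (a b z : M) : z ∊ bun a b ↔ (z ∊ a ∨ z ∊ b) := by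
  simp [bun, mem_Un, mem_upair]

/-- a finite tuple lies in a set -/
theorem tuple_ex : ∀ {n : ℕ} (v : Fin n → M), ∃ t : M, ∀ i, v i ∊ t
  | 0, _ => ⟨emp, fun i => i.elim0⟩
  | n+1, v => by
    obtain ⟨t, ht⟩ := tuple_ex (fun i : Fin n => v i.castSucc)
    refine ⟨bun t (upair (v (Fin.last n)) (v (Fin.last n))), fun i => ?_⟩
    rw [mem_bun]
    refine Fin.lastCases ?_ (fun j => ?_) i
    · right; simp [mem_upair]
    · left; exact ht j

theorem sep_formula {n : ℕ} (φ : SF (n+1)) (h : φ.IsDelta0P) (p : Fin n → M) (w : M) :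
    ∃ y : M, ∀ x, x ∊ y ↔ (x ∊ w ∧ φ.Eval MK.E (Fin.snoc p x)) := by
  obtain ⟨t0, ht0⟩ := tuple_ex p
  obtain ⟨t, ht1, ht2⟩ := tco_ex (bun t0 w)
  have hsep := (MK.kpp (M := M)).1.1.2.2.2.2.2.2.2.1 (n+1) (d0 φ) (delta_d0 φ h)
    (Fin.cons (Pow t) p) w
  obtain ⟨y, hy⟩ := hsep
  refine ⟨y, fun x => (hy x).trans (and_congr_right fun hx => ?_)⟩
  rw [← Fin.cons_snoc_eq_snoc_cons]
  have tt : ∀ x, x ∊ t → x ∊ Pow t := fun x hx => (mem_Pow _ _).2 (fun z hz => ht1 x hx z hz)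
  refine eval_d0 MK.E (Pow t) ?_ ?_ φ _ h ?_
  · intro a b hab hb
    exact tt _ ((mem_Pow _ _).1 hb a hab)
  · intro a b hab hb
    rw [mem_Pow] at hb ⊢
    exact fun z hz => hb z (hab z hz)
  · intro i
    refine Fin.lastCases ?_ (fun j => ?_) i
    · simpa using tt _ (ht2 _ ((mem_bun _ _ _).2 (Or.inr hx)))
    · simpa using tt _ (ht2 _ ((mem_bun _ _ _).2 (Or.inl (ht0 j))))

/-- value of a simple term -/
def tm : ℕ ⊕ M → (ℕ → M) → M
  | .inl n, ρ => ρ n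
  | .inr c, _ => c

@[reducible] def shift {M : Type} (ρ : ℕ → M) : ℕ → M := fun n => ρ (n+1)

def cns {M : Type} (x : M) (ρ : ℕ → M) : ℕ → M
  | 0 => x
  | n+1 => ρ n

theorem shift_cns (x : M) (ρ : ℕ → M) : shift (cns x ρ) = ρ := rfl
theorem cns_zero (x : M) (ρ : ℕ → M) : cns x ρ 0 = x := rfl

/-- `Δ₀^𝒫` predicates -/
def Dp (P : (ℕ → M) → Prop) : Prop :=
  ∃ (n : ℕ) (φ : SF n) (ts : Fin n → ℕ ⊕ M), φ.IsDelta0P ∧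
    ∀ ρ, P ρ ↔ φ.Eval MK.E (fun i => tm (ts i) ρ)

theorem Dp.congr {P Q : (ℕ → M) → Prop} (h : Dp P) (e : ∀ ρ, Q ρ ↔ P ρ) : Dp Q := by
  obtain ⟨n, φ, ts, h1, h2⟩ := h
  exact ⟨n, φ, ts, h1, fun ρ => (e ρ).trans (h2 ρ)⟩

theorem Dp.mem (s t : ℕ ⊕ M) : Dp (fun ρ => tm s ρ ∊ tm t ρ) :=
  ⟨2, .mem 0 1, ![s, t], trivial, fun ρ => by simp [SF.Eval]⟩
theorem Dp.eq (s t : ℕ ⊕ M) : Dp (fun ρ => tm s ρ = tm t ρ) :=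
  ⟨2, .eq 0 1, ![s, t], trivial, fun ρ => by simp [SF.Eval]⟩
theorem Dp.not {P : (ℕ → M) → Prop} (h : Dp P) : Dp (fun ρ => ¬ P ρ) := by
  obtain ⟨n, φ, ts, h1, h2⟩ := h
  exact ⟨n, .not φ, ts, h1, fun ρ => by simp [SF.Eval, h2]⟩
theorem Dp.and {P Q : (ℕ → M) → Prop} (h : Dp P) (h' : Dp Q) : Dp (fun ρ => P ρ ∧ Q ρ) := by
  obtain ⟨n, φ, ts, h1, h2⟩ := h
  obtain ⟨m, ψ, us, h3, h4⟩ := h'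
  refine ⟨n+m, .and (ren φ (Fin.castAdd m)) (ren ψ (Fin.natAdd n)), Fin.append ts us,
    ⟨delta_ren _ _ h1, delta_ren _ _ h3⟩, fun ρ => ?_⟩
  simp [SF.Eval, h2, h4, eval_ren]
theorem Dp.or {P Q : (ℕ → M) → Prop} (h : Dp P) (h' : Dp Q) : Dp (fun ρ => P ρ ∨ Q ρ) :=
  (h.not.and h'.not).not.congr fun ρ => by tauto

theorem Dp.subst {P : (ℕ → M) → Prop} (h : Dp P) (σ : ℕ → ℕ ⊕ M) :
    Dp (fun ρ => P (fun k => tm (σ k) ρ)) := by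
  obtain ⟨n, φ, ts, h1, h2⟩ := h
  refine ⟨n, φ, fun i => Sum.elim σ Sum.inr (ts i), h1, fun ρ => ?_⟩
  refine (h2 _).trans ?_
  have : ∀ i, tm (ts i) (fun k => tm (σ k) ρ) = tm (Sum.elim σ Sum.inr (ts i)) ρ := by
    intro i
    cases ts i <;> rfl
  simp only [this]

open Classical in
theorem Dp.bexMem {P : (ℕ → M) → M → Prop} (s : ℕ ⊕ M)
    (h : Dp (fun ρ => P (shift ρ) (ρ 0))) : Dp (fun ρ => ∃ x, x ∊ tm s ρ ∧ P ρ x) := by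
  obtain ⟨n, φ, ts, h1, h2⟩ := h
  refine ⟨n+1, .bexMem 0 (ren φ (fun i => if ts i = .inl 0 then Fin.last (n+1) else
      (i.succ).castSucc)), Fin.cons s (fun i => match ts i with
        | .inl 0 => s | .inl (k+1) => .inl k | .inr c => .inr c),
      delta_ren _ _ h1, fun ρ => ?_⟩
  simp only [SF.Eval, eval_ren, Fin.cons_zero]
  refine exists_congr fun x => and_congr_right fun _ => ?_
  refine (h2 (cns x ρ)).trans ?_
  refine iff_of_eq (congrArg _ (funext fun i => ?_))
  rcases hi : ts i with k | c
  · cases k with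
    | zero => simp [tm, cns]
    | succ k => simp [hi, tm, cns, -Fin.castSucc_succ]
  · simp [hi, tm, -Fin.castSucc_succ]

theorem Dp.ballMem {P : (ℕ → M) → M → Prop} (s : ℕ ⊕ M)
    (h : Dp (fun ρ => P (shift ρ) (ρ 0))) : Dp (fun ρ => ∀ x, x ∊ tm s ρ → P ρ x) :=
  (Dp.bexMem (P := fun ρ x => ¬ P ρ x) s h.not).not.congr fun ρ => by
    push Not; rfl

open Classical in
theorem Dp.bexSub {P : (ℕ → M) → M → Prop} (s : ℕ ⊕ M)
    (h : Dp (fun ρ => P (shift ρ) (ρ 0))) : Dp (fun ρ => ∃ x, x ⊑ tm s ρ ∧ P ρ x) := by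
  obtain ⟨n, φ, ts, h1, h2⟩ := h
  refine ⟨n+1, .bexSub 0 (ren φ (fun i => if ts i = .inl 0 then Fin.last (n+1) else
      (i.succ).castSucc)), Fin.cons s (fun i => match ts i with
        | .inl 0 => s | .inl (k+1) => .inl k | .inr c => .inr c),
      delta_ren _ _ h1, fun ρ => ?_⟩
  simp only [SF.Eval, eval_ren, Fin.cons_zero]
  refine exists_congr fun x => and_congr_right fun _ => ?_
  refine (h2 (cns x ρ)).trans ?_
  refine iff_of_eq (congrArg _ (funext fun i => ?_))
  rcases hi : ts i with k | c
  · cases k with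
    | zero => simp [tm, cns]
    | succ k => simp [hi, tm, cns, -Fin.castSucc_succ]
  · simp [hi, tm, -Fin.castSucc_succ]

/-- fix the tail environment -/
theorem Dp.fix {P : (ℕ → M) → M → Prop} (h : Dp (fun ρ => P (shift ρ) (ρ 0))) (ρ₁ : ℕ → M) :
    Dp (fun ρ => P ρ₁ (ρ 0)) :=
  (h.subst (fun k => match k with | 0 => .inl 0 | k+1 => .inr (ρ₁ k))).congr fun _ => Iff.rfl

open Classical in
theorem Dp.out1 {P : M → Prop} (h : Dp (fun ρ => P (ρ 0))) :
    ∃ (n : ℕ) (φ : SF (n+1)) (p : Fin n → M), φ.IsDelta0P ∧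
      ∀ x, P x ↔ φ.Eval MK.E (Fin.snoc p x) := by
  obtain ⟨n, φ, ts, h1, h2⟩ := h
  refine ⟨n, ren φ (fun i => if ts i = .inl 0 then Fin.last n else i.castSucc),
    fun i => tm (ts i) (fun _ => emp), delta_ren _ _ h1, fun x => ?_⟩
  refine (h2 (cns x (fun _ => emp))).trans ?_
  rw [eval_ren]
  refine iff_of_eq (congrArg _ (funext fun i => ?_))
  rcases hi : ts i with k | c
  · cases k with
    | zero => simp [tm, cns]
    | succ k => simp [hi, tm, cns]
  · simp [hi, tm]

open Classical in
theorem Dp.out2 {P : M → M → Prop} (h : Dp (fun ρ => P (ρ 1) (ρ 0))) :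
    ∃ (n : ℕ) (φ : SF (n+2)) (p : Fin n → M), φ.IsDelta0P ∧
      ∀ x y, P x y ↔ φ.Eval MK.E (Fin.snoc (Fin.snoc p x : Fin (n+1) → M) y) := by
  obtain ⟨n, φ, ts, h1, h2⟩ := h
  refine ⟨n, ren φ (fun i => if ts i = .inl 0 then Fin.last (n+1) else if ts i = .inl 1 then
    (Fin.last n).castSucc else i.castSucc.castSucc),
    fun i => tm (ts i) (fun _ => emp), delta_ren _ _ h1, fun x y => ?_⟩
  refine (h2 (cns y (cns x (fun _ => emp)))).trans ?_
  rw [eval_ren]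
  refine iff_of_eq (congrArg _ (funext fun i => ?_))
  rcases hi : ts i with k | c
  · rcases k with _ | _ | k
    · simp [tm, cns]
    · simp [tm, cns]
    · simp [hi, tm, cns]
  · simp [hi, tm]

theorem Dp.sep {P : M → Prop} (h : Dp (fun ρ => P (ρ 0))) (w : M) :
    ∃ y : M, ∀ x, x ∊ y ↔ (x ∊ w ∧ P x) := by
  obtain ⟨n, φ, p, h1, h2⟩ := h.out1
  obtain ⟨y, hy⟩ := sep_formula φ h1 p w
  exact ⟨y, fun x => by rw [hy, h2]⟩

theorem Dp.coll {P : M → M → Prop} (h : Dp (fun ρ => P (ρ 1) (ρ 0))) (w : M)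
    (hw : ∀ x, x ∊ w → ∃ y, P x y) : ∃ c : M, ∀ x, x ∊ w → ∃ y, y ∊ c ∧ P x y := by
  obtain ⟨n, φ, p, h1, h2⟩ := h.out2
  obtain ⟨c, hc⟩ := (MK.kpp (M := M)).2.1 n φ h1 p w (fun x hx => by
    obtain ⟨y, hy⟩ := hw x hx; exact ⟨y, (h2 x y).1 hy⟩)
  exact ⟨c, fun x hx => by
    obtain ⟨y, hy, hy'⟩ := hc x hx; exact ⟨y, hy, (h2 x y).2 hy'⟩⟩

/-- `∈`-induction for `Σ₁^𝒫` -/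
theorem Dp.ind {P : M → M → Prop} (h : Dp (fun ρ => P (ρ 1) (ρ 0)))
    (hi : ∀ x, (∀ z, z ∊ x → ∃ y, P z y) → ∃ y, P x y) (x : M) : ∃ y, P x y := by
  by_contra hx
  obtain ⟨n, φ, p, h1, h2⟩ := h.out2
  have key : ∀ x, (SF.all (.not φ)).Eval MK.E (Fin.snoc p x) ↔ ¬ ∃ y, P x y := by
    intro x
    simp only [SF.Eval, h2]
    push Not; rfl
  obtain ⟨y, hy, hy'⟩ := (MK.kpp (M := M)).2.2 n (.all (.not φ)) ⟨.not φ, h1, rfl⟩ p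
    ⟨x, (key x).2 hx⟩
  refine (key y).1 hy (hi y fun z hz => ?_)
  have := hy' z hz
  rw [key] at this
  exact not_not.1 this

/-! ### Sigma-1 predicates -/

class Sg (P : (ℕ → M) → Prop) : Prop where
  out : ∃ Q : (ℕ → M) → M → Prop, Dp (fun ρ => Q (shift ρ) (ρ 0)) ∧ ∀ ρ, P ρ ↔ ∃ y, Q ρ y

theorem Sg.congr {P Q : (ℕ → M) → Prop} (h : Sg P) (e : ∀ ρ, Q ρ ↔ P ρ) : Sg Q := by
  obtain ⟨R, h1, h2⟩ := h
  exact ⟨R, h1, fun ρ => (e ρ).trans (h2 ρ)⟩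

theorem Sg.subst {P : (ℕ → M) → Prop} (h : Sg P) (σ : ℕ → ℕ ⊕ M) :
    Sg (fun ρ => P (fun k => tm (σ k) ρ)) := by
  obtain ⟨R, h1, h2⟩ := h
  refine ⟨fun ρ y => R (fun k => tm (σ k) ρ) y, ?_, fun ρ => h2 _⟩
  refine (h1.subst (fun k => match k with
    | 0 => .inl 0
    | k+1 => (match σ k with | .inl m => .inl (m+1) | .inr c => .inr c))).congr fun ρ => ?_
  refine iff_of_eq (congrArg (fun r => R r (ρ 0)) (funext fun k => ?_))
  rcases hk : σ k <;> simp [tm, shift, hk]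

theorem Dp.sg {P : (ℕ → M) → Prop} (h : Dp P) : Sg P :=
  ⟨fun ρ _ => P ρ, (h.subst (fun k => .inl (k+1))).congr fun _ => Iff.rfl,
    fun ρ => ⟨fun h => ⟨emp, h⟩, fun ⟨_, h⟩ => h⟩⟩

/-- move variables : auxiliary substitution for a predicate with one distinguished variable -/
theorem Dp.lift1 {Q : (ℕ → M) → M → Prop} (h : Dp (fun ρ => Q (shift ρ) (ρ 0))) :
    Dp (fun ρ => Q (shift (shift ρ)) (ρ 0)) :=
  (h.subst (fun k => match k with | 0 => .inl 0 | k+1 => .inl (k+2))).congr fun _ => Iff.rfl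

theorem Sg.and {P Q : (ℕ → M) → Prop} (h : Sg P) (h' : Sg Q) : Sg (fun ρ => P ρ ∧ Q ρ) := by
  obtain ⟨R, h1, h2⟩ := h
  obtain ⟨S, h3, h4⟩ := h'
  refine ⟨fun ρ y => (∃ z, z ∊ y ∧ R ρ z) ∧ (∃ z, z ∊ y ∧ S ρ z), ?_, fun ρ => ?_⟩
  · exact (Dp.bexMem (P := fun ρ z => R (shift ρ) z) (.inl 0) h1.lift1).and
      (Dp.bexMem (P := fun ρ z => S (shift ρ) z) (.inl 0) h3.lift1)
  · rw [h2, h4]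
    constructor
    · rintro ⟨⟨a, ha⟩, ⟨b, hb⟩⟩
      exact ⟨upair a b, ⟨a, by simp [mem_upair], ha⟩, ⟨b, by simp [mem_upair], hb⟩⟩
    · rintro ⟨_, ⟨a, _, ha⟩, ⟨b, _, hb⟩⟩
      exact ⟨⟨a, ha⟩, ⟨b, hb⟩⟩

theorem Sg.or {P Q : (ℕ → M) → Prop} (h : Sg P) (h' : Sg Q) : Sg (fun ρ => P ρ ∨ Q ρ) := by
  obtain ⟨R, h1, h2⟩ := h
  obtain ⟨S, h3, h4⟩ := h'
  refine ⟨fun ρ y => R ρ y ∨ S ρ y, h1.or h3, fun ρ => ?_⟩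
  rw [h2, h4, exists_or]

theorem Sg.ex {P : (ℕ → M) → M → Prop} (h : Sg (fun ρ => P (shift ρ) (ρ 0))) :
    Sg (fun ρ => ∃ x, P ρ x) := by
  obtain ⟨R, h1, h2⟩ := h
  refine ⟨fun ρ w => ∃ x, x ∊ w ∧ ∃ y, y ∊ w ∧ R (cns x ρ) y, ?_, fun ρ => ?_⟩
  · refine Dp.bexMem (P := fun ρ x => ∃ y, y ∊ ρ 0 ∧ R (cns x (shift ρ)) y) (.inl 0) ?_
    refine Dp.bexMem (P := fun ρ y => R (cns (ρ 0) (shift (shift ρ))) y) (.inl 1) ?_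
    refine (h1.subst (fun k => match k with
      | 0 => .inl 0 | 1 => .inl 1 | k+2 => .inl (k+3))).congr fun ρ => ?_
    refine iff_of_eq (congrArg (fun r => R r (ρ 0)) (funext fun k => ?_))
    cases k <;> rfl
  · constructor
    · rintro ⟨x, hx⟩
      obtain ⟨y, hy⟩ := (h2 (cns x ρ)).1 hx
      exact ⟨upair x y, x, by simp [mem_upair], y, by simp [mem_upair], hy⟩
    · rintro ⟨_, x, _, y, _, hy⟩
      exact ⟨x, (h2 (cns x ρ)).2 ⟨y, hy⟩⟩

/-- `P ρ x` for fixed environment -/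
theorem Sg.fix {P : (ℕ → M) → M → Prop} (h : Sg (fun ρ => P (shift ρ) (ρ 0))) (ρ₁ : ℕ → M) :
    Sg (fun ρ => P ρ₁ (ρ 0)) :=
  (h.subst (fun k => match k with | 0 => .inl 0 | k+1 => .inr (ρ₁ k))).congr fun _ => Iff.rfl

theorem Sg.coll {P : M → M → Prop} (h : Sg (fun ρ => P (ρ 1) (ρ 0))) (w : M)
    (hw : ∀ x, x ∊ w → ∃ y, P x y) : ∃ c : M, ∀ x, x ∊ w → ∃ y, y ∊ c ∧ P x y := by
  obtain ⟨R, h1, h2⟩ := h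
  have key : ∀ x y, P x y ↔ ∃ z, R (cns y (cns x fun _ => emp)) z := fun x y =>
    h2 (cns y (cns x fun _ => emp))
  have hd : Dp (fun ρ => (fun x w => ∃ y, y ∊ w ∧ ∃ z, z ∊ w ∧ R (cns y (cns x fun _ => emp)) z)
      (ρ 1) (ρ 0)) := by
    refine Dp.bexMem (P := fun ρ y => ∃ z, z ∊ ρ 0 ∧ R (cns y (cns (ρ 1) fun _ => emp)) z)
      (.inl 0) ?_
    refine Dp.bexMem (P := fun ρ z => R (cns (ρ 0) (cns (ρ 2) fun _ => emp)) z) (.inl 1) ?_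
    refine (h1.subst (fun k => match k with
      | 0 => .inl 0 | 1 => .inl 1 | 2 => .inl 3 | k+3 => .inr emp)).congr fun ρ => ?_
    refine iff_of_eq (congrArg (fun r => R r (ρ 0)) (funext fun k => ?_))
    rcases k with _ | _ | k <;> rfl
  obtain ⟨c, hc⟩ := Dp.coll (P := fun x w => ∃ y, y ∊ w ∧ ∃ z, z ∊ w ∧ R (cns y (cns x fun _ => emp)) z) hd w (fun x hx => by
    obtain ⟨y, hy⟩ := hw x hx
    obtain ⟨z, hz⟩ := (key x y).1 hy
    exact ⟨upair y z, y, by simp [mem_upair], z, by simp [mem_upair], hz⟩)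
  refine ⟨Un c, fun x hx => ?_⟩
  obtain ⟨w', hw', y, hy, z, _, hz⟩ := hc x hx
  exact ⟨y, (mem_Un _ _).2 ⟨w', hw', hy⟩, (key x y).2 ⟨z, hz⟩⟩

theorem Sg.ball0 {P : (ℕ → M) → M → Prop} (s : ℕ ⊕ M)
    (h : Sg (fun ρ => P (shift ρ) (ρ 0))) : Sg (fun ρ => ∀ x, x ∊ tm s ρ → P ρ x) := by
  obtain ⟨R, h1, h2⟩ := h
  refine ⟨fun ρ w => ∀ x, x ∊ tm s ρ → ∃ y, y ∊ w ∧ R (cns x ρ) y, ?_, fun ρ => ?_⟩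
  · have e : ∀ ρ : ℕ → M, tm s (shift ρ) =
        tm (match s with | .inl m => .inl (m+1) | .inr c => .inr c) ρ := by
      intro ρ; cases s <;> rfl
    simp only [e]
    refine Dp.ballMem (P := fun ρ x => ∃ y, y ∊ ρ 0 ∧ R (cns x (shift ρ)) y) _ ?_
    refine Dp.bexMem (P := fun ρ y => R (cns (ρ 0) (shift (shift ρ))) y) (.inl 1) ?_
    refine (h1.subst (fun k => match k with
      | 0 => .inl 0 | 1 => .inl 1 | k+2 => .inl (k+3))).congr fun ρ => ?_
    refine iff_of_eq (congrArg (fun r => R r (ρ 0)) (funext fun k => ?_))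
    cases k <;> rfl
  · constructor
    · intro hx
      refine Dp.coll (P := fun x y => R (cns x ρ) y) ?_ _ fun x hx' => (h2 (cns x ρ)).1 (hx x hx')
      refine (h1.subst (fun k => match k with
        | 0 => .inl 0 | 1 => .inl 1 | k+2 => .inr (ρ k))).congr fun ρ' => ?_
      refine iff_of_eq (congrArg (fun r => R r (ρ' 0)) (funext fun k => ?_))
      cases k <;> rfl
    · rintro ⟨w, hw⟩ x hx
      obtain ⟨y, _, hy⟩ := hw x hx
      exact (h2 (cns x ρ)).2 ⟨y, hy⟩

theorem Sg.ind {P : M → Prop} (h : Sg (fun ρ => P (ρ 0)))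
    (hi : ∀ x, (∀ z, z ∊ x → P z) → P x) (x : M) : P x := by
  obtain ⟨R, h1, h2⟩ := h
  have key : ∀ x, P x ↔ ∃ y, R (cns x fun _ => emp) y := fun x => h2 (cns x fun _ => emp)
  rw [key]
  refine Dp.ind (P := fun x y => R (cns x fun _ => emp) y) ?_ (fun x hx => ?_) x
  · refine (h1.subst (fun k => match k with
        | 0 => .inl 0 | 1 => .inl 1 | k+2 => .inr emp)).congr fun ρ' => ?_
    refine iff_of_eq (congrArg (fun r => R r (ρ' 0)) (funext fun k => ?_))
    cases k <;> rfl
  · rw [← key]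
    exact hi x fun z hz => (key z).2 (hx z hz)

/-! ### Terms and Delta-1 predicates -/

class Tm (t : (ℕ → M) → M) : Prop where
  out : Sg (fun ρ => ρ 0 = t (shift ρ))

class Dl (P : (ℕ → M) → Prop) : Prop where
  pos : Sg P
  neg : Sg (fun ρ => ¬ P ρ)

theorem Dl.congr {P Q : (ℕ → M) → Prop} (h : Dl P) (e : ∀ ρ, Q ρ ↔ P ρ) : Dl Q :=
  ⟨h.pos.congr e, h.neg.congr fun ρ => not_congr (e ρ)⟩

theorem Dp.dl {P : (ℕ → M) → Prop} (h : Dp P) : Dl P := ⟨h.sg, h.not.sg⟩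

instance Tm.var (n : ℕ) : Tm (fun ρ : ℕ → M => ρ n) := ⟨(Dp.eq (.inl 0) (.inl (n+1))).sg⟩
instance Tm.const (c : M) : Tm (fun _ : ℕ → M => c) := ⟨(Dp.eq (.inl 0) (.inr c)).sg⟩

theorem Sg.sh {P : (ℕ → M) → Prop} (h : Sg P) : Sg (fun ρ => P (shift ρ)) :=
  (h.subst (fun k => .inl (k+1))).congr fun _ => Iff.rfl
theorem Dl.sh {P : (ℕ → M) → Prop} (h : Dl P) : Dl (fun ρ => P (shift ρ)) :=
  ⟨h.pos.sh, h.neg.sh⟩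
/-- substitution of a term for variable `0` in a `Sg` predicate -/
theorem Sg.app {P : (ℕ → M) → M → Prop} {t : (ℕ → M) → M} (ht : Tm t)
    (h : Sg (fun ρ => P (shift ρ) (ρ 0))) : Sg (fun ρ => P ρ (t ρ)) := by
  refine (Sg.ex (P := fun ρ x => x = t ρ ∧ P ρ x) (ht.out.and h)).congr fun ρ => ?_
  simp
theorem Dl.app {P : (ℕ → M) → M → Prop} {t : (ℕ → M) → M} (ht : Tm t)
    (h : Dl (fun ρ => P (shift ρ) (ρ 0))) : Dl (fun ρ => P ρ (t ρ)) :=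
  ⟨h.pos.app ht, h.neg.app (P := fun ρ x => ¬ P ρ x) ht⟩

instance Tm.sh1 (t : (ℕ → M) → M) [h : Tm t] : Tm (fun ρ => t (shift ρ)) :=
  ⟨(h.out.subst (fun k => match k with | 0 => .inl 0 | k+1 => .inl (k+2))).congr
    fun _ => Iff.rfl⟩
instance Tm.sh2 (t : (ℕ → M) → M) [h : Tm t] : Tm (fun ρ => t (shift (shift ρ))) :=
  Tm.sh1 (fun ρ => t (shift ρ))
instance Tm.sh3 (t : (ℕ → M) → M) [h : Tm t] : Tm (fun ρ => t (shift (shift (shift ρ)))) :=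
  Tm.sh2 (fun ρ => t (shift ρ))
instance Tm.sh4 (t : (ℕ → M) → M) [h : Tm t] :
    Tm (fun ρ => t (shift (shift (shift (shift ρ))))) :=
  Tm.sh3 (fun ρ => t (shift ρ))
instance Tm.sh5 (t : (ℕ → M) → M) [h : Tm t] :
    Tm (fun ρ => t (shift (shift (shift (shift (shift ρ)))))) :=
  Tm.sh4 (fun ρ => t (shift ρ))
instance Tm.sh6 (t : (ℕ → M) → M) [h : Tm t] :
    Tm (fun ρ => t (shift (shift (shift (shift (shift (shift ρ))))))) :=
  Tm.sh5 (fun ρ => t (shift ρ))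
instance Tm.sh7 (t : (ℕ → M) → M) [h : Tm t] :
    Tm (fun ρ => t (shift (shift (shift (shift (shift (shift (shift ρ)))))))) :=
  Tm.sh6 (fun ρ => t (shift ρ))

instance Dl.mem (s t : (ℕ → M) → M) [hs : Tm s] [ht : Tm t] : Dl (fun ρ => s ρ ∊ t ρ) := by
  have h0 : Dl (fun ρ : ℕ → M => ρ 1 ∊ ρ 0) := (Dp.mem (.inl 1) (.inl 0)).dl
  refine Dl.app (P := fun ρ x => x ∊ t ρ) hs ?_
  exact Dl.app (P := fun ρ x => ρ 0 ∊ x) (Tm.sh1 t) h0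
instance Dl.eq (s t : (ℕ → M) → M) [hs : Tm s] [ht : Tm t] : Dl (fun ρ => s ρ = t ρ) := by
  have h0 : Dl (fun ρ : ℕ → M => ρ 1 = ρ 0) := (Dp.eq (.inl 1) (.inl 0)).dl
  refine Dl.app (P := fun ρ x => x = t ρ) hs ?_
  exact Dl.app (P := fun ρ x => ρ 0 = x) (Tm.sh1 t) h0
instance Dl.not (P : (ℕ → M) → Prop) [h : Dl P] : Dl (fun ρ => ¬ P ρ) :=
  ⟨h.neg, h.pos.congr fun ρ => not_not⟩
instance Dl.and (P Q : (ℕ → M) → Prop) [h : Dl P] [h' : Dl Q] : Dl (fun ρ => P ρ ∧ Q ρ) :=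
  ⟨h.pos.and h'.pos, (h.neg.or h'.neg).congr fun ρ => not_and_or⟩
instance Dl.or (P Q : (ℕ → M) → Prop) [h : Dl P] [h' : Dl Q] : Dl (fun ρ => P ρ ∨ Q ρ) :=
  ⟨h.pos.or h'.pos, (h.neg.and h'.neg).congr fun ρ => not_or⟩
instance Dl.imp (P Q : (ℕ → M) → Prop) [h : Dl P] [h' : Dl Q] : Dl (fun ρ => P ρ → Q ρ) :=
  (Dl.or (fun ρ => ¬ P ρ) Q).congr fun ρ => imp_iff_not_or
instance Dl.iff (P Q : (ℕ → M) → Prop) [h : Dl P] [h' : Dl Q] : Dl (fun ρ => P ρ ↔ Q ρ) :=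
  (Dl.and (fun ρ => P ρ → Q ρ) (fun ρ => Q ρ → P ρ)).congr fun ρ => iff_iff_implies_and_implies
theorem Sg.ball {P : (ℕ → M) → M → Prop} {s : (ℕ → M) → M} (hs : Tm s)
    (h : Sg (fun ρ => P (shift ρ) (ρ 0))) : Sg (fun ρ => ∀ x, x ∊ s ρ → P ρ x) := by
  refine Sg.app (P := fun ρ w => ∀ x, x ∊ w → P ρ x) hs ?_
  exact Sg.ball0 (P := fun ρ x => P (shift ρ) x) (.inl 0)
    ((h.subst (fun k => match k with | 0 => .inl 0 | k+1 => .inl (k+2))).congr fun _ => Iff.rfl)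
theorem Sg.bex {P : (ℕ → M) → M → Prop} {s : (ℕ → M) → M} (hs : Tm s)
    (h : Sg (fun ρ => P (shift ρ) (ρ 0))) : Sg (fun ρ => ∃ x, x ∊ s ρ ∧ P ρ x) :=
  Sg.ex (P := fun ρ x => x ∊ s ρ ∧ P ρ x)
    ((Dl.mem (fun ρ => ρ 0) (fun ρ => s (shift ρ))).pos.and h)
instance Dl.ball (P : (ℕ → M) → M → Prop) (s : (ℕ → M) → M) [hs : Tm s]
    [h : Dl (fun ρ => P (shift ρ) (ρ 0))] : Dl (fun ρ => ∀ x, x ∊ s ρ → P ρ x) :=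
  ⟨h.pos.ball hs, (h.neg.bex (P := fun ρ x => ¬ P ρ x) hs).congr fun ρ => by
    push Not; rfl⟩
instance Dl.bex (P : (ℕ → M) → M → Prop) (s : (ℕ → M) → M) [hs : Tm s]
    [h : Dl (fun ρ => P (shift ρ) (ρ 0))] : Dl (fun ρ => ∃ x, x ∊ s ρ ∧ P ρ x) :=
  ⟨h.pos.bex hs, (h.neg.ball (P := fun ρ x => ¬ P ρ x) hs).congr fun ρ => by
    push Not; rfl⟩
instance Dl.sub (s t : (ℕ → M) → M) [hs : Tm s] [ht : Tm t] : Dl (fun ρ => s ρ ⊑ t ρ) := by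
  unfold Sub; infer_instance
instance Dl.top : Dl (fun _ : ℕ → M => True) :=
  (Dl.eq (fun ρ => ρ 0) (fun ρ => ρ 0)).congr fun ρ => by simp
instance Dl.bot : Dl (fun _ : ℕ → M => False) :=
  (Dl.not (fun _ => True)).congr fun ρ => by simp

/-! Sg instances -/
instance (priority := low) Sg.dl (P : (ℕ → M) → Prop) [h : Dl P] : Sg P := h.pos
instance Sg.iand (P Q : (ℕ → M) → Prop) [h : Sg P] [h' : Sg Q] : Sg (fun ρ => P ρ ∧ Q ρ) :=
  h.and h'
instance Sg.ior (P Q : (ℕ → M) → Prop) [h : Sg P] [h' : Sg Q] : Sg (fun ρ => P ρ ∨ Q ρ) :=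
  h.or h'
instance Sg.iball (P : (ℕ → M) → M → Prop) (s : (ℕ → M) → M) [hs : Tm s]
    [h : Sg (fun ρ => P (shift ρ) (ρ 0))] : Sg (fun ρ => ∀ x, x ∊ s ρ → P ρ x) := h.ball hs
instance Sg.iex (P : (ℕ → M) → M → Prop)
    [h : Sg (fun ρ => P (shift ρ) (ρ 0))] : Sg (fun ρ => ∃ x, P ρ x) := h.ex

/-- separation -/
theorem Dl.sep {P : M → Prop} (h : Dl (fun ρ => P (ρ 0))) (w : M) :
    ∃ y : M, ∀ x, x ∊ y ↔ (x ∊ w ∧ P x) := by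
  obtain ⟨R, h1, h2⟩ := h.pos
  obtain ⟨S, h3, h4⟩ := h.neg
  have h1' := fun x => h2 (cns x fun _ => emp)
  have h3' := fun x => h4 (cns x fun _ => emp)
  have hd : ∀ {R : (ℕ → M) → M → Prop}, Dp (fun ρ => R (shift ρ) (ρ 0)) →
      Dp (fun ρ => (fun x y => R (cns x fun _ => emp) y) (ρ 1) (ρ 0)) := by
    intro R h1
    refine (h1.subst (fun k => match k with
        | 0 => .inl 0 | 1 => .inl 1 | k+2 => .inr emp)).congr fun ρ' => ?_
    refine iff_of_eq (congrArg (fun r => R r (ρ' 0)) (funext fun k => ?_))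
    cases k <;> rfl
  obtain ⟨c, hc⟩ := ((hd h1).or (hd h3)).coll w (P := fun x y => R (cns x fun _ => emp) y ∨
      S (cns x fun _ => emp) y) (fun x _ => by
    by_cases hx : P x
    · exact ((h1' x).1 hx).imp fun _ => Or.inl
    · exact ((h3' x).1 hx).imp fun _ => Or.inr)
  obtain ⟨y, hy⟩ := Dp.sep (P := fun x => ∃ y, y ∊ c ∧ R (cns x fun _ => emp) y)
    (Dp.bexMem (P := fun ρ y => R (cns (ρ 0) fun _ => emp) y) (.inr c) (hd h1)) w
  refine ⟨y, fun x => (hy x).trans (and_congr_right fun hx => ?_)⟩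
  constructor
  · rintro ⟨z, _, hz⟩; exact (h1' x).2 ⟨z, hz⟩
  · intro hp
    obtain ⟨z, hz, hz' | hz'⟩ := hc x hx
    · exact ⟨z, hz, hz'⟩
    · exact absurd hp ((h3' x).2 ⟨z, hz'⟩)

/-- a term defined by extensional comprehension -/
theorem Tm.of_sep {t s : (ℕ → M) → M} {P : (ℕ → M) → M → Prop} [hs : Tm s]
    [hP : Dl (fun ρ => P (shift ρ) (ρ 0))]
    (h : ∀ ρ z, z ∊ t ρ ↔ z ∊ s ρ ∧ P ρ z) : Tm t := by
  refine ⟨?_⟩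
  have hP2 : Dl (fun ρ => P (shift (shift ρ)) (ρ 0)) := by
    have aux : ∀ {R : (ℕ → M) → M → Prop}, Sg (fun ρ => R (shift ρ) (ρ 0)) →
        Sg (fun ρ => R (shift (shift ρ)) (ρ 0)) := fun h =>
      (h.subst (fun k => match k with | 0 => .inl 0 | k+1 => .inl (k+2))).congr fun _ => Iff.rfl
    exact ⟨aux hP.pos, aux (R := fun ρ x => ¬ P ρ x) hP.neg⟩
  have : Dl (fun ρ => (∀ z, z ∊ ρ 0 → (z ∊ s (shift ρ) ∧ P (shift ρ) z)) ∧
      (∀ z, z ∊ s (shift ρ) → (P (shift ρ) z → z ∊ ρ 0))) := inferInstance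
  refine this.pos.congr fun ρ => ⟨fun e => ?_, fun e => ext fun z => ?_⟩
  · rw [e]; exact ⟨fun z hz => (h _ z).1 hz, fun z h1 h2 => (h _ z).2 ⟨h1, h2⟩⟩
  · rw [h]; exact ⟨e.1 z, fun k => e.2 z k.1 k.2⟩

/-- a term whose elements are Delta-1 and bounded -/
theorem Tm.of_graph {t : (ℕ → M) → M} {P : (ℕ → M) → M → Prop}
    [hP : Sg (fun ρ => P (shift ρ) (ρ 0))]
    (h : ∀ ρ z, z = t ρ ↔ P ρ z) : Tm t :=
  ⟨hP.congr fun ρ => h _ _⟩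

theorem Tm.congr {s t : (ℕ → M) → M} (h : Tm s) (e : ∀ ρ, t ρ = s ρ) : Tm t := by
  have : t = s := funext e
  rwa [this]

open Classical in
instance Tm.ite (P : (ℕ → M) → Prop) (s t : (ℕ → M) → M) [hP : Dl P] [hs : Tm s] [ht : Tm t] :
    Tm (fun ρ => if P ρ then s ρ else t ρ) := by
  have h1 := hP.sh
  refine Tm.of_graph (P := fun ρ z => (P ρ ∧ z = s ρ) ∨ (¬ P ρ ∧ z = t ρ)) fun ρ z => ?_
  by_cases h : P ρ <;> simp [h]

/-- unary and binary functions -/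
class Tm1 (f : M → M) : Prop where
  out : Tm (fun ρ => f (ρ 0))
class Tm2 (f : M → M → M) : Prop where
  out : Tm (fun ρ => f (ρ 1) (ρ 0))

theorem Tm1.app {f : M → M} (h : Tm1 f) (t : (ℕ → M) → M) [ht : Tm t] :
    Tm (fun ρ => f (t ρ)) := by
  refine ⟨?_⟩
  have h1 : Sg (fun ρ : ℕ → M => ρ 1 = f (ρ 0)) :=
    (h.out.out.subst (fun k => match k with | 0 => .inl 1 | k+1 => .inl k)).congr fun _ => Iff.rfl
  exact Sg.app (P := fun ρ x => ρ 0 = f x) (Tm.sh1 t) h1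

theorem Tm2.app {f : M → M → M} (h : Tm2 f) (s t : (ℕ → M) → M) [hs : Tm s] [ht : Tm t] :
    Tm (fun ρ => f (s ρ) (t ρ)) := by
  refine ⟨?_⟩
  have h1 : Sg (fun ρ : ℕ → M => ρ 2 = f (ρ 1) (ρ 0)) :=
    (h.out.out.subst (fun k => match k with | 0 => .inl 2 | k+1 => .inl k)).congr fun _ => Iff.rfl
  have h2 : Sg (fun ρ : ℕ → M => ρ 1 = f (ρ 0) (t (shift (shift ρ)))) :=
    Sg.app (P := fun ρ x => ρ 1 = f (ρ 0) x) (Tm.sh2 t) h1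
  exact Sg.app (P := fun ρ x => ρ 0 = f x (t (shift ρ))) (Tm.sh1 s) h2

theorem Tm1.of {f : M → M} [h : Tm (fun ρ : ℕ → M => f (ρ 0))] : Tm1 f := ⟨h⟩
theorem Tm2.of {f : M → M → M} [h : Tm (fun ρ : ℕ → M => f (ρ 1) (ρ 0))] : Tm2 f := ⟨h⟩

/-- predicates of M-tuples -/
theorem Dl.app1 {P : M → Prop} (h : Dl (fun ρ => P (ρ 0))) (t : (ℕ → M) → M) [ht : Tm t] :
    Dl (fun ρ => P (t ρ)) :=
  Dl.app (P := fun _ x => P x) ht h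

end
end KPP


/-! # Part 2 : set operations and recursion -/

set_option linter.unusedVariables false
set_option linter.unusedSectionVars false
set_option linter.unusedSimpArgs false
set_option linter.style.longLine false

namespace KPP
section
variable {M : Type} [MK M]

theorem Dl.fix {P : (ℕ → M) → M → Prop} (h : Dl (fun ρ => P (shift ρ) (ρ 0))) (ρ₁ : ℕ → M) :
    Dl (fun ρ => P ρ₁ (ρ 0)) := ⟨h.pos.fix ρ₁, h.neg.fix (P := fun ρ x => ¬ P ρ x) ρ₁⟩
theorem Tm.fix {F : (ℕ → M) → M → M} (h : Tm (fun ρ => F (shift ρ) (ρ 0))) (ρ₁ : ℕ → M) :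
    Tm (fun ρ => F ρ₁ (ρ 0)) :=
  ⟨(h.out.subst (fun k => match k with | 0 => .inl 0 | 1 => .inl 1 | k+2 => .inr (ρ₁ k))).congr
    fun _ => Iff.rfl⟩
theorem Tm.lift1 {F : (ℕ → M) → M → M} (h : Tm (fun ρ => F (shift ρ) (ρ 0))) :
    Tm (fun ρ => F (shift (shift ρ)) (ρ 0)) :=
  ⟨(h.out.subst (fun k => match k with | 0 => .inl 0 | 1 => .inl 1 | k+2 => .inl (k+3))).congr
    fun _ => Iff.rfl⟩

instance Tm.upair (s t : (ℕ → M) → M) [Tm s] [Tm t] : Tm (fun ρ => upair (s ρ) (t ρ)) :=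
  Tm.of_graph (P := fun ρ b => s ρ ∊ b ∧ t ρ ∊ b ∧ ∀ z, z ∊ b → (z = s ρ ∨ z = t ρ)) fun ρ b => by
    constructor
    · rintro rfl; simp [mem_upair]
    · rintro ⟨h1, h2, h3⟩
      refine ext fun z => ⟨fun h => (mem_upair _ _ _).2 (h3 z h), fun h => ?_⟩
      rcases (mem_upair _ _ _).1 h with rfl | rfl <;> assumption

instance Tm.Un (s : (ℕ → M) → M) [Tm s] : Tm (fun ρ => Un (s ρ)) :=
  Tm.of_graph (P := fun ρ b => (∀ z, z ∊ b → ∃ y, y ∊ s ρ ∧ z ∊ y) ∧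
      ∀ y, y ∊ s ρ → ∀ z, z ∊ y → z ∊ b) fun ρ b => by
    constructor
    · rintro rfl; exact ⟨fun z h => (mem_Un _ _).1 h, fun y h z h' => (mem_Un _ _).2 ⟨y, h, h'⟩⟩
    · rintro ⟨h1, h2⟩
      exact ext fun z => ⟨fun h => (mem_Un _ _).2 (h1 z h), fun h => by
        obtain ⟨y, a, b⟩ := (mem_Un _ _).1 h; exact h2 y a z b⟩

theorem Tm1.Pow : Tm1 (KPP.Pow : M → M) := by
  refine ⟨Tm.of_graph (P := fun ρ b => (∀ z, z ∊ b → z ⊑ ρ 0) ∧ ¬ ∃ z, z ⊑ ρ 0 ∧ ¬ z ∊ b)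
    (hP := ?_) fun ρ b => ?_⟩
  · refine Sg.and inferInstance (Dp.not ?_).sg
    exact Dp.bexSub (P := fun ρ z => ¬ z ∊ ρ 0) (.inl 1) (Dp.mem (.inl 0) (.inl 1)).not
  · push Not
    constructor
    · rintro rfl; exact ⟨fun z h => (mem_Pow _ _).1 h, fun y h => (mem_Pow _ _).2 h⟩
    · rintro ⟨h1, h2⟩
      exact ext fun z => ⟨fun h => (mem_Pow _ _).2 (h1 z h), fun h => h2 z ((mem_Pow _ _).1 h)⟩
instance Tm.Pow (s : (ℕ → M) → M) [Tm s] : Tm (fun ρ => Pow (s ρ)) := Tm1.Pow.app s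

instance Tm.bun (s t : (ℕ → M) → M) [Tm s] [Tm t] : Tm (fun ρ => bun (s ρ) (t ρ)) := by
  unfold KPP.bun; infer_instance

/-- separation as an operation -/
noncomputable def sp (w : M) (P : M → Prop) : M :=
  open Classical in
  if h : ∃ y : M, ∀ x, x ∊ y ↔ (x ∊ w ∧ P x) then h.choose else emp

theorem mem_sp (w : M) (P : M → Prop) [h : Dl (fun ρ => P (ρ 0))] (z : M) :
    z ∊ sp w P ↔ z ∊ w ∧ P z := by
  have := h.sep w
  rw [sp, dif_pos this]
  exact this.choose_spec z

instance Tm.sp (s : (ℕ → M) → M) (P : (ℕ → M) → M → Prop) [hs : Tm s]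
    [h : Dl (fun ρ => P (shift ρ) (ρ 0))] : Tm (fun ρ => sp (s ρ) (P ρ)) :=
  Tm.of_sep (P := P) fun ρ z => mem_sp (h := h.fix ρ) _ _ _

theorem img_ex (w : M) (f : M → M) [h : Tm (fun ρ => f (ρ 0))] :
    ∃ y : M, ∀ z, z ∊ y ↔ ∃ x, x ∊ w ∧ z = f x := by
  have h0 : Tm1 f := ⟨h⟩
  have h1 : Tm (fun ρ : ℕ → M => f (ρ 1)) := h0.app _
  obtain ⟨c, hc⟩ := Sg.coll (P := fun x y => y = f x) inferInstance w (fun x _ => ⟨f x, rfl⟩)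
  have : Dl (fun ρ : ℕ → M => ∃ x, x ∊ w ∧ ρ 0 = f x) := inferInstance
  obtain ⟨y, hy⟩ := Dl.sep (P := fun z => ∃ x, x ∊ w ∧ z = f x) this c
  refine ⟨y, fun z => (hy z).trans (and_iff_right_of_imp ?_)⟩
  rintro ⟨x, hx, rfl⟩
  obtain ⟨y', h1, h2⟩ := hc x hx
  rwa [← h2]

/-- image -/
noncomputable def img (w : M) (f : M → M) : M :=
  open Classical in
  if h : ∃ y : M, ∀ z, z ∊ y ↔ ∃ x, x ∊ w ∧ z = f x then h.choose else emp

theorem mem_img (w : M) (f : M → M) [h : Tm (fun ρ => f (ρ 0))] (z : M) :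
    z ∊ img w f ↔ ∃ x, x ∊ w ∧ z = f x := by
  have := img_ex w f
  rw [img, dif_pos this]
  exact this.choose_spec z

instance Tm.img (s : (ℕ → M) → M) (F : (ℕ → M) → M → M) [hs : Tm s]
    [h : Tm (fun ρ => F (shift ρ) (ρ 0))] : Tm (fun ρ => img (s ρ) (F ρ)) := by
  have h1 := h.lift1
  have h2 : Tm (fun ρ => F (shift (shift (shift ρ))) (ρ 0)) := Tm.lift1 (F := fun ρ => F (shift ρ)) h1
  refine Tm.of_graph (P := fun ρ b => (∀ z, z ∊ b → ∃ x, x ∊ s ρ ∧ z = F ρ x) ∧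
      ∀ x, x ∊ s ρ → F ρ x ∊ b) fun ρ b => ?_
  have hm := mem_img (h := h.fix ρ) (s ρ) (F ρ)
  constructor
  · rintro rfl; exact ⟨fun z h => (hm _).1 h, fun x hx => (hm _).2 ⟨x, hx, rfl⟩⟩
  · rintro ⟨h1, h2⟩
    refine ext fun z => ⟨fun h => (hm _).2 (h1 z h), fun h => ?_⟩
    obtain ⟨x, hx, rfl⟩ := (hm _).1 h
    exact h2 x hx

theorem img_congr (w : M) (f g : M → M) [h : Tm (fun ρ => f (ρ 0))] [h' : Tm (fun ρ => g (ρ 0))]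
    (e : ∀ x, x ∊ w → f x = g x) : img w f = img w g := by
  refine ext fun z => ?_
  rw [mem_img, mem_img]
  exact exists_congr fun x => and_congr_right fun hx => by rw [e x hx]

/-! pairs -/
noncomputable def sing (x : M) : M := upair x x
theorem mem_sing (x z : M) : z ∊ sing x ↔ z = x := by simp [sing, mem_upair]
instance Tm.sing (s : (ℕ → M) → M) [Tm s] : Tm (fun ρ => sing (s ρ)) := by
  unfold KPP.sing; infer_instance
noncomputable def pr (x y : M) : M := upair (sing x) (upair x y)
instance Tm.pr (s t : (ℕ → M) → M) [Tm s] [Tm t] : Tm (fun ρ => pr (s ρ) (t ρ)) := by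
  unfold KPP.pr; infer_instance
theorem isPair_iff (p x y : M) : IsPair MK.E p x y ↔ p = pr x y := by
  have e1 : ∀ z : M, (∀ w, w ∊ z ↔ w = x) ↔ z = sing x := fun z =>
    ⟨fun h => ext fun w => by rw [h, mem_sing], fun h w => by rw [h, mem_sing]⟩
  have e2 : ∀ z : M, (∀ w, w ∊ z ↔ w = x ∨ w = y) ↔ z = upair x y := fun z =>
    ⟨fun h => ext fun w => by rw [h, mem_upair], fun h w => by rw [h, mem_upair]⟩
  unfold IsPair
  simp only [e1, e2]
  exact ⟨fun h => ext fun z => by rw [h, pr, mem_upair], fun h z => by rw [h, pr, mem_upair]⟩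
theorem pr_inj {x y x' y' : M} (h : pr x y = pr x' y') : x = x' ∧ y = y' := by
  have h1 : ∀ z, (z = sing x ∨ z = upair x y) ↔ (z = sing x' ∨ z = upair x' y') := by
    intro z
    have : z ∊ pr x y ↔ z ∊ pr x' y' := by rw [h]
    simpa [pr, mem_upair] using this
  have s1 : ∀ a b : M, sing a = sing b → a = b := fun a b h => by
    have := (mem_sing a a).2 rfl
    rw [h, mem_sing] at this; exact this
  have s2 : ∀ a b c : M, sing a = upair b c → b = a ∧ c = a := fun a b c h =>
    ⟨(mem_sing _ _).1 (h ▸ (mem_upair _ _ _).2 (Or.inl rfl)),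
      (mem_sing _ _).1 (h ▸ (mem_upair _ _ _).2 (Or.inr rfl))⟩
  have hx : x = x' := by
    rcases (h1 (sing x)).1 (Or.inl rfl) with h | h
    · exact s1 _ _ h
    · exact (s2 _ _ _ h).1.symm
  subst hx
  refine ⟨rfl, ?_⟩
  rcases (h1 (upair x y)).1 (Or.inr rfl) with h | h
  · have := (s2 _ _ _ h.symm).2
    rcases (h1 (upair x y')).2 (Or.inr rfl) with h' | h'
    · rw [this, (s2 _ _ _ h'.symm).2]
    · have := (mem_upair x y y').1 (h' ▸ (mem_upair _ _ _).2 (Or.inr rfl))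
      rcases this with e | e
      · simp_all
      · exact e.symm
  · have := (mem_upair x y' y).1 (h ▸ (mem_upair _ _ _).2 (Or.inr rfl))
    rcases this with e | e
    · have := (mem_upair x y y').1 (h.symm ▸ (mem_upair _ _ _).2 (Or.inr rfl))
      rcases this with e' | e'
      · rw [e, e']
      · exact e'.symm
    · exact e
@[simp] theorem pr_inj_iff {x y x' y' : M} : pr x y = pr x' y' ↔ x = x' ∧ y = y' :=
  ⟨pr_inj, fun h => by rw [h.1, h.2]⟩

theorem Un_sing (x : M) : Un (sing x) = x := ext fun z => by simp [mem_Un, mem_sing]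
theorem Un_eq {s x : M} (h : ∀ z, z ∊ s ↔ z = x) : Un s = x := by
  rw [← Un_sing x]; congr 1; exact ext fun z => by rw [h, mem_sing]
theorem Un_pr (x y z : M) : z ∊ Un (pr x y) ↔ z = x ∨ z = y := by
  simp [mem_Un, pr, mem_upair, mem_sing]
theorem fst_UnUn {x y f : M} (h : pr x y ∊ f) : x ∊ Un (Un f) :=
  (mem_Un _ _).2 ⟨sing x, (mem_Un _ _).2 ⟨_, h, by simp [pr, mem_upair]⟩, by simp [mem_sing]⟩
theorem snd_UnUn {x y f : M} (h : pr x y ∊ f) : y ∊ Un (Un f) :=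
  (mem_Un _ _).2 ⟨upair x y, (mem_Un _ _).2 ⟨_, h, by simp [pr, mem_upair]⟩, by simp [mem_upair]⟩

noncomputable def fst (p : M) : M := Un (sp (Un p) (fun x => ∃ y, y ∊ Un p ∧ p = pr x y))
noncomputable def snd (p : M) : M := Un (sp (Un p) (fun y => ∃ x, x ∊ Un p ∧ p = pr x y))
noncomputable def app (f x : M) : M := Un (sp (Un (Un f)) (fun y => pr x y ∊ f))
instance Tm.fst (s : (ℕ → M) → M) [Tm s] : Tm (fun ρ => fst (s ρ)) := by
  unfold KPP.fst; infer_instance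
instance Tm.snd (s : (ℕ → M) → M) [Tm s] : Tm (fun ρ => snd (s ρ)) := by
  unfold KPP.snd; infer_instance
instance Tm.app (s t : (ℕ → M) → M) [Tm s] [Tm t] : Tm (fun ρ => app (s ρ) (t ρ)) := by
  unfold KPP.app; infer_instance
@[simp] theorem fst_pr (x y : M) : fst (pr x y) = x := Un_eq fun z => by
  rw [mem_sp]; simp only [Un_pr, pr_inj_iff]
  constructor
  · rintro ⟨_, _, _, rfl, _⟩; rfl
  · rintro rfl; exact ⟨Or.inl rfl, y, Or.inr rfl, rfl, rfl⟩
@[simp] theorem snd_pr (x y : M) : snd (pr x y) = y := Un_eq fun z => by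
  rw [mem_sp]; simp only [Un_pr, pr_inj_iff]
  constructor
  · rintro ⟨_, _, _, _, rfl⟩; rfl
  · rintro rfl; exact ⟨Or.inr rfl, x, Or.inl rfl, rfl, rfl⟩
theorem app_eq {f x y : M} (h : pr x y ∊ f) (h' : ∀ z, pr x z ∊ f → z = y) : app f x = y :=
  Un_eq fun z => by
    rw [mem_sp]
    exact ⟨fun k => h' z k.2, fun k => by subst k; exact ⟨snd_UnUn h, h⟩⟩

noncomputable def prod (a b : M) : M := Un (img a (fun x => img b (fun y => pr x y)))
instance Tm.prod (s t : (ℕ → M) → M) [Tm s] [Tm t] : Tm (fun ρ => prod (s ρ) (t ρ)) := by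
  unfold KPP.prod; infer_instance
theorem mem_prod (a b z : M) : z ∊ prod a b ↔ ∃ x y, x ∊ a ∧ y ∊ b ∧ z = pr x y := by
  rw [prod, mem_Un]
  simp only [mem_img]
  constructor
  · rintro ⟨_, ⟨x, hx, rfl⟩, hz⟩
    rw [mem_img] at hz
    obtain ⟨y, hy, rfl⟩ := hz
    exact ⟨x, y, hx, hy, rfl⟩
  · rintro ⟨x, y, hx, hy, rfl⟩
    exact ⟨_, ⟨x, hx, rfl⟩, (mem_img _ _ _).2 ⟨y, hy, rfl⟩⟩
@[simp] theorem pr_mem_prod (a b x y : M) : pr x y ∊ prod a b ↔ x ∊ a ∧ y ∊ b := by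
  rw [mem_prod]
  constructor
  · rintro ⟨x', y', h1, h2, e⟩
    obtain ⟨rfl, rfl⟩ := pr_inj e
    exact ⟨h1, h2⟩
  · rintro ⟨h1, h2⟩; exact ⟨x, y, h1, h2, rfl⟩

noncomputable def int (a b : M) : M := sp a (fun x => x ∊ b)
theorem mem_int (a b z : M) : z ∊ int a b ↔ z ∊ a ∧ z ∊ b := mem_sp _ _ _
instance Tm.int (s t : (ℕ → M) → M) [Tm s] [Tm t] : Tm (fun ρ => int (s ρ) (t ρ)) := by
  unfold KPP.int; infer_instance
noncomputable def suc (x : M) : M := bun x (sing x)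
theorem mem_suc (x z : M) : z ∊ suc x ↔ z ∊ x ∨ z = x := by rw [suc, mem_bun, mem_sing]
instance Tm.suc (s : (ℕ → M) → M) [Tm s] : Tm (fun ρ => suc (s ρ)) := by
  unfold KPP.suc; infer_instance

theorem not_mem_self (x : M) : ¬ x ∊ x := by
  intro h
  obtain ⟨y, hy, hy'⟩ := fnd (sing x) ⟨x, (mem_sing _ _).2 rfl⟩
  rw [mem_sing] at hy; subst hy
  exact hy' y h ((mem_sing _ _).2 rfl)
theorem not_mem_cycle {x y : M} (h : x ∊ y) (h' : y ∊ x) : False := by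
  obtain ⟨z, hz, hz'⟩ := fnd (upair x y) ⟨x, (mem_upair _ _ _).2 (Or.inl rfl)⟩
  rcases (mem_upair _ _ _).1 hz with rfl | rfl
  · exact hz' y h' ((mem_upair _ _ _).2 (Or.inr rfl))
  · exact hz' x h ((mem_upair _ _ _).2 (Or.inl rfl))

/-! ### Recursion -/
def Tr (t : M) : Prop := ∀ y, y ∊ t → ∀ z, z ∊ y → z ∊ t
instance Dl.Tr (s : (ℕ → M) → M) [Tm s] : Dl (fun ρ => Tr (s ρ)) := by
  unfold KPP.Tr; infer_instance

/-- ternary terms -/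
class Tm3 (f : M → M → M → M) : Prop where
  out : Tm (fun ρ => f (ρ 2) (ρ 1) (ρ 0))
theorem Tm3.app {f : M → M → M → M} (h : Tm3 f) (r s t : (ℕ → M) → M) [hr : Tm r] [hs : Tm s]
    [ht : Tm t] : Tm (fun ρ => f (r ρ) (s ρ) (t ρ)) := by
  refine ⟨?_⟩
  have h1 : Sg (fun ρ : ℕ → M => ρ 3 = f (ρ 2) (ρ 1) (ρ 0)) :=
    (h.out.out.subst (fun k => match k with | 0 => .inl 3 | k+1 => .inl k)).congr fun _ => Iff.rfl
  have h2 : Sg (fun ρ : ℕ → M => ρ 2 = f (ρ 1) (ρ 0) (t (shift (shift (shift ρ))))) :=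
    Sg.app (P := fun ρ x => ρ 2 = f (ρ 1) (ρ 0) x) (Tm.sh3 t) h1
  have h3 : Sg (fun ρ : ℕ → M => ρ 1 = f (ρ 0) (s (shift (shift ρ))) (t (shift (shift ρ)))) :=
    Sg.app (P := fun ρ x => ρ 1 = f (ρ 0) x (t (shift (shift ρ)))) (Tm.sh2 s) h2
  exact Sg.app (P := fun ρ x => ρ 0 = f x (s (shift ρ)) (t (shift ρ))) (Tm.sh1 r) h3

section Recursion
variable (G : M → M → M → M)

noncomputable def gr (f x : M) : M := img x (fun y => pr y (app f y))
instance Tm.gr (s t : (ℕ → M) → M) [Tm s] [Tm t] : Tm (fun ρ => gr (s ρ) (t ρ)) := by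
  unfold KPP.gr; infer_instance
theorem gr_congr {f f' x : M} (h : ∀ y, y ∊ x → app f y = app f' y) : gr f x = gr f' x :=
  img_congr _ _ _ fun y hy => by rw [h y hy]

def Good (p t f : M) : Prop := Tr t ∧ ∀ x, x ∊ t → app f x = G p x (gr f x)

variable {G}
theorem Dl.Good (hG : Tm3 G) (p t f : (ℕ → M) → M) [Tm p] [Tm t] [Tm f] :
    Dl (fun ρ => Good G (p ρ) (t ρ) (f ρ)) := by
  unfold KPP.Good
  have := hG.app (fun ρ => p (shift ρ)) (fun ρ => ρ 0) (fun ρ => KPP.gr (f (shift ρ)) (ρ 0))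
  infer_instance

theorem Good.uniq (hG : Tm3 G) {p t f t' f' : M} (h : Good G p t f) (h' : Good G p t' f') (x : M) :
    x ∊ t → x ∊ t' → app f x = app f' x := by
  refine Sg.ind (P := fun x => x ∊ t → x ∊ t' → app f x = app f' x) inferInstance
    (fun x ih h1 h2 => ?_) x
  rw [h.2 x h1, h'.2 x h2, gr_congr fun y hy => ih y hy (h.1 x h1 y hy) (h'.1 x h2 y hy)]

theorem Good.ex (hG : Tm3 G) (p x : M) : ∃ t f, x ∊ t ∧ Good G p t f := by
  refine Sg.ind (P := fun x => ∃ t f, x ∊ t ∧ Good G p t f) ?_ (fun x ih => ?_) x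
  · have := Dl.Good hG (fun _ => p) (fun ρ => ρ 1) (fun ρ => ρ 0)
    infer_instance
  obtain ⟨c, hc⟩ := Sg.coll (P := fun z u => ∃ t f, u = pr t f ∧ z ∊ t ∧ Good G p t f) (by
    have := Dl.Good hG (fun _ => p) (fun ρ => ρ 1) (fun ρ => ρ 0)
    infer_instance) x (fun z hz => by
      obtain ⟨t, f, h⟩ := ih z hz
      exact ⟨pr t f, t, f, rfl, h⟩)
  have hGd := Dl.Good hG (fun _ => p) (fun ρ => fst (ρ 0)) (fun ρ => snd (ρ 0))
  obtain ⟨c', hc'⟩ : ∃ c', ∀ u, u ∊ c' ↔ u ∊ c ∧ Good G p (fst u) (snd u) :=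
    ⟨_, mem_sp c (fun u => Good G p (fst u) (snd u))⟩
  obtain ⟨T, hT⟩ : ∃ T, ∀ z, z ∊ T ↔ ∃ u, u ∊ c' ∧ z ∊ fst u := ⟨Un (img c' (fun u => fst u)), by
    intro z; rw [mem_Un]; simp only [mem_img]
    exact ⟨fun ⟨y, ⟨u, hu, e⟩, hz⟩ => ⟨u, hu, e ▸ hz⟩, fun ⟨u, hu, hz⟩ => ⟨_, ⟨u, hu, rfl⟩, hz⟩⟩⟩
  obtain ⟨f', hf'⟩ : ∃ f', ∀ q, q ∊ f' ↔ ∃ u, u ∊ c' ∧ ∃ w, w ∊ fst u ∧ q = pr w (app (snd u) w) :=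
    ⟨Un (img c' (fun u => img (fst u) (fun w => pr w (app (snd u) w)))), by
      intro z; rw [mem_Un]; simp only [mem_img]
      constructor
      · rintro ⟨y, ⟨u, hu, rfl⟩, hz⟩
        rw [mem_img] at hz
        exact ⟨u, hu, hz⟩
      · rintro ⟨u, hu, hz⟩
        exact ⟨_, ⟨u, hu, rfl⟩, (mem_img _ _ _).2 hz⟩⟩
  have app' : ∀ u w, u ∊ c' → w ∊ fst u → app f' w = app (snd u) w := by
    intro u w hu hw
    refine app_eq ((hf' _).2 ⟨u, hu, w, hw, rfl⟩) fun z hz => ?_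
    obtain ⟨u', hu', w', hw', e⟩ := (hf' _).1 hz
    obtain ⟨rfl, rfl⟩ := pr_inj e
    exact ((hc' _).1 hu').2.uniq hG ((hc' _).1 hu).2 _ hw' hw
  have hTt : Tr T := by
    intro y hy z hz
    obtain ⟨u, hu, hy⟩ := (hT _).1 hy
    exact (hT _).2 ⟨u, hu, ((hc' _).1 hu).2.1 y hy z hz⟩
  have good : Good G p T f' := by
    refine ⟨hTt, fun w hw => ?_⟩
    obtain ⟨u, hu, hy⟩ := (hT _).1 hw
    rw [app' u w hu hy, ((hc' _).1 hu).2.2 w hy,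
      gr_congr fun y hy' => (app' u y hu (((hc' _).1 hu).2.1 w hy y hy')).symm]
  have hxT : ∀ z, z ∊ x → z ∊ T := by
    intro z hz
    obtain ⟨u, hu, t, f, rfl, h1, h2⟩ := hc z hz
    exact (hT _).2 ⟨_, (hc' _).2 ⟨hu, by simpa using h2⟩, by simpa using h1⟩
  by_cases hx : x ∊ T
  · exact ⟨T, f', hx, good⟩
  let y := G p x (gr f' x)
  let fnew := bun f' (sing (pr x y))
  have nx : ∀ z, ¬ pr x z ∊ f' := fun z hz => by
    obtain ⟨u, hu, w, hw, e⟩ := (hf' _).1 hz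
    obtain ⟨rfl, -⟩ := pr_inj e
    exact hx ((hT _).2 ⟨u, hu, hw⟩)
  have ax : app fnew x = y := by
    refine app_eq ((mem_bun _ _ _).2 (Or.inr ((mem_sing _ _).2 rfl))) fun z hz => ?_
    rcases (mem_bun _ _ _).1 hz with h | h
    · exact (nx z h).elim
    · exact (pr_inj ((mem_sing _ _).1 h)).2
  have aT : ∀ w, w ∊ T → app fnew w = app f' w := by
    intro w hw
    obtain ⟨u, hu, hwu⟩ := (hT _).1 hw
    rw [app' u w hu hwu]
    refine app_eq ((mem_bun _ _ _).2 (Or.inl ((hf' _).2 ⟨u, hu, w, hwu, rfl⟩))) fun z hz => ?_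
    rcases (mem_bun _ _ _).1 hz with h | h
    · obtain ⟨u', hu', w', hw', e⟩ := (hf' _).1 h
      obtain ⟨rfl, rfl⟩ := pr_inj e
      exact ((hc' _).1 hu').2.uniq hG ((hc' _).1 hu).2 _ hw' hwu
    · have := (pr_inj ((mem_sing _ _).1 h)).1
      subst this; exact (hx hw).elim
  refine ⟨bun T (sing x), fnew, (mem_bun _ _ _).2 (Or.inr ((mem_sing _ _).2 rfl)), ?_, ?_⟩
  · intro w hw z hz
    rcases (mem_bun _ _ _).1 hw with h | h
    · exact (mem_bun _ _ _).2 (Or.inl (hTt w h z hz))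
    · rw [mem_sing] at h; subst h
      exact (mem_bun _ _ _).2 (Or.inl (hxT z hz))
  · intro w hw
    rcases (mem_bun _ _ _).1 hw with h | h
    · rw [aT w h, good.2 w h, gr_congr fun z hz => (aT z (hTt w h z hz)).symm]
    · rw [mem_sing] at h; subst h
      rw [ax]
      change G p w (gr f' w) = _
      rw [gr_congr fun z hz => (aT z (hxT z hz)).symm]

variable (G) in
/-- function defined by recursion: `rec p x = G p x {(y, rec p y) : y ∈ x}` -/
noncomputable def rc (p x : M) : M :=
  open Classical in
  if h : ∃ y t f, x ∊ t ∧ Good G p t f ∧ y = app f x then h.choose else emp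

theorem rc_eq_app (hG : Tm3 G) {p t f x : M} (h : Good G p t f) (hx : x ∊ t) :
    rc G p x = app f x := by
  have : ∃ y t f, x ∊ t ∧ Good G p t f ∧ y = app f x := ⟨_, t, f, hx, h, rfl⟩
  rw [rc, dif_pos this]
  obtain ⟨t', f', h1, h2, h3⟩ := this.choose_spec
  rw [h3]
  exact h2.uniq hG h _ h1 hx

theorem Tm2.rc (hG : Tm3 G) : Tm2 (rc G) := by
  have := Dl.Good hG (fun ρ => ρ 4) (fun ρ => ρ 1) (fun ρ => ρ 0)
  refine ⟨Tm.of_graph (P := fun ρ z => ∃ t f, ρ 0 ∊ t ∧ Good G (ρ 1) t f ∧ z = KPP.app f (ρ 0))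
    fun ρ z => ?_⟩
  constructor
  · rintro rfl
    obtain ⟨t, f, h1, h2⟩ := Good.ex hG (ρ 1) (ρ 0)
    exact ⟨t, f, h1, h2, rc_eq_app hG h2 h1⟩
  · rintro ⟨t, f, h1, h2, rfl⟩
    exact (rc_eq_app hG h2 h1).symm

theorem rc_eq (hG : Tm3 G) (p x : M) : rc G p x = G p x (img x (fun y => pr y (rc G p y))) := by
  obtain ⟨t, f, h1, h2⟩ := Good.ex hG p x
  rw [rc_eq_app hG h2 h1, h2.2 x h1]
  congr 1
  have := (Tm2.rc hG).app (fun _ => p) (fun ρ => ρ 0)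
  exact img_congr _ _ _ fun y hy => by rw [rc_eq_app hG h2 (h2.1 x h1 y hy)]

end Recursion

end
end KPP


/-! # Part 3 : ordinals, omega, the cumulative hierarchy, compactness -/

set_option linter.unusedVariables false
set_option linter.unusedSectionVars false
set_option linter.unusedSimpArgs false
set_option linter.style.longLine false

namespace KPP
section
variable {M : Type} [MK M]

instance Sg.imp (P Q : (ℕ → M) → Prop) [h : Dl P] [h' : Sg Q] : Sg (fun ρ => P ρ → Q ρ) :=
  (h.neg.or h').congr fun ρ => imp_iff_not_or

def Ord (x : M) : Prop := Tr x ∧ ∀ y, y ∊ x → Tr y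
instance Dl.Ord (s : (ℕ → M) → M) [Tm s] : Dl (fun ρ => Ord (s ρ)) := by
  unfold KPP.Ord; infer_instance
theorem Ord.mem {a b : M} (h : Ord a) (hb : b ∊ a) : Ord b :=
  ⟨h.2 b hb, fun y hy => h.2 y (h.1 b hb y hy)⟩
theorem Ord.tri {a b : M} (ha : Ord a) (hb : Ord b) : a ∊ b ∨ a = b ∨ b ∊ a := by
  obtain ⟨t, ht, hab⟩ := tco_ex (upair a b)
  have h1 : a ∊ t := hab _ ((mem_upair _ _ _).2 (Or.inl rfl))
  have h2 : b ∊ t := hab _ ((mem_upair _ _ _).2 (Or.inr rfl))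
  have key : ∀ x, x ∊ t → Ord x → ∀ y, y ∊ t → Ord y → (x ∊ y ∨ x = y ∨ y ∊ x) := by
    refine Sg.ind (P := fun x => x ∊ t → Ord x → ∀ y, y ∊ t → Ord y → (x ∊ y ∨ x = y ∨ y ∊ x))
      inferInstance ?_
    intro x ihx hx ox
    refine Sg.ind (P := fun y => y ∊ t → Ord y → (x ∊ y ∨ x = y ∨ y ∊ x)) inferInstance ?_
    intro y ihy hy oy
    by_contra hcon
    push Not at hcon
    obtain ⟨n1, n2, n3⟩ := hcon
    refine n2 (ext fun z => ⟨fun hz => ?_, fun hz => ?_⟩)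
    · rcases ihx z hz (ht x hx z hz) (ox.mem hz) y hy oy with h | h | h
      · exact h
      · subst h; exact (n3 hz).elim
      · exact (n3 (ox.1 z hz y h)).elim
    · rcases ihy z hz (ht y hy z hz) (oy.mem hz) with h | h | h
      · exact (n1 (oy.1 z hz x h)).elim
      · subst h; exact (n1 hz).elim
      · exact h
  exact key a h1 ha b h2 hb
theorem Ord.sub_iff {a b : M} (ha : Ord a) (hb : Ord b) : a ⊑ b ↔ a ∊ b ∨ a = b := by
  constructor
  · intro h
    rcases ha.tri hb with h' | h' | h'
    · exact Or.inl h'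
    · exact Or.inr h'
    · exact (not_mem_self b (h b h')).elim
  · rintro (h | rfl)
    · exact fun z hz => hb.1 a h z hz
    · exact sub_refl _
theorem Ord.sub_of_mem {a b : M} (hb : Ord b) (h : a ∊ b) : a ⊑ b := fun z hz => hb.1 a h z hz
theorem Ord.suc {a : M} (ha : Ord a) : Ord (suc a) := by
  constructor
  · intro y hy z hz
    rw [mem_suc] at *
    rcases hy with h | rfl
    · exact Or.inl (ha.1 y h z hz)
    · exact Or.inl hz
  · intro y hy
    rw [mem_suc] at hy
    rcases hy with h | rfl
    · exact ha.2 y h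
    · exact ha.1
theorem Ord.Un {s : M} (hs : ∀ a, a ∊ s → Ord a) : Ord (Un s) := by
  constructor
  · intro y hy z hz
    rw [mem_Un] at *
    obtain ⟨a, h1, h2⟩ := hy
    exact ⟨a, h1, (hs a h1).1 y h2 z hz⟩
  · intro y hy
    rw [mem_Un] at hy
    obtain ⟨a, h1, h2⟩ := hy
    exact (hs a h1).2 y h2
theorem Ord.emp : Ord (emp : M) := ⟨fun y hy => (not_emp y hy).elim, fun y hy => (not_emp y hy).elim⟩

/-- least element for Delta classes of ordinals -/
theorem Dl.least {P : M → Prop} (h : Dl (fun ρ => P (ρ 0))) {a : M} (ha : KPP.Ord a) (hP : P a) :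
    ∃ b, KPP.Ord b ∧ b ⊑ a ∧ P b ∧ ∀ c, c ∊ b → ¬ P c := by
  have hm := mem_sp (suc a) P
  obtain ⟨b, hb, hb'⟩ := fnd (sp (suc a) P) ⟨a, (hm _).2 ⟨(mem_suc _ _).2 (Or.inr rfl), hP⟩⟩
  obtain ⟨h1, h2⟩ := (hm _).1 hb
  have hob := ha.suc.mem h1
  refine ⟨b, hob, (hob.sub_iff ha).2 ((mem_suc _ _).1 h1), h2, fun c hc hPc => hb' c hc ?_⟩
  exact (hm _).2 ⟨ha.suc.1 b h1 c hc, hPc⟩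

/-! ### omega -/
def Ind (a : M) : Prop := emp ∊ a ∧ ∀ x, x ∊ a → suc x ∊ a
instance Dl.Ind (s : (ℕ → M) → M) [Tm s] : Dl (fun ρ => Ind (s ρ)) := by
  unfold KPP.Ind; infer_instance
theorem inf_ex : ∃ a : M, Ind a := by
  obtain ⟨a, ⟨e, he, he'⟩, h2⟩ := (MK.kpp (M := M)).1.1.2.2.2.2.2.2.1
  refine ⟨a, ?_, fun x hx => ?_⟩
  · have : (emp : M) = e := ext fun z => ⟨fun h => (not_emp z h).elim, fun h => (he' z h).elim⟩
    rwa [this]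
  · obtain ⟨s, hs, hs'⟩ := h2 x hx
    have : suc x = s := ext fun z => by rw [mem_suc]; exact (hs' z).symm
    rwa [this]
noncomputable def om : M := sp inf_ex.choose (fun x => ∀ b, b ∊ Pow inf_ex.choose → Ind b → x ∊ b)
theorem mem_om (x : M) : x ∊ om ↔
    x ∊ inf_ex.choose ∧ ∀ b, b ∊ Pow inf_ex.choose → Ind b → x ∊ b := mem_sp _ _ _
theorem om_emp : (emp : M) ∊ om := (mem_om _).2 ⟨inf_ex.choose_spec.1, fun b _ h => h.1⟩
theorem om_suc {x : M} (h : x ∊ om) : suc x ∊ om := by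
  rw [mem_om] at *
  exact ⟨inf_ex.choose_spec.2 x h.1, fun b hb hi => hi.2 _ (h.2 b hb hi)⟩
theorem om_ind {P : M → Prop} (h : Dl (fun ρ => P (ρ 0))) (h0 : P emp)
    (hs : ∀ n, n ∊ om → P n → P (suc n)) (n : M) (hn : n ∊ om) : P n := by
  have hm := mem_sp om P
  have : n ∊ sp om P := ((mem_om n).1 hn).2 _ ((mem_Pow _ _).2 fun z hz =>
    ((mem_om z).1 ((hm z).1 hz).1).1) ⟨(hm _).2 ⟨om_emp, h0⟩, fun x hx => (hm _).2
      ⟨om_suc ((hm _).1 hx).1, hs _ ((hm _).1 hx).1 ((hm _).1 hx).2⟩⟩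
  exact ((hm _).1 this).2
theorem om_cases {n : M} (hn : n ∊ om) : n = emp ∨ ∃ m, m ∊ om ∧ n = suc m :=
  om_ind (P := fun n => n = emp ∨ ∃ m, m ∊ om ∧ n = suc m) inferInstance (Or.inl rfl)
    (fun n hn _ => Or.inr ⟨n, hn, rfl⟩) n hn
theorem om_Ord {n : M} (hn : n ∊ om) : Ord n :=
  om_ind (P := fun n => Ord n) inferInstance Ord.emp (fun n hn h => h.suc) n hn
theorem om_tr {n m : M} (hn : n ∊ om) (hm : m ∊ n) : m ∊ om := by
  refine om_ind (P := fun n => ∀ m, m ∊ n → m ∊ om) inferInstance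
    (fun m h => (not_emp m h).elim) (fun n hn h m hm => ?_) n hn m hm
  rcases (mem_suc _ _).1 hm with h' | rfl
  · exact h m h'
  · exact hn
theorem Ord_om : Ord (om : M) := ⟨fun _ h _ h' => om_tr h h', fun y hy => (om_Ord hy).1⟩
theorem om_ind_sg {P : M → Prop} (h : Sg (fun ρ => P (ρ 0))) (h0 : P emp)
    (hs : ∀ n, n ∊ om → P n → P (suc n)) (n : M) (hn : n ∊ om) : P n := by
  refine Sg.ind (P := fun n => n ∊ om → P n) inferInstance (fun x ih hx => ?_) n hn
  rcases om_cases hx with rfl | ⟨m, hm, rfl⟩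
  · exact h0
  · exact hs m hm (ih m ((mem_suc _ _).2 (Or.inr rfl)) hm)
theorem Un_suc {a : M} (ha : Tr a) : Un (suc a) = a := ext fun z => by
  rw [mem_Un]; simp only [mem_suc]
  constructor
  · rintro ⟨y, h | rfl, h'⟩
    · exact ha y h z h'
    · exact h'
  · exact fun h => ⟨a, Or.inr rfl, h⟩
theorem suc_inj {a b : M} (h : suc a = suc b) : a = b := by
  have h1 := (mem_suc b a).1 (h ▸ (mem_suc _ _).2 (Or.inr rfl))
  have h2 := (mem_suc a b).1 (h ▸ (mem_suc _ _).2 (Or.inr rfl))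
  rcases h1 with h1 | h1
  · rcases h2 with h2 | h2
    · exact (not_mem_cycle h1 h2).elim
    · exact h2.symm
  · exact h1
theorem suc_ne_emp (a : M) : suc a ≠ emp := fun h =>
  not_emp a (h ▸ (mem_suc _ _).2 (Or.inr rfl))

noncomputable def num : ℕ → M
  | 0 => emp
  | n+1 => suc (num n)
theorem num_om : ∀ k : ℕ, (num k : M) ∊ om
  | 0 => om_emp
  | k+1 => om_suc (num_om k)
theorem mem_num (k : ℕ) (z : M) : z ∊ num k ↔ ∃ j < k, z = num j := by
  induction k with
  | zero => simp [num, not_emp]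
  | succ k ih =>
    rw [num, mem_suc, ih]
    constructor
    · rintro (⟨j, hj, rfl⟩ | rfl)
      · exact ⟨j, by omega, rfl⟩
      · exact ⟨k, by omega, rfl⟩
    · rintro ⟨j, hj, rfl⟩
      rcases Nat.lt_succ_iff_lt_or_eq.1 hj with h | rfl
      · exact Or.inl ⟨j, h, rfl⟩
      · exact Or.inr rfl
theorem num_inj {i j : ℕ} (h : (num i : M) = num j) : i = j := by
  rcases lt_trichotomy i j with h' | h' | h'
  · have := (mem_num j (num i : M)).2 ⟨i, h', rfl⟩
    rw [h] at this; exact (not_mem_self _ this).elim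
  · exact h'
  · have := (mem_num i (num j : M)).2 ⟨j, h', rfl⟩
    rw [h] at this; exact (not_mem_self _ this).elim
@[simp] theorem num_inj_iff {i j : ℕ} : (num i : M) = num j ↔ i = j := ⟨num_inj, fun h => by rw [h]⟩
@[simp] theorem num_mem_num {i j : ℕ} : (num i : M) ∊ num j ↔ i < j := by
  rw [mem_num]
  constructor
  · rintro ⟨k, hk, h⟩; rw [num_inj h]; exact hk
  · exact fun h => ⟨i, h, rfl⟩
theorem num_sub_num {i j : ℕ} : (num i : M) ⊑ num j ↔ i ≤ j := by
  rw [(om_Ord (num_om i)).sub_iff (om_Ord (num_om j)), num_mem_num, num_inj_iff]; omega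
theorem acc_num {n : M} (hn : n ∊ om) (ha : Acc MK.E n) : ∃ k, n = num k := by
  induction ha with
  | intro n _ ih =>
    rcases om_cases hn with rfl | ⟨m, hm, rfl⟩
    · exact ⟨0, rfl⟩
    · obtain ⟨k, rfl⟩ := ih m ((mem_suc _ _).2 (Or.inr rfl)) hm
      exact ⟨k+1, rfl⟩
theorem num_acc (k : ℕ) : Acc MK.E (num k : M) := by
  induction k using Nat.strong_induction_on with
  | _ k ih =>
    refine ⟨_, fun z hz => ?_⟩
    obtain ⟨j, hj, rfl⟩ := (mem_num _ _).1 hz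
    exact ih j hj

/-! ### iteration -/
open Classical in
noncomputable def iterG (h : M → M) (p x g : M) : M := if x = emp then p else h (app g (Un x))
theorem Tm3.iterG {h : M → M} (hh : Tm1 h) : Tm3 (iterG h) := by
  have := hh.app (fun ρ : ℕ → M => KPP.app (ρ 0) (KPP.Un (ρ 1)))
  exact ⟨by unfold KPP.iterG; infer_instance⟩
noncomputable def iter (h : M → M) (a n : M) : M := rc (iterG h) a n
theorem Tm2.iter {h : M → M} (hh : Tm1 h) : Tm2 (iter h) := Tm2.rc (Tm3.iterG hh)
theorem iter_emp {h : M → M} (hh : Tm1 h) (a : M) : iter h a emp = a := by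
  rw [iter, rc_eq (Tm3.iterG hh), iterG, if_pos rfl]
theorem iter_suc {h : M → M} (hh : Tm1 h) (a n : M) (hn : n ∊ om) :
    iter h a (suc n) = h (iter h a n) := by
  rw [iter, rc_eq (Tm3.iterG hh), iterG, if_neg (suc_ne_emp n), Un_suc (om_Ord hn).1]
  congr 1
  have := (Tm2.rc (Tm3.iterG hh)).app (fun _ => a) (fun ρ => ρ 0)
  refine app_eq ((mem_img _ _ _).2 ⟨n, (mem_suc _ _).2 (Or.inr rfl), rfl⟩) fun z hz => ?_
  obtain ⟨x, _, e⟩ := (mem_img _ _ _).1 hz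
  obtain ⟨rfl, rfl⟩ := pr_inj e
  rfl
theorem iter_num {h : M → M} (hh : Tm1 h) (a : M) (k : ℕ) : iter h a (num k) = h^[k] a := by
  induction k with
  | zero => exact iter_emp hh a
  | succ k ih => rw [num, iter_suc hh a _ (num_om k), ih, Function.iterate_succ_apply']

/-! ### cumulative hierarchy -/
noncomputable def VG (p x g : M) : M := Un (img g (fun q => Pow (snd q)))
theorem Tm3.VG : Tm3 (VG : M → M → M → M) := ⟨by unfold KPP.VG; infer_instance⟩
noncomputable def V (x : M) : M := rc VG emp x
instance Tm.V (s : (ℕ → M) → M) [Tm s] : Tm (fun ρ => V (s ρ)) :=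
  (Tm2.rc Tm3.VG).app (fun _ => emp) s
theorem mem_V (x z : M) : z ∊ V x ↔ ∃ y, y ∊ x ∧ z ⊑ V y := by
  have : ∀ y : M, rc VG emp y = V y := fun _ => rfl
  rw [V, rc_eq Tm3.VG, VG, mem_Un]
  simp only [mem_img, this]
  constructor
  · rintro ⟨y, ⟨q, hq, rfl⟩, hz⟩
    obtain ⟨y, hy, rfl⟩ := hq
    rw [snd_pr, mem_Pow] at hz
    exact ⟨y, hy, hz⟩
  · rintro ⟨y, hy, hz⟩
    exact ⟨Pow (V y), ⟨pr y (V y), ⟨y, hy, rfl⟩, by rw [snd_pr]⟩,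
      (mem_Pow _ _).2 hz⟩
theorem V_sub {x z w : M} (h : w ∊ V x) (hz : z ⊑ w) : z ∊ V x := by
  rw [mem_V] at *
  obtain ⟨y, h1, h2⟩ := h
  exact ⟨y, h1, sub_trans hz h2⟩
theorem V_tr (x : M) : Tr (V x) := by
  refine Sg.ind (P := fun x => Tr (V x)) inferInstance (fun x ih => ?_) x
  intro w hw z hz
  obtain ⟨y, h1, h2⟩ := (mem_V _ _).1 hw
  exact (mem_V _ _).2 ⟨y, h1, fun u hu => ih y h1 z (h2 z hz) u hu⟩
theorem V_mono {x y : M} (h : x ⊑ y) : V x ⊑ V y := fun z hz => by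
  rw [mem_V] at *
  obtain ⟨w, h1, h2⟩ := hz
  exact ⟨w, h w h1, h2⟩
theorem V_mem {x y : M} (h : x ∊ y) : V x ∊ V y := (mem_V _ _).2 ⟨x, h, sub_refl _⟩
theorem sub_V (x : M) : x ⊑ V x := by
  refine Sg.ind (P := fun x => x ⊑ V x) inferInstance (fun x ih z hz => ?_) x
  exact (mem_V _ _).2 ⟨z, hz, ih z hz⟩

noncomputable def rkG (p x g : M) : M := Un (img g (fun q => suc (snd q)))
theorem Tm3.rkG : Tm3 (rkG : M → M → M → M) := ⟨by unfold KPP.rkG; infer_instance⟩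
noncomputable def rk (x : M) : M := rc rkG emp x
instance Tm.rk (s : (ℕ → M) → M) [Tm s] : Tm (fun ρ => rk (s ρ)) :=
  (Tm2.rc Tm3.rkG).app (fun _ => emp) s
theorem rk_eq (x : M) : rk x = Un (img x (fun y => suc (rk y))) := by
  have : ∀ y : M, rc rkG emp y = rk y := fun _ => rfl
  rw [rk, rc_eq Tm3.rkG, rkG]
  congr 1
  refine ext fun z => ?_
  simp only [mem_img, this]
  constructor
  · rintro ⟨q, hq, rfl⟩
    obtain ⟨y, hy, rfl⟩ := hq
    exact ⟨y, hy, by rw [snd_pr]⟩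
  · rintro ⟨y, hy, rfl⟩
    exact ⟨pr y (rk y), ⟨y, hy, rfl⟩, by rw [snd_pr]⟩
theorem Ord_rk (x : M) : Ord (rk x) := by
  refine Sg.ind (P := fun x => Ord (rk x)) inferInstance (fun x ih => ?_) x
  rw [rk_eq]
  refine Ord.Un fun a ha => ?_
  obtain ⟨y, hy, rfl⟩ := (mem_img _ _ _).1 ha
  exact (ih y hy).suc
theorem rk_mem {x y : M} (h : x ∊ y) : rk x ∊ rk y := by
  rw [rk_eq y, mem_Un]
  exact ⟨_, (mem_img _ _ _).2 ⟨x, h, rfl⟩, (mem_suc _ _).2 (Or.inr rfl)⟩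
theorem sub_V_rk (x : M) : x ⊑ V (rk x) := by
  refine Sg.ind (P := fun x => x ⊑ V (rk x)) inferInstance (fun x ih z hz => ?_) x
  exact (mem_V _ _).2 ⟨rk z, rk_mem hz, ih z hz⟩
theorem mem_V_rk (x : M) : x ∊ V (suc (rk x)) :=
  (mem_V _ _).2 ⟨rk x, (mem_suc _ _).2 (Or.inr rfl), sub_V_rk x⟩

/-- the coded hierarchy on an ordinal -/
theorem exists_IsRK (a : M) : ∃ α f β v : M, IsRK MK.E α f ∧ β ∊ α ∧ FunApp MK.E f β v ∧ a ∊ v := by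
  let β := suc (rk a)
  have hβ : Ord β := (Ord_rk a).suc
  let f := img (suc β) (fun γ => pr γ (V γ))
  have hf : ∀ γ v, FunApp MK.E f γ v ↔ γ ∊ suc β ∧ v = V γ := by
    intro γ v
    unfold FunApp
    simp only [isPair_iff]
    constructor
    · rintro ⟨_, h, rfl⟩
      obtain ⟨x, hx, e⟩ := (mem_img _ _ _).1 h
      obtain ⟨rfl, rfl⟩ := pr_inj e
      exact ⟨hx, rfl⟩
    · rintro ⟨h, rfl⟩
      exact ⟨_, (mem_img _ _ _).2 ⟨γ, h, rfl⟩, rfl⟩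
  refine ⟨suc β, f, β, V β, ⟨hβ.suc, ⟨?_, ?_, ?_⟩, ?_⟩, (mem_suc _ _).2 (Or.inr rfl),
    (hf _ _).2 ⟨(mem_suc _ _).2 (Or.inr rfl), rfl⟩, mem_V_rk a⟩
  · intro q hq
    obtain ⟨x, hx, rfl⟩ := (mem_img _ _ _).1 hq
    exact ⟨x, V x, (isPair_iff _ _ _).2 rfl, hx⟩
  · intro x y y' h h'
    rw [((hf _ _).1 h).2, ((hf _ _).1 h').2]
  · intro x hx
    exact ⟨V x, (hf _ _).2 ⟨hx, rfl⟩⟩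
  · intro γ v hγ hv x
    rw [((hf _ _).1 hv).2]
    refine (mem_V _ _).trans (exists_congr fun δ => and_congr_right fun hδ => ?_)
    constructor
    · exact fun h => ⟨V δ, (hf _ _).2 ⟨hβ.suc.1 γ hγ δ hδ, rfl⟩, h⟩
    · rintro ⟨w, hw, h⟩
      rw [((hf _ _).1 hw).2] at h
      exact h

/-! ### Sigma-1 foundation on ordinals -/
theorem Sg.least {D : M → Prop} (hD : Sg (fun ρ => D (ρ 0))) {a : M} (ha : Ord a) (hDa : D a) :
    ∃ b, Ord b ∧ D b ∧ ∀ c, c ∊ b → ¬ D c := by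
  by_contra hcon
  push Not at hcon
  obtain ⟨R, h1, h2⟩ := hD
  have h2' : ∀ x, D x ↔ ∃ y, R (cns x fun _ => emp) y := fun x => h2 (cns x fun _ => emp)
  -- bounded versions
  let Dd : M → M → Prop := fun δ x => ∃ y, y ∊ V δ ∧ R (cns x fun _ => emp) y
  have hR : Dl (fun ρ : ℕ → M => R (cns (ρ 1) fun _ => emp) (ρ 0)) := by
    refine Dp.dl ((h1.subst (fun k => match k with
        | 0 => .inl 0 | 1 => .inl 1 | k+2 => .inr emp)).congr fun ρ' => ?_)
    refine iff_of_eq (congrArg (fun r => R r (ρ' 0)) (funext fun k => ?_))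
    cases k <;> rfl
  have hR0 : Dl (fun ρ : ℕ → M => Dd (ρ 1) (ρ 0)) := by
    have : Dl (fun ρ : ℕ → M => (fun ρ' y => R (cns (ρ' 0) fun _ => emp) y) (shift ρ) (ρ 0)) := hR
    exact Dl.bex (fun ρ' y => R (cns (ρ' 0) fun _ => emp) y) (fun ρ => V (ρ 1))
  have hDd : ∀ (s t : (ℕ → M) → M) [Tm s] [Tm t], Dl (fun ρ => Dd (s ρ) (t ρ)) := by
    intro s t _ _
    have h3 : Dl (fun ρ : ℕ → M => Dd (ρ 0) (t (shift ρ))) :=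
      Dl.app (P := fun ρ x => Dd (ρ 0) x) (Tm.sh1 t) hR0
    exact Dl.app (P := fun ρ x => Dd x (t ρ)) inferInstance h3
  have hDmono : ∀ δ δ' x, δ ⊑ δ' → Dd δ x → Dd δ' x := fun δ δ' x h ⟨y, h3, h4⟩ =>
    ⟨y, V_mono h y h3, h4⟩
  have hDex : ∀ x, D x → ∃ δ, Ord δ ∧ Dd δ x := fun x hx => by
    obtain ⟨y, hy⟩ := (h2' x).1 hx
    exact ⟨_, (Ord_rk y).suc, y, mem_V_rk y, hy⟩
  have hDD : ∀ δ x, Dd δ x → D x := fun δ x ⟨y, _, hy⟩ => (h2' x).2 ⟨y, hy⟩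
  -- least element of level δ
  let Ls : M → M → Prop := fun δ γ => Dd δ γ ∧ ∀ γ', γ' ∊ γ → ¬ Dd δ γ'
  have hLs : ∀ (s t : (ℕ → M) → M) [Tm s] [Tm t], Dl (fun ρ => Ls (s ρ) (t ρ)) := by
    intro s t _ _
    have i1 := hDd s t
    have i2 := hDd (fun ρ => s (shift ρ)) (fun ρ => ρ 0)
    show Dl (fun ρ => Dd (s ρ) (t ρ) ∧ ∀ γ', γ' ∊ t ρ → ¬ Dd (s ρ) γ')
    infer_instance
  let lam : M → M := fun δ => Un (sp (suc a) (fun γ => Ls δ γ))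
  have hlam : Tm1 lam := by
    have := hLs (fun ρ => ρ 1) (fun ρ => ρ 0)
    exact ⟨inferInstanceAs (Tm (fun ρ => Un (sp (suc a) (fun γ => Ls (ρ 0) γ))))⟩
  let gd : M → Prop := fun δ => Ord δ ∧ ∃ γ, γ ∊ suc a ∧ Dd δ γ
  have hgd : ∀ (s : (ℕ → M) → M) [Tm s], Dl (fun ρ => gd (s ρ)) := by
    intro s _
    have := hDd (fun ρ => s (shift ρ)) (fun ρ => ρ 0)
    show Dl (fun ρ => Ord (s ρ) ∧ ∃ γ, γ ∊ suc a ∧ Dd (s ρ) γ)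
    infer_instance
  have lam_spec : ∀ δ, gd δ → lam δ ∊ suc a ∧ Ls δ (lam δ) := by
    rintro δ ⟨hδ, γ, hγ, hd⟩
    have i := hDd (fun _ => δ) (fun ρ => ρ 0)
    obtain ⟨b, hb1, hb2, hb3, hb4⟩ := i.least (ha.suc.mem hγ) hd
    have hba : b ∊ suc a := by
      rcases (hb1.sub_iff (ha.suc.mem hγ)).1 hb2 with h | rfl
      · exact ha.suc.1 γ hγ b h
      · exact hγ
    have : lam δ = b := by
      have i := hLs (fun _ => δ) (fun ρ => ρ 0)
      refine Un_eq fun z => ?_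
      rw [mem_sp]
      constructor
      · rintro ⟨hz, hz1, hz2⟩
        rcases (ha.suc.mem hz).tri hb1 with h | h | h
        · exact (hb4 z h hz1).elim
        · exact h
        · exact (hz2 b h hb3).elim
      · rintro rfl; exact ⟨hba, hb3, hb4⟩
    rw [this]; exact ⟨hba, hb3, hb4⟩
  have step : ∀ δ, gd δ → ∃ δ', gd δ' ∧ lam δ' ∊ lam δ := by
    intro δ hδ
    obtain ⟨l1, l2⟩ := lam_spec δ hδ
    obtain ⟨c, hc, hcD⟩ := hcon (lam δ) (ha.suc.mem l1) (hDD _ _ l2.1)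
    obtain ⟨δ', o', hd'⟩ := hDex c hcD
    have g' : gd δ' := ⟨o', c, ha.suc.1 _ l1 c hc, hd'⟩
    obtain ⟨m1, m2⟩ := lam_spec δ' g'
    refine ⟨δ', g', ?_⟩
    have oc := (ha.suc.mem l1).mem hc
    rcases (ha.suc.mem m1).tri oc with h | h | h
    · exact (ha.suc.mem l1).1 c hc _ h
    · rwa [h]
    · exact (m2.2 c h hd').elim
  let Nx : M → M → Prop := fun x z => (gd x ∧ gd z ∧ lam z ∊ lam x ∧
    ∀ δ, δ ∊ z → ¬ (gd δ ∧ lam δ ∊ lam x)) ∨ (¬ gd x ∧ z = emp)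
  have nx_ex : ∀ x, ∃ z, Nx x z := by
    intro x
    by_cases hx : gd x
    · obtain ⟨δ', h3, h4⟩ := step x hx
      have i1 := hgd (fun ρ => ρ 0)
      have i2 := hlam.app (fun ρ => ρ 0)
      have i : Dl (fun ρ : ℕ → M => gd (ρ 0) ∧ lam (ρ 0) ∊ lam x) := inferInstance
      obtain ⟨b, b1, _, b2, b3⟩ := Dl.least (P := fun z => gd z ∧ lam z ∊ lam x) i h3.1 ⟨h3, h4⟩
      exact ⟨b, Or.inl ⟨hx, b2.1, b2.2, b3⟩⟩
    · exact ⟨emp, Or.inr ⟨hx, rfl⟩⟩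
  have nx_un : ∀ x z z', Nx x z → Nx x z' → z = z' := by
    intro x z z' h3 h4
    rcases h3 with ⟨g, g1, l1, m1⟩ | ⟨g, rfl⟩
    · rcases h4 with ⟨_, g2, l2, m2⟩ | ⟨g', _⟩
      · rcases g1.1.tri g2.1 with h | h | h
        · exact (m2 _ h ⟨g1, l1⟩).elim
        · exact h
        · exact (m1 _ h ⟨g2, l2⟩).elim
      · exact (g' g).elim
    · rcases h4 with ⟨g', _⟩ | ⟨_, rfl⟩
      · exact (g g').elim
      · rfl
  choose nx hnx using nx_ex
  have tnx : Tm1 nx := by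
    have i1 := hgd (fun ρ => ρ 1)
    have i2 := hgd (fun ρ => ρ 0)
    have i3 := hlam.app (fun ρ => ρ 0)
    have i4 := hlam.app (fun ρ => ρ 1)
    have i5 := hlam.app (fun ρ => ρ 2)
    have i : Sg (fun ρ : ℕ → M => (gd (ρ 1) ∧ gd (ρ 0) ∧ lam (ρ 0) ∊ lam (ρ 1) ∧
      ∀ δ, δ ∊ (ρ 0) → ¬ (gd δ ∧ lam δ ∊ lam (ρ 1))) ∨ (¬ gd (ρ 1) ∧ (ρ 0) = emp)) := inferInstance
    exact ⟨Tm.of_graph (P := fun ρ z => Nx (ρ 0) z) (hP := i) fun ρ z =>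
      ⟨fun h => h ▸ hnx _, fun h => nx_un _ _ _ h (hnx _)⟩⟩
  obtain ⟨δ₀, o₀, hd₀⟩ := hDex a hDa
  have g₀ : gd δ₀ := ⟨o₀, a, (mem_suc _ _).2 (Or.inr rfl), hd₀⟩
  let sq : M → M := fun n => iter nx δ₀ n
  have tsq : Tm (fun ρ : ℕ → M => sq (ρ 0)) := (Tm2.iter tnx).app (fun _ => δ₀) (fun ρ => ρ 0)
  have gsq : ∀ n, n ∊ om → gd (sq n) := by
    have i := hgd (fun ρ => sq (ρ 0))
    refine om_ind (P := fun n => gd (sq n)) i ?_ fun n hn h => ?_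
    · show gd (iter nx δ₀ emp); rw [iter_emp tnx]; exact g₀
    · show gd (iter nx δ₀ (suc n)); rw [iter_suc tnx _ _ hn]
      rcases hnx (iter nx δ₀ n) with h' | h'
      · exact h'.2.1
      · exact (h'.1 h).elim
  have dsq : ∀ n, n ∊ om → lam (sq (suc n)) ∊ lam (sq n) := by
    intro n hn
    show lam (iter nx δ₀ (suc n)) ∊ _
    rw [iter_suc tnx _ _ hn]
    rcases hnx (iter nx δ₀ n) with h' | h'
    · exact h'.2.2.1
    · exact (h'.1 (gsq n hn)).elim
  have tl : Tm (fun ρ : ℕ → M => lam (sq (ρ 0))) := hlam.app (fun ρ => sq (ρ 0))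
  obtain ⟨y, hy, hy'⟩ := fnd (img om (fun n => lam (sq n))) ⟨_, (mem_img _ _ _).2 ⟨emp, om_emp, rfl⟩⟩
  obtain ⟨n, hn, rfl⟩ := (mem_img _ _ _).1 hy
  exact hy' _ (dsq n hn) ((mem_img _ _ _).2 ⟨suc n, om_suc hn, rfl⟩)

/-! ### Compactness -/
theorem compactness (A : M) (Q : M → M → M → Prop)
    (hQ : ∀ (r s t : (ℕ → M) → M) [Tm r] [Tm s] [Tm t], Dl (fun ρ => Q (r ρ) (s ρ) (t ρ)))
    (anti : ∀ a α β x x', Ord α → Ord β → β ⊑ α → x ⊑ x' → Q a α x' → Q a β x)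
    (h : ∀ α, Ord α → Acc MK.E α → ∀ x, ∃ a, a ∊ A ∧ Q a α x) :
    ∃ a, a ∊ A ∧ ∀ α, Ord α → Acc MK.E α → ∀ x, Q a α x := by
  by_contra hcon
  push Not at hcon
  by_cases hall : ∀ α : M, Ord α → Acc MK.E α
  · have i1 := hQ (fun ρ => ρ 1) (fun ρ => fst (ρ 0)) (fun ρ => snd (ρ 0))
    obtain ⟨c, hc⟩ := Sg.coll (P := fun a u => Ord (fst u) ∧ ¬ Q a (fst u) (snd u)) inferInstance A
      (fun a ha => by
        obtain ⟨α, o, _, x, hx⟩ := hcon a ha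
        exact ⟨pr α x, by simpa using o, by simpa using hx⟩)
    let c' := sp c (fun u => Ord (fst u))
    have hc' : ∀ u, u ∊ c' ↔ u ∊ c ∧ Ord (fst u) := mem_sp c (fun u => Ord (fst u))
    let α := Un (img c' (fun u => fst u))
    let x := Un (img c' (fun u => snd u))
    have oα : Ord α := Ord.Un fun a ha => by
      obtain ⟨u, hu, rfl⟩ := (mem_img _ _ _).1 ha
      exact ((hc' _).1 hu).2
    obtain ⟨a, ha, hq⟩ := h α oα (hall α oα) x
    obtain ⟨u, hu, ou, nq⟩ := hc a ha
    have huc := (hc' u).2 ⟨hu, ou⟩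
    refine nq (anti a α _ _ x oα ou ?_ ?_ hq)
    · exact fun z hz => (mem_Un _ _).2 ⟨_, (mem_img _ _ _).2 ⟨u, huc, rfl⟩, hz⟩
    · exact fun z hz => (mem_Un _ _).2 ⟨_, (mem_img _ _ _).2 ⟨u, huc, rfl⟩, hz⟩
  · push Not at hall
    obtain ⟨γ, oγ, nγ⟩ := hall
    have inD : ∀ δ, Ord δ → ¬ Acc MK.E δ → ∃ x, ∀ a, a ∊ A → ¬ Q a δ x := by
      intro δ oδ nδ
      have i1 := hQ (fun ρ => ρ 1) (fun _ => δ) (fun ρ => ρ 0)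
      obtain ⟨c, hc⟩ := Sg.coll (P := fun a x => ¬ Q a δ x) inferInstance A (fun a ha => by
        obtain ⟨α, o, acc, x, hx⟩ := hcon a ha
        refine ⟨x, fun hq => hx (anti a δ α x x oδ o ?_ (sub_refl _) hq)⟩
        rcases o.tri oδ with h | rfl | h
        · exact oδ.sub_of_mem h
        · exact (nδ acc).elim
        · exact (nδ (acc.inv h)).elim)
      refine ⟨Un c, fun a ha hq => ?_⟩
      obtain ⟨x, hx, nq⟩ := hc a ha
      exact nq (anti a δ δ x _ oδ oδ (sub_refl _) (fun z hz => (mem_Un _ _).2 ⟨x, hx, hz⟩) hq)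
    have i1 := hQ (fun ρ => ρ 0) (fun ρ => ρ 2) (fun ρ => ρ 1)
    obtain ⟨α, oα, hα, mα⟩ := Sg.least (D := fun δ => Ord δ ∧ ∃ x, ∀ a, a ∊ A → ¬ Q a δ x)
      inferInstance oγ ⟨oγ, inD γ oγ nγ⟩
    have acc : Acc MK.E α := ⟨_, fun β hβ => by
      by_contra hn
      exact mα β hβ ⟨oα.mem hβ, inD β (oα.mem hβ) hn⟩⟩
    obtain ⟨_, x, hx⟩ := hα
    obtain ⟨a, ha, hq⟩ := h α oα acc x
    exact hx a ha hq

end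
end KPP

set_option linter.unusedVariables false
set_option linter.unusedSectionVars false
set_option linter.unusedSimpArgs false
set_option linter.style.longLine false

/-! ## Part 4: primitive recursive functions on the numerals of the model -/
namespace KPP
section
variable {M : Type} [MK M]

noncomputable def nadd (a b : M) : M := iter suc a b
theorem Tm1.suc : Tm1 (suc : M → M) := ⟨inferInstance⟩
instance Tm.nadd (s t : (ℕ → M) → M) [Tm s] [Tm t] : Tm (fun ρ => nadd (s ρ) (t ρ)) :=
  (Tm2.iter Tm1.suc).app s t
theorem nadd_num (a b : ℕ) : nadd (num a : M) (num b) = num (a + b) := by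
  rw [nadd, iter_num Tm1.suc]
  induction b with
  | zero => rfl
  | succ b ih => rw [Function.iterate_succ_apply', ih]; rfl

noncomputable def mulS (s : M) : M := pr (fst s) (nadd (snd s) (fst s))
theorem Tm1.mulS : Tm1 (mulS : M → M) := ⟨by unfold KPP.mulS; infer_instance⟩
noncomputable def nmul (a b : M) : M := snd (iter mulS (pr b emp) a)
instance Tm.nmul (s t : (ℕ → M) → M) [Tm s] [Tm t] : Tm (fun ρ => nmul (s ρ) (t ρ)) := by
  have := (Tm2.iter (Tm1.mulS (M := M))).app (fun ρ => KPP.pr (t ρ) KPP.emp) s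
  unfold KPP.nmul; infer_instance
theorem nmul_num (a b : ℕ) : nmul (num a : M) (num b) = num (a * b) := by
  have : ∀ a : ℕ, mulS^[a] (pr (num b) emp : M) = pr (num b) (num (a * b)) := by
    intro a
    induction a with
    | zero => simp [num]
    | succ a ih => rw [Function.iterate_succ_apply', ih, mulS, fst_pr, snd_pr, nadd_num, Nat.succ_mul]
  rw [nmul, iter_num Tm1.mulS, this, snd_pr]

open Classical in
noncomputable def npair (a b : M) : M :=
  if a ∊ b then nadd (nmul b b) a else nadd (nadd (nmul a a) a) b
instance Tm.npair (s t : (ℕ → M) → M) [Tm s] [Tm t] : Tm (fun ρ => npair (s ρ) (t ρ)) := by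
  unfold KPP.npair; infer_instance
theorem npair_num (a b : ℕ) : npair (num a : M) (num b) = num (Nat.pair a b) := by
  unfold npair Nat.pair
  simp only [num_mem_num, nmul_num, nadd_num]
  split_ifs <;> rfl
noncomputable def nleft (n : M) : M :=
  KPP.Un (sp (suc n) (fun a => ∃ b, b ∊ suc n ∧ npair a b = n))
noncomputable def nright (n : M) : M :=
  KPP.Un (sp (suc n) (fun b => ∃ a, a ∊ suc n ∧ npair a b = n))
instance Tm.nleft (s : (ℕ → M) → M) [Tm s] : Tm (fun ρ => nleft (s ρ)) := by
  unfold KPP.nleft; infer_instance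
instance Tm.nright (s : (ℕ → M) → M) [Tm s] : Tm (fun ρ => nright (s ρ)) := by
  unfold KPP.nright; infer_instance
theorem nleft_num (n : ℕ) : nleft (num n : M) = num n.unpair.1 := by
  have : sp (suc (num n : M)) (fun a => ∃ b, b ∊ suc (num n) ∧ npair a b = num n) =
      sing (num n.unpair.1) := by
    refine ext fun z => ?_
    rw [mem_sp, mem_sing]
    have hn : suc (num n : M) = num (n+1) := rfl
    rw [hn]
    constructor
    · rintro ⟨h1, b, h2, h3⟩
      obtain ⟨i, hi, rfl⟩ := (mem_num _ _).1 h1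
      obtain ⟨j, hj, rfl⟩ := (mem_num _ _).1 h2
      rw [npair_num, num_inj_iff] at h3
      rw [← h3, Nat.unpair_pair]
    · rintro rfl
      exact ⟨num_mem_num.2 (Nat.lt_succ_of_le (Nat.unpair_left_le n)), num n.unpair.2,
        num_mem_num.2 (Nat.lt_succ_of_le (Nat.unpair_right_le n)), by
          rw [npair_num, Nat.pair_unpair]⟩
  rw [nleft, this, Un_sing]
theorem nright_num (n : ℕ) : nright (num n : M) = num n.unpair.2 := by
  have : sp (suc (num n : M)) (fun b => ∃ a, a ∊ suc (num n) ∧ npair a b = num n) =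
      sing (num n.unpair.2) := by
    refine ext fun z => ?_
    rw [mem_sp, mem_sing]
    have hn : suc (num n : M) = num (n+1) := rfl
    rw [hn]
    constructor
    · rintro ⟨h1, b, h2, h3⟩
      obtain ⟨i, hi, rfl⟩ := (mem_num _ _).1 h1
      obtain ⟨j, hj, rfl⟩ := (mem_num _ _).1 h2
      rw [npair_num, num_inj_iff] at h3
      rw [← h3, Nat.unpair_pair]
    · rintro rfl
      exact ⟨num_mem_num.2 (Nat.lt_succ_of_le (Nat.unpair_right_le n)), num n.unpair.1,
        num_mem_num.2 (Nat.lt_succ_of_le (Nat.unpair_left_le n)), by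
          rw [npair_num, Nat.pair_unpair]⟩
  rw [nright, this, Un_sing]

/-- f is represented by a Delta-definable function of the model -/
def Cod (M : Type) [MK M] (f : ℕ → ℕ) : Prop :=
  ∃ φ : M → M, Tm1 φ ∧ ∀ k, φ (num k) = num (f k)

theorem Cod.of_primrec {f : ℕ → ℕ} (h : Nat.Primrec f) : Cod M f := by
  induction h with
  | zero => exact ⟨fun _ => emp, ⟨inferInstance⟩, fun k => rfl⟩
  | succ => exact ⟨suc, ⟨inferInstance⟩, fun k => rfl⟩
  | left => exact ⟨nleft, ⟨inferInstance⟩, nleft_num⟩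
  | right => exact ⟨nright, ⟨inferInstance⟩, nright_num⟩
  | pair _ _ ih ih' =>
    obtain ⟨φ, h1, h2⟩ := ih
    obtain ⟨ψ, h3, h4⟩ := ih'
    have := h1.app (fun ρ => ρ 0)
    have := h3.app (fun ρ => ρ 0)
    exact ⟨fun n => npair (φ n) (ψ n), ⟨inferInstance⟩, fun k => by
      dsimp only; rw [h2, h4, npair_num]⟩
  | comp _ _ ih ih' =>
    obtain ⟨φ, h1, h2⟩ := ih
    obtain ⟨ψ, h3, h4⟩ := ih'
    have := h3.app (fun ρ => ρ 0)
    exact ⟨fun n => φ (ψ n), ⟨h1.app (fun ρ => ψ (ρ 0))⟩, fun k => by dsimp only; rw [h4, h2]⟩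
  | @prec f g _ _ ih ih' =>
    obtain ⟨φ, h1, h2⟩ := ih
    obtain ⟨ψ, h3, h4⟩ := ih'
    let st : M → M := fun s => pr (fst s) (pr (suc (fst (snd s)))
      (ψ (npair (fst s) (npair (fst (snd s)) (snd (snd s))))))
    have hst : Tm1 st := by
      have := h3.app (fun ρ => npair (fst (ρ 0)) (npair (fst (snd (ρ 0))) (snd (snd (ρ 0)))))
      exact ⟨by simp only [st]; infer_instance⟩
    have := h1.app (fun ρ => nleft (ρ 0))
    have := (Tm2.iter hst).app (fun ρ => pr (nleft (ρ 0)) (pr emp (φ (nleft (ρ 0)))))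
      (fun ρ => nright (ρ 0))
    refine ⟨fun n => snd (snd (iter st (pr (nleft n) (pr emp (φ (nleft n)))) (nright n))),
      ⟨inferInstance⟩, fun k => ?_⟩
    have key : ∀ z n : ℕ, st^[n] (pr (num z) (pr emp (num (f z)))) =
        pr (num z) (pr (num n) (num (Nat.rec (f z) (fun y IH => g (Nat.pair z (Nat.pair y IH))) n))) := by
      intro z n
      induction n with
      | zero => rfl
      | succ n ih =>
        rw [Function.iterate_succ_apply', ih]
        simp only [st, fst_pr, snd_pr, npair_num, h4]
        rfl
    dsimp only
    rw [nleft_num, nright_num, h2, iter_num hst, key, snd_pr, snd_pr]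
end
end KPP

set_option linter.unusedVariables false
set_option linter.unusedSectionVars false
set_option linter.unusedSimpArgs false
set_option linter.style.longLine false

/-! ## Part 5: the consistency game inside the model -/
namespace KPP

/-- The combinatorial data of the rule system: rule r says that ra r, rb r entail rc r or rd r. -/
structure Rules where
  ra : ℕ → ℕ
  rb : ℕ → ℕ
  rc : ℕ → ℕ
  rd : ℕ → ℕ
  mc : ℕ → ℕ
  sc : ℕ → ℕ
  bot : ℕ
  pa : Nat.Primrec ra
  pb : Nat.Primrec rb
  pc : Nat.Primrec rc
  pd : Nat.Primrec rd
  pm : Nat.Primrec mc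
  ps : Nat.Primrec sc

section
variable {M : Type} [MK M] (K : Rules)

noncomputable def RA (x : M) : M := (Cod.of_primrec (M := M) K.pa).choose x
noncomputable def RB (x : M) : M := (Cod.of_primrec (M := M) K.pb).choose x
noncomputable def RC (x : M) : M := (Cod.of_primrec (M := M) K.pc).choose x
noncomputable def RD (x : M) : M := (Cod.of_primrec (M := M) K.pd).choose x
noncomputable def MC (x : M) : M := (Cod.of_primrec (M := M) K.pm).choose x
noncomputable def SC (x : M) : M := (Cod.of_primrec (M := M) K.ps).choose x
instance Tm.RA (s : (ℕ → M) → M) [Tm s] : Tm (fun ρ => RA K (s ρ)) :=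
  (Cod.of_primrec (M := M) K.pa).choose_spec.1.app s
instance Tm.RB (s : (ℕ → M) → M) [Tm s] : Tm (fun ρ => RB K (s ρ)) :=
  (Cod.of_primrec (M := M) K.pb).choose_spec.1.app s
instance Tm.RC (s : (ℕ → M) → M) [Tm s] : Tm (fun ρ => RC K (s ρ)) :=
  (Cod.of_primrec (M := M) K.pc).choose_spec.1.app s
instance Tm.RD (s : (ℕ → M) → M) [Tm s] : Tm (fun ρ => RD K (s ρ)) :=
  (Cod.of_primrec (M := M) K.pd).choose_spec.1.app s
instance Tm.MC (s : (ℕ → M) → M) [Tm s] : Tm (fun ρ => MC K (s ρ)) :=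
  (Cod.of_primrec (M := M) K.pm).choose_spec.1.app s
instance Tm.SC (s : (ℕ → M) → M) [Tm s] : Tm (fun ρ => SC K (s ρ)) :=
  (Cod.of_primrec (M := M) K.ps).choose_spec.1.app s
@[simp] theorem RA_num (k : ℕ) : RA K (num k : M) = num (K.ra k) :=
  (Cod.of_primrec (M := M) K.pa).choose_spec.2 k
@[simp] theorem RB_num (k : ℕ) : RB K (num k : M) = num (K.rb k) :=
  (Cod.of_primrec (M := M) K.pb).choose_spec.2 k
@[simp] theorem RC_num (k : ℕ) : RC K (num k : M) = num (K.rc k) :=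
  (Cod.of_primrec (M := M) K.pc).choose_spec.2 k
@[simp] theorem RD_num (k : ℕ) : RD K (num k : M) = num (K.rd k) :=
  (Cod.of_primrec (M := M) K.pd).choose_spec.2 k
@[simp] theorem MC_num (k : ℕ) : MC K (num k : M) = num (K.mc k) :=
  (Cod.of_primrec (M := M) K.pm).choose_spec.2 k
@[simp] theorem SC_num (k : ℕ) : SC K (num k : M) = num (K.sc k) :=
  (Cod.of_primrec (M := M) K.ps).choose_spec.2 k

noncomputable def fr (x : M) : M := nadd x x
instance Tm.fr (s : (ℕ → M) → M) [Tm s] : Tm (fun ρ => fr (s ρ)) := by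
  unfold KPP.fr; infer_instance
@[simp] theorem fr_num (k : ℕ) : fr (num k : M) = num (2 * k) := by rw [fr, nadd_num, two_mul]
noncomputable def M7 (r : M) : M := MC K (npair (fr (nright r)) (nleft r))
instance Tm.M7 (s : (ℕ → M) → M) [Tm s] : Tm (fun ρ => M7 K (s ρ)) := by
  unfold KPP.M7; infer_instance
@[simp] theorem M7_num (k : ℕ) :
    M7 K (num k : M) = num (K.mc (Nat.pair (2 * k.unpair.2) k.unpair.1)) := by
  rw [M7, nright_num, nleft_num, fr_num, npair_num, MC_num]

/-! ### tokens -/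
noncomputable def tok (k i a : M) : M := pr k (pr i a)
instance Tm.tok (r s t : (ℕ → M) → M) [Tm r] [Tm s] [Tm t] : Tm (fun ρ => tok (r ρ) (s ρ) (t ρ)) := by
  unfold KPP.tok; infer_instance
@[simp] theorem tok_inj {k i a k' i' a' : M} : tok k i a = tok k' i' a' ↔ k = k' ∧ i = i' ∧ a = a' := by
  simp [tok]
noncomputable def tT (i : M) : M := tok (num 0) i emp
noncomputable def tG (i a : M) : M := tok (num 1) i a
noncomputable def tH (i a : M) : M := tok (num 2) i a
instance Tm.tT (s : (ℕ → M) → M) [Tm s] : Tm (fun ρ => tT (s ρ)) := by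
  unfold KPP.tT; infer_instance
instance Tm.tG (s t : (ℕ → M) → M) [Tm s] [Tm t] : Tm (fun ρ => tG (s ρ) (t ρ)) := by
  unfold KPP.tG; infer_instance
instance Tm.tH (s t : (ℕ → M) → M) [Tm s] [Tm t] : Tm (fun ρ => tH (s ρ) (t ρ)) := by
  unfold KPP.tH; infer_instance
/-- all tokens saying that i avoids the subsets of v -/
noncomputable def hs (j w : M) : M := prod (sing (num 2)) (prod j w)
instance Tm.hs (s t : (ℕ → M) → M) [Tm s] [Tm t] : Tm (fun ρ => hs (s ρ) (t ρ)) := by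
  unfold KPP.hs; infer_instance
noncomputable def Dom (w : M) : M := prod om (prod om w)
instance Tm.Dom (s : (ℕ → M) → M) [Tm s] : Tm (fun ρ => Dom (s ρ)) := by
  unfold KPP.Dom; infer_instance
theorem tok_Dom {k i a w : M} : tok k i a ∊ Dom w ↔ k ∊ om ∧ i ∊ om ∧ a ∊ w := by
  simp [tok, Dom]
theorem tT_Dom {i w : M} : tT i ∊ Dom w ↔ i ∊ om ∧ emp ∊ w := by
  simp [tT, tok_Dom, num_om]
theorem tG_Dom {i a w : M} : tG i a ∊ Dom w ↔ i ∊ om ∧ a ∊ w := by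
  simp [tG, tok_Dom, num_om]
theorem tH_Dom {i a w : M} : tH i a ∊ Dom w ↔ i ∊ om ∧ a ∊ w := by
  simp [tH, tok_Dom, num_om]
theorem mem_hs {j w z : M} : z ∊ hs j w ↔ ∃ i v, i ∊ j ∧ v ∊ w ∧ z = tH i v := by
  simp only [hs, mem_prod, mem_sing, tH, tok]
  constructor
  · rintro ⟨a, b, rfl, ⟨i, v, h1, h2, rfl⟩, rfl⟩
    exact ⟨i, v, h1, h2, rfl⟩
  · rintro ⟨i, v, h1, h2, rfl⟩
    exact ⟨_, _, rfl, ⟨i, v, h1, h2, rfl⟩, rfl⟩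
@[simp] theorem tT_hs {i j w : M} : ¬ tT i ∊ hs j w := by
  rw [mem_hs]; rintro ⟨a, b, _, _, h⟩
  simp [tT, tH] at h
@[simp] theorem tG_hs {i a j w : M} : ¬ tG i a ∊ hs j w := by
  rw [mem_hs]; rintro ⟨a, b, _, _, h⟩
  simp [tG, tH] at h
@[simp] theorem tH_hs {i a j w : M} : tH i a ∊ hs j w ↔ i ∊ j ∧ a ∊ w := by
  rw [mem_hs]
  constructor
  · rintro ⟨a, b, h1, h2, h⟩
    simp [tH] at h
    rw [h.1, h.2]; exact ⟨h1, h2⟩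
  · rintro ⟨h1, h2⟩
    exact ⟨_, _, h1, h2, rfl⟩
@[simp] theorem tT_tT {i j : M} : tT i = tT j ↔ i = j := by simp [tT]
@[simp] theorem tG_tG {i a j b : M} : tG i a = tG j b ↔ i = j ∧ a = b := by simp [tG]
@[simp] theorem tT_tG {i j b : M} : ¬ tT i = tG j b := by simp [tT, tG]
@[simp] theorem tG_tT {i j b : M} : ¬ tG j b = tT i := by simp [tT, tG]
@[simp] theorem tH_tT {i j b : M} : ¬ tH j b = tT i := by simp [tT, tH]
@[simp] theorem tH_tG {i j b a : M} : ¬ tH j b = tG i a := by simp [tG, tH]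

/-! ### requirements -/
def D1 (q n' A r : M) : Prop :=
  tT (RA K r) ∊ q ∧ tT (RB K r) ∊ q ∧ RC K r ∊ n' ∧ RD K r ∊ n' ∧
    sing (tT (RC K r)) ∊ A ∧ sing (tT (RD K r)) ∊ A
def D2 (w q A r : M) : Prop :=
  ∃ b, b ∊ w ∧ tT (MC K r) ∊ q ∧ tG (nright r) b ∊ q ∧ ∀ a, a ∊ b → sing (tG (nleft r) a) ∊ A
def D3 (w q A r : M) : Prop :=
  ∃ b, b ∊ w ∧ tT (SC K r) ∊ q ∧ tG (nright r) b ∊ q ∧ ∀ a, a ∊ Pow b → sing (tG (nleft r) a) ∊ A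
def D4 (w q n' A r : M) : Prop :=
  ∃ b, b ∊ w ∧ ∃ a, a ∊ b ∧ tG (nleft r) a ∊ q ∧ tG (nright r) b ∊ q ∧ MC K r ∊ n' ∧
    sing (tT (MC K r)) ∊ A
def D5 (w n n' A r : M) : Prop :=
  ∃ a, a ∊ w ∧ n ⊑ r ∧ fr r ∊ n' ∧ sing (tG (fr r) a) ∊ A
def D6 (w A r : M) : Prop :=
  ∃ v, v ∊ w ∧ (∀ a, a ∊ v → sing (tG r a) ∊ A) ∧ hs (sing r) (Pow v) ∊ A
def D7 (w q n n' A r : M) : Prop :=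
  ∃ u, u ∊ w ∧ ∃ v, v ∊ w ∧ Pow v ⊑ u ∧ tH (nleft r) u ∊ q ∧ n ⊑ nright r ∧
    fr (nright r) ∊ n' ∧ M7 K r ∊ n' ∧
    bun (sing (tT (M7 K r))) (hs (sing (fr (nright r))) (Pow v)) ∊ A
def Req (w q n n' A r : M) : Prop :=
  D1 K q n' A r ∨ D2 K w q A r ∨ D3 K w q A r ∨ D4 K w q n' A r ∨ D5 w n n' A r ∨ D6 w A r ∨
    D7 K w q n n' A r

instance Dl.D1 (a b c d : (ℕ → M) → M) [Tm a] [Tm b] [Tm c] [Tm d] :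
    Dl (fun ρ => D1 K (a ρ) (b ρ) (c ρ) (d ρ)) := by unfold KPP.D1; infer_instance
instance Dl.D2 (a b c d : (ℕ → M) → M) [Tm a] [Tm b] [Tm c] [Tm d] :
    Dl (fun ρ => D2 K (a ρ) (b ρ) (c ρ) (d ρ)) := by unfold KPP.D2; infer_instance
instance Dl.D3 (a b c d : (ℕ → M) → M) [Tm a] [Tm b] [Tm c] [Tm d] :
    Dl (fun ρ => D3 K (a ρ) (b ρ) (c ρ) (d ρ)) := by unfold KPP.D3; infer_instance
instance Dl.D4 (a b c d e : (ℕ → M) → M) [Tm a] [Tm b] [Tm c] [Tm d] [Tm e] :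
    Dl (fun ρ => D4 K (a ρ) (b ρ) (c ρ) (d ρ) (e ρ)) := by unfold KPP.D4; infer_instance
instance Dl.D5 (a b c d e : (ℕ → M) → M) [Tm a] [Tm b] [Tm c] [Tm d] [Tm e] :
    Dl (fun ρ => D5 (a ρ) (b ρ) (c ρ) (d ρ) (e ρ)) := by unfold KPP.D5; infer_instance
instance Dl.D6 (a b c : (ℕ → M) → M) [Tm a] [Tm b] [Tm c] :
    Dl (fun ρ => D6 (a ρ) (b ρ) (c ρ)) := by unfold KPP.D6; infer_instance
instance Dl.D7 (a b c d e f : (ℕ → M) → M) [Tm a] [Tm b] [Tm c] [Tm d] [Tm e] [Tm f] :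
    Dl (fun ρ => D7 K (a ρ) (b ρ) (c ρ) (d ρ) (e ρ) (f ρ)) := by unfold KPP.D7; infer_instance
instance Dl.Req (a b c d e f : (ℕ → M) → M) [Tm a] [Tm b] [Tm c] [Tm d] [Tm e] [Tm f] :
    Dl (fun ρ => Req K (a ρ) (b ρ) (c ρ) (d ρ) (e ρ) (f ρ)) := by unfold KPP.Req; infer_instance

theorem Req.mono {w w' q q' n n' A r : M} (hw : w ⊑ w') (hq : q ⊑ q') (h : Req K w q n n' A r) :
    Req K w' q' n n' A r := by
  rcases h with h | h | h | h | h | h | h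
  · obtain ⟨h1, h2, h3⟩ := h
    exact Or.inl ⟨hq _ h1, hq _ h2, h3⟩
  · obtain ⟨b, h0, h1, h2, h3⟩ := h
    exact Or.inr (Or.inl ⟨b, hw _ h0, hq _ h1, hq _ h2, h3⟩)
  · obtain ⟨b, h0, h1, h2, h3⟩ := h
    exact Or.inr (Or.inr (Or.inl ⟨b, hw _ h0, hq _ h1, hq _ h2, h3⟩))
  · obtain ⟨b, h0, a, h4, h1, h2, h3⟩ := h
    exact Or.inr (Or.inr (Or.inr (Or.inl ⟨b, hw _ h0, a, h4, hq _ h1, hq _ h2, h3⟩)))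
  · obtain ⟨b, h0, h1⟩ := h
    exact Or.inr (Or.inr (Or.inr (Or.inr (Or.inl ⟨b, hw _ h0, h1⟩))))
  · obtain ⟨b, h0, h1⟩ := h
    exact Or.inr (Or.inr (Or.inr (Or.inr (Or.inr (Or.inl ⟨b, hw _ h0, h1⟩)))))
  · obtain ⟨u, h0, v, h1, h2, h3, h4⟩ := h
    exact Or.inr (Or.inr (Or.inr (Or.inr (Or.inr (Or.inr
      ⟨u, hw _ h0, v, hw _ h1, h2, hq _ h3, h4⟩)))))

def Static (w q : M) : Prop :=
  ¬ tT (num K.bot) ∊ q ∧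
  (∀ i, i ∊ om → ∀ a, a ∊ w → ∀ b, b ∊ w → tG i a ∊ q → tG i b ∊ q → a = b) ∧
  (∀ i, i ∊ om → ∀ a, a ∊ w → ∀ v, v ∊ w → tG i a ∊ q → tH i v ∊ q → ¬ a ∊ v)
instance Dl.Static (a b : (ℕ → M) → M) [Tm a] [Tm b] :
    Dl (fun ρ => Static K (a ρ) (b ρ)) := by unfold KPP.Static; infer_instance
theorem Static.anti {w w' q q' : M} (hw : w ⊑ w') (hq : q ⊑ q') (h : Static K w' q') :
    Static K w q :=
  ⟨fun h' => h.1 (hq _ h'), fun i hi a ha b hb h1 h2 => h.2.1 i hi a (hw _ ha) b (hw _ hb) (hq _ h1) (hq _ h2),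
    fun i hi a ha b hb h1 h2 => h.2.2 i hi a (hw _ ha) b (hw _ hb) (hq _ h1) (hq _ h2)⟩

/-! ### the game -/
def Ans (w q n' A Z : M) : Prop :=
  ∃ q', q' ∊ Pow (Dom w) ∧ q ⊑ q' ∧ pr q' n' ∊ Z ∧ ∃ o, o ∊ A ∧ o ⊑ q'
instance Dl.Ans (a b c d e : (ℕ → M) → M) [Tm a] [Tm b] [Tm c] [Tm d] [Tm e] :
    Dl (fun ρ => Ans (a ρ) (b ρ) (c ρ) (d ρ) (e ρ)) := by unfold KPP.Ans; infer_instance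
def Play (w q n β Z : M) : Prop :=
  ∀ n', n' ∊ om → n' ∊ β → n ⊑ n' → ∀ A, A ∊ Pow (Pow (Dom w)) → ∀ r, r ∊ n' →
    Req K w q n n' A r → Ans w q n' A Z
instance Dl.Play (a b c d e : (ℕ → M) → M) [Tm a] [Tm b] [Tm c] [Tm d] [Tm e] :
    Dl (fun ρ => Play K (a ρ) (b ρ) (c ρ) (d ρ) (e ρ)) := by unfold KPP.Play; infer_instance
noncomputable def RG (w α g : M) : M :=
  sp (prod (Pow (Dom w)) om) (fun z => Static K w (fst z) ∧
    ∀ β, β ∊ α → Play K w (fst z) (snd z) β (app g β))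
theorem Tm3.RG : Tm3 (RG K : M → M → M → M) := ⟨by unfold KPP.RG; infer_instance⟩
noncomputable def Rs (w α : M) : M := KPP.rc (RG K) w α
instance Tm.Rs (s t : (ℕ → M) → M) [Tm s] [Tm t] : Tm (fun ρ => Rs K (s ρ) (t ρ)) :=
  (Tm2.rc (Tm3.RG K)).app s t
def R (w α q n : M) : Prop := pr q n ∊ Rs K w α
instance Dl.R (a b c d : (ℕ → M) → M) [Tm a] [Tm b] [Tm c] [Tm d] :
    Dl (fun ρ => R K (a ρ) (b ρ) (c ρ) (d ρ)) := by unfold KPP.R; infer_instance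
theorem R_iff {w α q n : M} : R K w α q n ↔ q ∊ Pow (Dom w) ∧ n ∊ om ∧ Static K w q ∧
    ∀ β, β ∊ α → Play K w q n β (Rs K w β) := by
  have key : ∀ β, β ∊ α → app (img α (fun y => pr y (KPP.rc (RG K) w y))) β = Rs K w β := by
    have := Tm.Rs (M := M) K (fun _ => w) (fun ρ => ρ 0)
    have h2 : Tm (fun ρ : ℕ → M => pr (ρ 0) (KPP.rc (RG K) w (ρ 0))) :=
      Tm.pr (fun ρ => ρ 0) (fun ρ => Rs K w (ρ 0))
    intro β hβ
    refine app_eq ?_ ?_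
    · exact (mem_img _ _ _).2 ⟨β, hβ, rfl⟩
    · intro y hy
      obtain ⟨z, hz, h⟩ := (mem_img _ _ _).1 hy
      rw [pr_inj_iff] at h
      rw [h.2, h.1]; rfl
  rw [R, Rs, rc_eq (Tm3.RG K), RG, mem_sp, pr_mem_prod, fst_pr, snd_pr, and_assoc]
  refine and_congr_right fun _ => and_congr_right fun _ => and_congr_right fun _ =>
    forall_congr' fun β => forall_congr' fun hβ => ?_
  rw [key β hβ]

theorem Dom_mono {w w' : M} (h : w ⊑ w') : Dom w ⊑ Dom w' := by
  intro z hz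
  simp only [Dom, mem_prod] at *
  obtain ⟨x, y, h1, ⟨a, b, h2, h3, rfl⟩, rfl⟩ := hz
  exact ⟨x, _, h1, ⟨a, b, h2, h _ h3, rfl⟩, rfl⟩

theorem R.mono {w w' α α' q q' n : M} (hw : w ⊑ w') (hα : Ord α') (ha : α ⊑ α') (hq : q ⊑ q')
    (hqw : q ⊑ Dom w) (h : R K w' α' q' n) : R K w α q n := by
  have key := Sg.ind (P := fun β => ∀ α₁, α₁ ∊ suc α' → ∀ p', p' ∊ Pow (Dom w') →
    ∀ p, p ∊ Pow (Dom w) → ∀ m, m ∊ om → β ⊑ α₁ → p ⊑ p' → R K w' α₁ p' m → R K w β p m)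
    inferInstance (fun β ih α₁ hα₁ p' hp' p hp m hm hβ hpp hR => by
      obtain ⟨-, -, hs, hpl⟩ := (R_iff K).1 hR
      refine (R_iff K).2 ⟨hp, hm, hs.anti K hw hpp, fun γ hγ n' hn' hnγ hmn A hA r hr hreq => ?_⟩
      have hA' : A ∊ Pow (Pow (Dom w')) := by
        rw [mem_Pow] at *
        intro z hz
        have := hA z hz
        rw [mem_Pow] at *
        exact sub_trans this (Dom_mono hw)
      obtain ⟨q₁, h1, h2, h3, o, ho, hoq⟩ := hpl γ (hβ γ hγ) n' hn' hnγ hmn A hA' r hr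
        (hreq.mono K hw hpp)
      have hoD : o ⊑ Dom w := (mem_Pow _ _).1 ((mem_Pow _ _).1 hA o ho)
      refine ⟨int q₁ (Dom w), ?_, ?_, ?_, o, ho, ?_⟩
      · rw [mem_Pow]; intro z hz; exact ((mem_int _ _ _).1 hz).2
      · intro z hz
        exact (mem_int _ _ _).2 ⟨h2 _ (hpp _ hz), (mem_Pow _ _).1 hp z hz⟩
      · refine ih γ hγ γ (hα.suc.1 _ hα₁ _ (hβ γ hγ)) q₁ h1 _ ?_ n' hn' (sub_refl _) ?_ h3
        · rw [mem_Pow]; intro z hz; exact ((mem_int _ _ _).1 hz).2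
        · intro z hz; exact ((mem_int _ _ _).1 hz).1
      · intro z hz
        exact (mem_int _ _ _).2 ⟨hoq z hz, hoD z hz⟩) α
  obtain ⟨h1, h2, -⟩ := (R_iff K).1 h
  exact key α' ((mem_suc _ _).2 (Or.inr rfl)) q' h1 q ((mem_Pow _ _).2 hqw) n h2 ha hq h
end
end KPP

set_option linter.unusedVariables false
set_option linter.unusedSectionVars false
set_option linter.unusedSimpArgs false
set_option linter.style.longLine false

/-! ## Part 6: truth in the model keeps the game alive; extension steps -/
namespace KPP
section
variable {M : Type} [MK M] (K : Rules)

/-- A truth definition for the atoms which validates the rules. -/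
structure Sem (M : Type) [MK M] (K : Rules) where
  tru : (ℕ → M) → ℕ → Prop
  e : (ℕ → M) → ℕ → M
  s1 : ∀ u r, tru u (K.ra r) → tru u (K.rb r) → tru u (K.rc r) ∨ tru u (K.rd r)
  s2 : ∀ u r, tru u (K.mc r) ↔ e u r.unpair.1 ∊ e u r.unpair.2
  s3 : ∀ u r, tru u (K.sc r) ↔ e u r.unpair.1 ⊑ e u r.unpair.2
  s4 : ∀ u, ¬ tru u K.bot
  s5 : ∀ u k, e u (2 * k) = u k
  s6 : ∀ u u' m, (∀ k < m, u k = u' k) → ∀ k < m, e u k = e u' k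
  s7 : ∀ u u' m, (∀ k < m, u k = u' k) → ∀ k < m, tru u k → tru u' k

variable {K}

/-- the tokens of q are true and have small standard indices -/
def Real (S : Sem M K) (u : ℕ → M) (q : M) (m : ℕ) : Prop :=
  (∀ i, tT i ∊ q → ∃ k < m, i = num k ∧ S.tru u k) ∧
  (∀ i a, tG i a ∊ q → ∃ k < m, i = num k ∧ S.e u k = a) ∧
  (∀ i v, tH i v ∊ q → ∃ k < m, i = num k ∧ ¬ S.e u k ∊ v)

theorem Real.bun {S : Sem M K} {u : ℕ → M} {q o : M} {m : ℕ} (h : Real S u q m) (h' : Real S u o m) :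
    Real S u (bun q o) m := by
  refine ⟨fun i hi => ?_, fun i a hi => ?_, fun i v hi => ?_⟩ <;> rw [mem_bun] at hi
  · exact hi.elim (h.1 i) (h'.1 i)
  · exact hi.elim (h.2.1 i a) (h'.2.1 i a)
  · exact hi.elim (h.2.2 i v) (h'.2.2 i v)
theorem Real.mono {S : Sem M K} {u : ℕ → M} {q : M} {m m' : ℕ} (h : Real S u q m) (hm : m ≤ m') :
    Real S u q m' := by
  refine ⟨fun i hi => ?_, fun i a hi => ?_, fun i v hi => ?_⟩
  · obtain ⟨k, h1, h2⟩ := h.1 i hi; exact ⟨k, by omega, h2⟩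
  · obtain ⟨k, h1, h2⟩ := h.2.1 i a hi; exact ⟨k, by omega, h2⟩
  · obtain ⟨k, h1, h2⟩ := h.2.2 i v hi; exact ⟨k, by omega, h2⟩
theorem Real.congr {S : Sem M K} {u u' : ℕ → M} {q : M} {m : ℕ} (h : Real S u q m)
    (hu : ∀ k < m, u k = u' k) : Real S u' q m := by
  refine ⟨fun i hi => ?_, fun i a hi => ?_, fun i v hi => ?_⟩
  · obtain ⟨k, h1, h2, h3⟩ := h.1 i hi; exact ⟨k, h1, h2, S.s7 u u' m hu k h1 h3⟩
  · obtain ⟨k, h1, h2, h3⟩ := h.2.1 i a hi; exact ⟨k, h1, h2, (S.s6 u u' m hu k h1) ▸ h3⟩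
  · obtain ⟨k, h1, h2, h3⟩ := h.2.2 i v hi; exact ⟨k, h1, h2, (S.s6 u u' m hu k h1) ▸ h3⟩
theorem Real.sT {S : Sem M K} {u : ℕ → M} {m k : ℕ} (hk : k < m) (h : S.tru u k) :
    Real S u (sing (tT (num k))) m := by
  refine ⟨fun i hi => ?_, fun i a hi => ?_, fun i v hi => ?_⟩ <;> rw [mem_sing] at hi
  · exact ⟨k, hk, tT_tT.1 hi, h⟩
  · exact (tG_tT hi).elim
  · exact (tH_tT hi).elim
theorem Real.sG {S : Sem M K} {u : ℕ → M} {m k : ℕ} (hk : k < m) :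
    Real S u (sing (tG (num k) (S.e u k))) m := by
  refine ⟨fun i hi => ?_, fun i a hi => ?_, fun i v hi => ?_⟩ <;> rw [mem_sing] at hi
  · exact (tT_tG hi).elim
  · exact ⟨k, hk, (tG_tG.1 hi).1, (tG_tG.1 hi).2.symm⟩
  · exact (tH_tG hi).elim
theorem Real.sH {S : Sem M K} {u : ℕ → M} {m k : ℕ} (hk : k < m) {v : M} (hv : ¬ S.e u k ∊ v) :
    Real S u (hs (sing (num k)) (Pow v)) m := by
  refine ⟨fun i hi => ?_, fun i a hi => ?_, fun i z hi => ?_⟩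
  · exact (tT_hs hi).elim
  · exact (tG_hs hi).elim
  · rw [tH_hs, mem_sing, mem_Pow] at hi
    exact ⟨k, hk, hi.1, fun h => hv (hi.2 _ h)⟩
theorem Real.static {S : Sem M K} {u : ℕ → M} {q : M} {m : ℕ} (h : Real S u q m) (w : M) :
    Static K w q := by
  refine ⟨fun hb => ?_, fun i _ a _ b _ h1 h2 => ?_, fun i _ a _ v _ h1 h2 => ?_⟩
  · obtain ⟨k, _, h2, h3⟩ := h.1 _ hb
    rw [num_inj_iff] at h2
    exact S.s4 u (h2 ▸ h3)
  · obtain ⟨k, _, e, rfl⟩ := h.2.1 _ _ h1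
    obtain ⟨k', _, e', rfl⟩ := h.2.1 _ _ h2
    rw [e, num_inj_iff] at e'; rw [e']
  · obtain ⟨k, _, e, rfl⟩ := h.2.1 _ _ h1
    obtain ⟨k', _, e', h3⟩ := h.2.2 _ _ h2
    rw [e, num_inj_iff] at e'; rwa [e']

theorem Real.step (S : Sem M K) {u : ℕ → M} {q A w : M} {m m' r : ℕ} (h : Real S u q m) (hm : m ≤ m')
    (hr : r < m') (hreq : Req K w q (num m) (num m') A (num r)) :
    ∃ u' o, o ∊ A ∧ Real S u' (KPP.bun q o) m' := by
  have hl := Nat.unpair_left_le r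
  have hrt := Nat.unpair_right_le r
  rcases hreq with h0 | h0 | h0 | h0 | h0 | h0 | h0
  · obtain ⟨h1, h2, h3, h4, h5, h6⟩ := h0
    simp only [RA_num, RB_num, RC_num, RD_num, num_mem_num] at *
    obtain ⟨k, _, e, h7⟩ := h.1 _ h1
    obtain ⟨k', _, e', h8⟩ := h.1 _ h2
    rw [num_inj_iff] at e e'
    subst e e'
    rcases S.s1 u r h7 h8 with h9 | h9
    · exact ⟨u, _, h5, (h.mono hm).bun (Real.sT h3 h9)⟩
    · exact ⟨u, _, h6, (h.mono hm).bun (Real.sT h4 h9)⟩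
  · obtain ⟨b, _, h1, h2, h3⟩ := h0
    rw [MC_num] at h1
    rw [nright_num] at h2
    obtain ⟨k, _, e, h7⟩ := h.1 _ h1
    obtain ⟨k', _, e', h8⟩ := h.2.1 _ _ h2
    rw [num_inj_iff] at e e'
    subst e e' h8
    have := h3 _ ((S.s2 u r).1 h7)
    rw [nleft_num] at this
    exact ⟨u, _, this, (h.mono hm).bun (Real.sG (by omega))⟩
  · obtain ⟨b, _, h1, h2, h3⟩ := h0
    rw [SC_num] at h1
    rw [nright_num] at h2
    obtain ⟨k, _, e, h7⟩ := h.1 _ h1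
    obtain ⟨k', _, e', h8⟩ := h.2.1 _ _ h2
    rw [num_inj_iff] at e e'
    subst e e' h8
    have := h3 _ ((mem_Pow _ _).2 ((S.s3 u r).1 h7))
    rw [nleft_num] at this
    exact ⟨u, _, this, (h.mono hm).bun (Real.sG (by omega))⟩
  · obtain ⟨b, _, a, hab, h1, h2, h3, h4⟩ := h0
    rw [MC_num] at h3 h4
    rw [nleft_num] at h1
    rw [nright_num] at h2
    obtain ⟨k, _, e, h7⟩ := h.2.1 _ _ h1
    obtain ⟨k', _, e', h8⟩ := h.2.1 _ _ h2
    rw [num_inj_iff] at e e'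
    subst e e' h7 h8
    exact ⟨u, _, h4, (h.mono hm).bun (Real.sT (num_mem_num.1 h3) ((S.s2 u r).2 hab))⟩
  · obtain ⟨a, _, h1, h2, h3⟩ := h0
    rw [num_sub_num] at h1
    rw [fr_num] at h2 h3
    rw [num_mem_num] at h2
    have h4 : S.e (Function.update u r a) (2 * r) = a := by rw [S.s5]; simp
    refine ⟨Function.update u r a, _, h3, Real.bun ((h.congr ?_).mono hm) ?_⟩
    · intro k hk
      rw [Function.update_of_ne (by omega)]
    · have := Real.sG (S := S) (u := Function.update u r a) h2
      rwa [h4] at this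
  · obtain ⟨v, _, h1, h2⟩ := h0
    by_cases hv : S.e u r ∊ v
    · exact ⟨u, _, h1 _ hv, (h.mono hm).bun (Real.sG hr)⟩
    · exact ⟨u, _, h2, (h.mono hm).bun (Real.sH hr hv)⟩
  · obtain ⟨w', _, v, _, h1, h2, h3, h4, h5, h6⟩ := h0
    rw [nleft_num] at h2
    rw [nright_num, num_sub_num] at h3
    rw [nright_num, fr_num, num_mem_num] at h4
    rw [M7_num, num_mem_num] at h5
    rw [M7_num, nright_num, fr_num] at h6
    obtain ⟨k, hk, e, h7⟩ := h.2.2 _ _ h2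
    rw [num_inj_iff] at e
    subst e
    have : ∃ b, b ∊ S.e u r.unpair.1 ∧ ¬ b ∊ v := by
      by_contra hc
      push Not at hc
      exact h7 (h1 _ ((mem_Pow _ _).2 hc))
    obtain ⟨b, hb, hbv⟩ := this
    set u' := Function.update u r.unpair.2 b with hu'
    have hag : ∀ k < m, u k = u' k := by
      intro k hk
      rw [hu', Function.update_of_ne (by omega)]
    have he : S.e u' (2 * r.unpair.2) = b := by rw [S.s5, hu']; simp
    refine ⟨u', _, h6, Real.bun ((h.congr hag).mono hm) (Real.bun (Real.sT h5 ?_) (Real.sH h4 ?_))⟩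
    · rw [S.s2, Nat.unpair_pair, he]
      rwa [← S.s6 u u' m hag _ hk]
    · rwa [he]

theorem Real.R (S : Sem M K) {α : M} (hα : Acc MK.E α) : ∀ {u : ℕ → M} {q w : M} {m : ℕ},
    Real S u q m → q ∊ Pow (Dom w) → R K w α q (num m) := by
  induction hα with
  | intro α hacc ih =>
    intro u q w m h hq
    refine (R_iff K).2 ⟨hq, num_om m, h.static w, fun β hβ n' hn' hnβ hmn A hA r hr hreq => ?_⟩
    obtain ⟨m', rfl⟩ := acc_num hn' ((hacc β hβ).inv hnβ)
    obtain ⟨k, hk, rfl⟩ := (mem_num _ _).1 hr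
    obtain ⟨u', o, ho, hre⟩ := h.step S (num_sub_num.1 hmn) hk hreq
    have hq' : KPP.bun q o ∊ Pow (Dom w) := by
      rw [mem_Pow]
      intro z hz
      rcases (mem_bun _ _ _).1 hz with h | h
      · exact (mem_Pow _ _).1 hq _ h
      · exact (mem_Pow _ _).1 ((mem_Pow _ _).1 hA o ho) z h
    exact ⟨KPP.bun q o, hq', fun z hz => (mem_bun _ _ _).2 (Or.inl hz), ih β hβ hre hq', o, ho,
      fun z hz => (mem_bun _ _ _).2 (Or.inr hz)⟩

/-! ### consistent states -/
noncomputable def W (x : M) : M := Pow (V x)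
instance Tm.W (s : (ℕ → M) → M) [Tm s] : Tm (fun ρ => W (s ρ)) := by
  unfold KPP.W; infer_instance
theorem W_mono {x y : M} (h : x ⊑ y) : W x ⊑ W y := by
  intro z hz
  rw [W, mem_Pow] at *
  exact sub_trans hz (V_mono h)
theorem emp_W (x : M) : emp ∊ W x := (mem_Pow _ _).2 fun z hz => (not_emp z hz).elim
theorem mem_W (x : M) : x ∊ W x := (mem_Pow _ _).2 (sub_V x)
theorem W_sub {a b x : M} (h : a ⊑ b) (hb : b ∊ W x) : a ∊ W x :=
  (mem_Pow _ _).2 (sub_trans h ((mem_Pow _ _).1 hb))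
theorem W_tr {a b x : M} (h : a ∊ b) (hb : b ∊ W x) : a ∊ W x :=
  (mem_Pow _ _).2 fun z hz => V_tr x a ((mem_Pow _ _).1 hb a h) z hz
noncomputable def cond (x q j : M) : M := bun (int q (Dom (W x))) (hs j (W x))
instance Tm.cond (a b c : (ℕ → M) → M) [Tm a] [Tm b] [Tm c] : Tm (fun ρ => cond (a ρ) (b ρ) (c ρ)) := by
  unfold KPP.cond; infer_instance
theorem mem_cond {x q j z : M} : z ∊ cond x q j ↔ (z ∊ q ∧ z ∊ Dom (W x)) ∨ z ∊ hs j (W x) := by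
  rw [cond, mem_bun, mem_int]
theorem cond_Dom {x q j : M} (hj : j ⊑ om) : cond x q j ⊑ Dom (W x) := by
  intro z hz
  rcases mem_cond.1 hz with h | h
  · exact h.2
  · obtain ⟨i, v, h1, h2, rfl⟩ := mem_hs.1 h
    exact tH_Dom.2 ⟨hj _ h1, h2⟩
theorem cond_mono {x x' q q' j j' : M} (hx : x ⊑ x') (hq : q ⊑ q') (hj : j ⊑ j') :
    cond x q j ⊑ cond x' q' j' := by
  intro z hz
  rcases mem_cond.1 hz with h | h
  · exact mem_cond.2 (Or.inl ⟨hq _ h.1, Dom_mono (W_mono hx) _ h.2⟩)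
  · obtain ⟨i, v, h1, h2, rfl⟩ := mem_hs.1 h
    exact mem_cond.2 (Or.inr (tH_hs.2 ⟨hj _ h1, W_mono hx _ h2⟩))

variable (K)
def Cons (q j : M) (m : ℕ) : Prop :=
  j ⊑ om ∧ ∀ α, Ord α → Acc MK.E α → ∀ x, R K (W x) α (cond x q j) (num m)
variable {K}

theorem Ord.union {a b : M} (ha : Ord a) (hb : Ord b) : Ord (bun a b) := by
  have : bun a b = KPP.Un (upair a b) := rfl
  rw [this]
  refine Ord.Un fun x hx => ?_
  rcases (mem_upair _ _ _).1 hx with rfl | rfl <;> assumption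
theorem acc_bun {a b : M} (ha : Acc MK.E a) (hb : Acc MK.E b) : Acc MK.E (bun a b) :=
  Acc.intro _ fun y hy => ((mem_bun a b y).1 hy).elim (fun h => ha.inv h) (fun h => hb.inv h)
theorem acc_suc {a : M} (ha : Acc MK.E a) : Acc MK.E (suc a) :=
  Acc.intro _ fun y hy => ((mem_suc a y).1 hy).elim (fun h => ha.inv h) (fun h => h ▸ ha)

/-- one move of the game, pointwise -/
theorem Cons.move {q j : M} {m : ℕ} (h : Cons K q j m) {m' r : ℕ} (hm : m ≤ m') (hr : r < m')
    {α : M} (hα : Ord α) (hacc : Acc MK.E α) {x A : M}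
    (hA : A ∊ Pow (Pow (Dom (W x)))) (hreq : Req K (W x) (cond x q j) (num m) (num m') A (num r)) :
    ∃ q' o, cond x q j ⊑ q' ∧ o ∊ A ∧ o ⊑ q' ∧ R K (W x) α q' (num m') := by
  let β := bun α (num (m' + 1))
  have hβ : Ord β := hα.union (om_Ord (num_om _))
  have hβa : Acc MK.E β := acc_bun hacc (num_acc _)
  obtain ⟨h1, h2, h3, h4⟩ := (R_iff K).1 (h.2 (suc β) hβ.suc (acc_suc hβa) x)
  obtain ⟨q', h5, h6, h7, o, ho, hoq⟩ := h4 β ((mem_suc _ _).2 (Or.inr rfl)) (num m') (num_om _)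
    ((mem_bun _ _ _).2 (Or.inr (num_mem_num.2 (Nat.lt_succ_self _)))) (num_sub_num.2 hm) A hA (num r)
    (num_mem_num.2 hr) hreq
  refine ⟨q', o, h6, ho, hoq, R.mono K (sub_refl _) hβ (fun z hz => (mem_bun _ _ _).2 (Or.inl hz))
    (sub_refl _) ((mem_Pow _ _).1 h5) h7⟩

theorem Dl.consQ (q j n : M) (r s t : (ℕ → M) → M) [Tm r] [Tm s] [Tm t] :
    Dl (fun ρ => KPP.R K (KPP.W (t ρ)) (s ρ) (KPP.cond (t ρ) (KPP.bun q (r ρ)) j) n) := inferInstance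

/-- extension by one of the options -/
theorem Cons.step {q j : M} {m : ℕ} (h : Cons K q j m) {m' r : ℕ} (hm : m ≤ m') (hr : r < m')
    {A x₀ : M} (hreq : ∀ x, x₀ ⊑ x → A ∊ Pow (Pow (Dom (W x))) ∧
      Req K (W x) (cond x q j) (num m) (num m') A (num r)) :
    ∃ o, o ∊ A ∧ Cons K (bun q o) j m' := by
  obtain ⟨o, ho, h'⟩ := compactness A
    (fun o α x => R K (W x) α (cond x (bun q o) j) (num m')) (fun r s t _ _ _ => Dl.consQ q j _ r s t)
    (fun o α β x x' hα hβ hba hx hR => hR.mono K (W_mono hx) hα hba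
      (cond_mono hx (sub_refl _) (sub_refl _)) (cond_Dom h.1))
    (fun α hα hacc x => by
      obtain ⟨hA, hrq⟩ := hreq (bun x₀ x) (fun z hz => (mem_bun _ _ _).2 (Or.inl hz))
      obtain ⟨q', o, h1, h2, h3, h4⟩ := h.move hm hr hα hacc hA hrq
      have hx : x ⊑ bun x₀ x := fun z hz => (mem_bun _ _ _).2 (Or.inr hz)
      refine ⟨o, h2, h4.mono K (W_mono hx) hα (sub_refl _) ?_ (cond_Dom h.1)⟩
      intro z hz
      rcases mem_cond.1 hz with ⟨hz, hzD⟩ | hz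
      · rcases (mem_bun _ _ _).1 hz with hz | hz
        · exact h1 z (mem_cond.2 (Or.inl ⟨hz, Dom_mono (W_mono hx) _ hzD⟩))
        · exact h3 z hz
      · exact h1 z (cond_mono hx (sub_refl _) (sub_refl _) z (mem_cond.2 (Or.inr hz))))
  exact ⟨o, ho, h.1, h'⟩
end
end KPP

set_option linter.unusedVariables false
set_option linter.unusedSectionVars false
set_option linter.unusedSimpArgs false
set_option linter.style.longLine false

/-! ## Part 7: the extension steps -/
namespace KPP
section
variable {M : Type} [MK M] {K : Rules}

theorem sing_PowDom {t w : M} (h : t ∊ Dom w) : sing t ∊ Pow (Dom w) := by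
  rw [mem_Pow]; intro z hz; rw [mem_sing] at hz; rwa [hz]
theorem tG_cond {i : ℕ} {a x q j : M} (h : tG (num i) a ∊ q) (ha : a ∊ W x) :
    tG (num i) a ∊ cond x q j :=
  mem_cond.2 (Or.inl ⟨h, tG_Dom.2 ⟨num_om i, ha⟩⟩)
theorem tT_cond {i : ℕ} {x q j : M} (h : tT (num i) ∊ q) : tT (num i) ∊ cond x q j :=
  mem_cond.2 (Or.inl ⟨h, tT_Dom.2 ⟨num_om i, emp_W x⟩⟩)

theorem Cons.st1 {q j : M} {m : ℕ} (h : Cons K q j m) (r : ℕ) (h1 : tT (num (K.ra r)) ∊ q)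
    (h2 : tT (num (K.rb r)) ∊ q) : ∃ m', m ≤ m' ∧
    (Cons K (bun q (sing (tT (num (K.rc r))))) j m' ∨ Cons K (bun q (sing (tT (num (K.rd r))))) j m') := by
  refine ⟨m + r + K.rc r + K.rd r + 1, by omega, ?_⟩
  obtain ⟨o, ho, hc⟩ := h.step (m' := m + r + K.rc r + K.rd r + 1) (r := r) (by omega) (by omega)
    (A := upair (sing (tT (num (K.rc r)))) (sing (tT (num (K.rd r))))) (x₀ := emp) (fun x _ => by
      constructor
      · rw [mem_Pow]
        intro z hz
        rcases (mem_upair _ _ _).1 hz with rfl | rfl <;>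
        exact sing_PowDom (tT_Dom.2 ⟨num_om _, emp_W x⟩)
      · refine Or.inl ?_
        unfold D1
        simp only [RA_num, RB_num, RC_num, RD_num, num_mem_num, mem_upair]
        exact ⟨tT_cond h1, tT_cond h2, by omega, by omega, Or.inl trivial, Or.inr trivial⟩)
  rcases (mem_upair _ _ _).1 ho with rfl | rfl
  · exact Or.inl hc
  · exact Or.inr hc

theorem Cons.st2 {q j : M} {m : ℕ} (h : Cons K q j m) (r : ℕ) (b : M) (h1 : tT (num (K.mc r)) ∊ q)
    (h2 : tG (num r.unpair.2) b ∊ q) : ∃ m', m ≤ m' ∧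
    ∃ a, a ∊ b ∧ Cons K (bun q (sing (tG (num r.unpair.1) a))) j m' := by
  refine ⟨m + r + 1, by omega, ?_⟩
  obtain ⟨o, ho, hc⟩ := h.step (m' := m + r + 1) (r := r) (by omega) (by omega)
    (A := img b (fun a => sing (tG (num r.unpair.1) a))) (x₀ := b) (fun x hx => by
      have hb : b ∊ W x := W_mono hx _ (mem_W b)
      constructor
      · rw [mem_Pow]
        intro z hz
        obtain ⟨a, ha, rfl⟩ := (mem_img _ _ _).1 hz
        exact sing_PowDom (tG_Dom.2 ⟨num_om _, W_tr ha hb⟩)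
      · refine Or.inr (Or.inl ⟨b, hb, ?_⟩)
        simp only [MC_num, nleft_num, nright_num]
        exact ⟨tT_cond h1, tG_cond h2 hb, fun a ha => (mem_img _ _ _).2 ⟨a, ha, rfl⟩⟩)
  obtain ⟨a, ha, rfl⟩ := (mem_img _ _ _).1 ho
  exact ⟨a, ha, hc⟩

theorem Cons.st3 {q j : M} {m : ℕ} (h : Cons K q j m) (r : ℕ) (b : M) (h1 : tT (num (K.sc r)) ∊ q)
    (h2 : tG (num r.unpair.2) b ∊ q) : ∃ m', m ≤ m' ∧
    ∃ a, a ⊑ b ∧ Cons K (bun q (sing (tG (num r.unpair.1) a))) j m' := by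
  refine ⟨m + r + 1, by omega, ?_⟩
  obtain ⟨o, ho, hc⟩ := h.step (m' := m + r + 1) (r := r) (by omega) (by omega)
    (A := img (Pow b) (fun a => sing (tG (num r.unpair.1) a))) (x₀ := b) (fun x hx => by
      have hb : b ∊ W x := W_mono hx _ (mem_W b)
      constructor
      · rw [mem_Pow]
        intro z hz
        obtain ⟨a, ha, rfl⟩ := (mem_img _ _ _).1 hz
        exact sing_PowDom (tG_Dom.2 ⟨num_om _, W_sub ((mem_Pow _ _).1 ha) hb⟩)
      · refine Or.inr (Or.inr (Or.inl ⟨b, hb, ?_⟩))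
        simp only [SC_num, nleft_num, nright_num]
        exact ⟨tT_cond h1, tG_cond h2 hb, fun a ha => (mem_img _ _ _).2 ⟨a, ha, rfl⟩⟩)
  obtain ⟨a, ha, rfl⟩ := (mem_img _ _ _).1 ho
  exact ⟨a, (mem_Pow _ _).1 ha, hc⟩

theorem Cons.st4 {q j : M} {m : ℕ} (h : Cons K q j m) (r : ℕ) {a b : M} (hab : a ∊ b)
    (h1 : tG (num r.unpair.1) a ∊ q)
    (h2 : tG (num r.unpair.2) b ∊ q) : ∃ m', m ≤ m' ∧
    Cons K (bun q (sing (tT (num (K.mc r))))) j m' := by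
  refine ⟨m + r + K.mc r + 1, by omega, ?_⟩
  obtain ⟨o, ho, hc⟩ := h.step (m' := m + r + K.mc r + 1) (r := r) (by omega) (by omega)
    (A := sing (sing (tT (num (K.mc r))))) (x₀ := b) (fun x hx => by
      have hb : b ∊ W x := W_mono hx _ (mem_W b)
      constructor
      · rw [mem_Pow]
        intro z hz
        rw [mem_sing] at hz
        rw [hz]
        exact sing_PowDom (tT_Dom.2 ⟨num_om _, emp_W x⟩)
      · refine Or.inr (Or.inr (Or.inr (Or.inl ⟨b, hb, a, hab, ?_⟩)))
        simp only [MC_num, nleft_num, nright_num, num_mem_num, mem_sing]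
        exact ⟨tG_cond h1 (W_tr hab hb), tG_cond h2 hb, by omega, trivial⟩)
  rw [mem_sing] at ho
  rw [← ho]; exact hc

theorem Cons.st5 {q j : M} {m : ℕ} (h : Cons K q j m) (a : M) : ∃ m', m ≤ m' ∧
    Cons K (bun q (sing (tG (num (2 * m)) a))) j m' := by
  refine ⟨2 * m + 1, by omega, ?_⟩
  obtain ⟨o, ho, hc⟩ := h.step (m' := 2 * m + 1) (r := m) (by omega) (by omega)
    (A := sing (sing (tG (num (2 * m)) a))) (x₀ := a) (fun x hx => by
      have hb : a ∊ W x := W_mono hx _ (mem_W a)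
      constructor
      · rw [mem_Pow]
        intro z hz
        rw [mem_sing] at hz
        rw [hz]
        exact sing_PowDom (tG_Dom.2 ⟨num_om _, hb⟩)
      · refine Or.inr (Or.inr (Or.inr (Or.inr (Or.inl ⟨a, hb, ?_⟩))))
        simp only [fr_num, num_mem_num, mem_sing]
        exact ⟨sub_refl _, by omega, trivial⟩)
  rw [mem_sing] at ho
  rw [← ho]; exact hc

theorem hs_mono {i j w w' : M} (h : i ⊑ j) (hw : w ⊑ w') : hs i w ⊑ hs j w' := by
  intro z hz
  obtain ⟨i, v, h1, h2, rfl⟩ := mem_hs.1 hz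
  exact tH_hs.2 ⟨h _ h1, hw _ h2⟩

theorem Cons.st6 {q j : M} {m : ℕ} (h : Cons K q j m) (r : ℕ) : ∃ m', m ≤ m' ∧
    ((∃ a, Cons K (bun q (sing (tG (num r) a))) j m') ∨ Cons K q (bun j (sing (num r))) m') := by
  refine ⟨m + r + 1, by omega, ?_⟩
  by_cases hc : Cons K q (bun j (sing (num r))) (m + r + 1)
  · exact Or.inr hc
  left
  have hj : bun j (sing (num r)) ⊑ om := by
    intro z hz
    rcases (mem_bun _ _ _).1 hz with h' | h'
    · exact h.1 _ h'
    · rw [mem_sing] at h'; rw [h']; exact num_om r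
  have : ∃ α x₀, Ord α ∧ Acc MK.E α ∧
      ¬ R K (W x₀) α (cond x₀ q (bun j (sing (num r)))) (num (m + r + 1)) := by
    by_contra hn
    push Not at hn
    exact hc ⟨hj, fun α h1 h2 x => hn α x h1 h2⟩
  obtain ⟨α₀, x₀, hα₀, hacc₀, hR⟩ := this
  have hA : ∀ x, x₀ ⊑ x →
      bun (img (V x₀) (fun a => sing (tG (num r) a))) (sing (hs (sing (num r)) (Pow (V x₀)))) ∊
        Pow (Pow (Dom (W x))) := by
    intro x hx
    rw [mem_Pow]
    intro z hz
    rcases (mem_bun _ _ _).1 hz with hz | hz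
    · obtain ⟨a, ha, rfl⟩ := (mem_img _ _ _).1 hz
      exact sing_PowDom (tG_Dom.2 ⟨num_om _, W_tr ha (W_mono hx _ ((mem_Pow _ _).2 (sub_refl _)))⟩)
    · rw [mem_sing] at hz
      rw [hz, mem_Pow]
      intro y hy
      obtain ⟨i, v, h1, h2, rfl⟩ := mem_hs.1 hy
      rw [mem_sing] at h1
      rw [h1]
      exact tH_Dom.2 ⟨num_om _, W_mono hx _ h2⟩
  have hreq : ∀ x, x₀ ⊑ x → Req K (W x) (cond x q j) (num m) (num (m + r + 1))
      (bun (img (V x₀) (fun a => sing (tG (num r) a))) (sing (hs (sing (num r)) (Pow (V x₀))))) (num r) := by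
    intro x hx
    refine Or.inr (Or.inr (Or.inr (Or.inr (Or.inr (Or.inl ⟨V x₀, ?_, ?_, ?_⟩)))))
    · exact W_mono hx _ ((mem_Pow _ _).2 (sub_refl _))
    · intro a ha
      exact (mem_bun _ _ _).2 (Or.inl ((mem_img _ _ _).2 ⟨a, ha, rfl⟩))
    · exact (mem_bun _ _ _).2 (Or.inr ((mem_sing _ _).2 rfl))
  obtain ⟨o, ho, h'⟩ := compactness (img (V x₀) (fun a => sing (tG (num r) a)))
    (fun o α x => R K (W x) α (cond x (bun q o) j) (num (m + r + 1)))
    (fun r s t _ _ _ => Dl.consQ q j _ r s t)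
    (fun o α β x x' hα hβ hba hx hR => hR.mono K (W_mono hx) hα hba
      (cond_mono hx (sub_refl _) (sub_refl _)) (cond_Dom h.1))
    (fun α hα hacc x => by
      have hx₀ : x₀ ⊑ bun x₀ x := fun z hz => (mem_bun _ _ _).2 (Or.inl hz)
      have hx : x ⊑ bun x₀ x := fun z hz => (mem_bun _ _ _).2 (Or.inr hz)
      obtain ⟨q', o, h1, h2, h3, h4⟩ := h.move (m' := m + r + 1) (r := r) (by omega) (by omega)
        (hα.union hα₀) (acc_bun hacc hacc₀) (hA _ hx₀) (hreq _ hx₀)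
      rcases (mem_bun _ _ _).1 h2 with h2 | h2
      · refine ⟨o, h2, h4.mono K (W_mono hx) (hα.union hα₀) (fun z hz => (mem_bun _ _ _).2 (Or.inl hz)) ?_
          (cond_Dom h.1)⟩
        intro z hz
        rcases mem_cond.1 hz with ⟨hz, hzD⟩ | hz
        · rcases (mem_bun _ _ _).1 hz with hz | hz
          · exact h1 z (mem_cond.2 (Or.inl ⟨hz, Dom_mono (W_mono hx) _ hzD⟩))
          · exact h3 z hz
        · exact h1 z (cond_mono hx (sub_refl _) (sub_refl _) z (mem_cond.2 (Or.inr hz)))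
      · exfalso
        apply hR
        rw [mem_sing] at h2
        subst h2
        refine h4.mono K (W_mono hx₀) (hα.union hα₀) (fun z hz => (mem_bun _ _ _).2 (Or.inr hz)) ?_
          (cond_Dom hj)
        intro z hz
        rcases mem_cond.1 hz with ⟨hz, hzD⟩ | hz
        · exact h1 z (mem_cond.2 (Or.inl ⟨hz, Dom_mono (W_mono hx₀) _ hzD⟩))
        · obtain ⟨i, v, h5, h6, rfl⟩ := mem_hs.1 hz
          rcases (mem_bun _ _ _).1 h5 with h5 | h5
          · exact h1 _ (mem_cond.2 (Or.inr (tH_hs.2 ⟨h5, W_mono hx₀ _ h6⟩)))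
          · exact h3 _ (tH_hs.2 ⟨h5, h6⟩))
  obtain ⟨a, ha, rfl⟩ := (mem_img _ _ _).1 ho
  exact ⟨a, h.1, h'⟩

theorem Cons.st7 {q j : M} {m : ℕ} (h : Cons K q j m) (i : ℕ) (hi : num i ∊ j) : ∃ m', m ≤ m' ∧
    Cons K (bun q (sing (tT (num (K.mc (Nat.pair (2 * m) i)))))) (bun j (sing (num (2 * m)))) m' := by
  have hj : bun j (sing (num (2 * m))) ⊑ om := by
    intro z hz
    rcases (mem_bun _ _ _).1 hz with h' | h'
    · exact h.1 _ h'
    · rw [mem_sing] at h'; rw [h']; exact num_om _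
  set c := K.mc (Nat.pair (2 * m) i) with hc
  set r := Nat.pair i m with hr
  set m' := 2 * m + r + c + 1 with hm'
  refine ⟨m', by omega, hj, fun α hα hacc x => ?_⟩
  set x' := bun x (sing (V x)) with hx'
  have hx : x ⊑ x' := fun z hz => (mem_bun _ _ _).2 (Or.inl hz)
  have hv : V x ∊ W x' := W_mono hx _ ((mem_Pow _ _).2 (sub_refl _))
  have hu : W x ∊ W x' := by
    rw [W, W, mem_Pow]
    intro z hz
    rw [mem_Pow] at hz
    exact (mem_V _ _).2 ⟨V x, (mem_bun _ _ _).2 (Or.inr ((mem_sing _ _).2 rfl)),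
      sub_trans hz (sub_V _)⟩
  obtain ⟨q', o, h1, h2, h3, h4⟩ := h.move (m' := m') (r := r) (by omega) (by omega) hα hacc
    (A := sing (bun (sing (tT (num c))) (hs (sing (num (2 * m))) (Pow (V x))))) (x := x')
    (by
      rw [mem_Pow]
      intro z hz
      rw [mem_sing] at hz
      rw [hz, mem_Pow]
      intro y hy
      rcases (mem_bun _ _ _).1 hy with hy | hy
      · rw [mem_sing] at hy
        rw [hy]
        exact tT_Dom.2 ⟨num_om _, emp_W _⟩
      · obtain ⟨i, v, h1, h2, rfl⟩ := mem_hs.1 hy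
        rw [mem_sing] at h1
        rw [h1]
        exact tH_Dom.2 ⟨num_om _, W_mono hx _ h2⟩)
    (by
      refine Or.inr (Or.inr (Or.inr (Or.inr (Or.inr (Or.inr ⟨W x, hu, V x, hv, sub_refl _, ?_⟩)))))
      simp only [nleft_num, nright_num, fr_num, M7_num, hr, Nat.unpair_pair, num_mem_num, mem_sing]
      refine ⟨mem_cond.2 (Or.inr (tH_hs.2 ⟨hi, hu⟩)), sub_refl _, by omega, by omega, ?_⟩
      rw [← hc])
  rw [mem_sing] at h2
  subst h2
  refine h4.mono K (W_mono hx) hα (sub_refl _) ?_ (cond_Dom hj)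
  intro z hz
  rcases mem_cond.1 hz with ⟨hz, hzD⟩ | hz
  · rcases (mem_bun _ _ _).1 hz with hz | hz
    · exact h1 z (mem_cond.2 (Or.inl ⟨hz, Dom_mono (W_mono hx) _ hzD⟩))
    · exact h3 z ((mem_bun _ _ _).2 (Or.inl hz))
  · obtain ⟨i, v, h5, h6, rfl⟩ := mem_hs.1 hz
    rcases (mem_bun _ _ _).1 h5 with h5 | h5
    · exact h1 _ (mem_cond.2 (Or.inr (tH_hs.2 ⟨h5, W_mono hx _ h6⟩)))
    · exact h3 _ ((mem_bun _ _ _).2 (Or.inr (tH_hs.2 ⟨h5, h6⟩)))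

/-! static consequences -/
theorem Cons.bot {q j : M} {m : ℕ} (h : Cons K q j m) : ¬ tT (num K.bot) ∊ q := fun hb =>
  ((R_iff K).1 (h.2 emp Ord.emp (num_acc 0) emp)).2.2.1.1 (tT_cond hb)
theorem Cons.fn {q j : M} {m : ℕ} (h : Cons K q j m) {i : ℕ} {a b : M} (ha : tG (num i) a ∊ q)
    (hb : tG (num i) b ∊ q) : a = b := by
  have h1 : a ∊ W (bun a b) := W_mono (fun z hz => (mem_bun _ _ _).2 (Or.inl hz)) _ (mem_W a)
  have h2 : b ∊ W (bun a b) := W_mono (fun z hz => (mem_bun _ _ _).2 (Or.inr hz)) _ (mem_W b)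
  exact ((R_iff K).1 (h.2 emp Ord.emp (num_acc 0) (bun a b))).2.2.1.2.1 (num i) (num_om i) a h1 b h2
    (tG_cond ha h1) (tG_cond hb h2)
theorem Cons.disj {q j : M} {m : ℕ} (h : Cons K q j m) {i : ℕ} {a : M} (ha : tG (num i) a ∊ q) :
    ¬ num i ∊ j := by
  intro hj
  have h2 : sing a ∊ W (sing a) := mem_W _
  have h1 : a ∊ W (sing a) := W_tr ((mem_sing _ _).2 rfl) h2
  exact ((R_iff K).1 (h.2 emp Ord.emp (num_acc 0) (sing a))).2.2.1.2.2 (num i) (num_om i) a h1 (sing a) h2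
    (tG_cond ha h1) (mem_cond.2 (Or.inr (tH_hs.2 ⟨hj, h2⟩))) ((mem_sing _ _).2 rfl)

/-- the initial state -/
theorem Cons.init (S : Sem M K) {top : ℕ} (htop : ∀ u, S.tru u top) :
    Cons (M := M) K (sing (tT (num top))) (sing (num 0)) (top + 1) := by
  refine ⟨fun z hz => by rw [mem_sing] at hz; rw [hz]; exact num_om 0, fun α hα hacc x => ?_⟩
  refine Real.R S hacc (u := fun _ => V x) ?_ ((mem_Pow _ _).2 (cond_Dom
    (fun z hz => by rw [mem_sing] at hz; rw [hz]; exact num_om 0)))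
  refine ⟨fun i hi => ?_, fun i a hi => ?_, fun i v hi => ?_⟩ <;> rcases mem_cond.1 hi with hi | hi
  · rw [mem_sing, tT_tT] at hi
    exact ⟨top, by omega, hi.1, htop _⟩
  · exact (tT_hs hi).elim
  · rw [mem_sing] at hi
    exact (tG_tT hi.1).elim
  · exact (tG_hs hi).elim
  · rw [mem_sing] at hi
    exact (tH_tT hi.1).elim
  · rw [tH_hs, mem_sing] at hi
    refine ⟨0, by omega, hi.1, fun h => ?_⟩
    have := S.s5 (fun _ => V x) 0
    rw [mul_zero] at this
    rw [this] at h
    exact not_mem_self _ ((mem_Pow _ _).1 hi.2 _ h)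
end
end KPP

set_option linter.unusedVariables false
set_option linter.unusedSectionVars false
set_option linter.unusedSimpArgs false
set_option linter.style.longLine false

/-! ## Part 8: the generic limit -/
namespace KPP

theorem generic_seq {St : Type} [Preorder St] {ι : Type} [Countable ι] (P C : ι → St → Prop)
    (hP : ∀ i s s', s ≤ s' → P i s → P i s') (h : ∀ i s, P i s → ∃ s', s ≤ s' ∧ C i s') (s₀ : St) :
    ∃ I : Set St, s₀ ∈ I ∧ (∀ s ∈ I, ∀ s' ∈ I, ∃ t ∈ I, s ≤ t ∧ s' ≤ t) ∧
      ∀ i, (∃ s ∈ I, P i s) → ∃ s ∈ I, C i s := by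
  classical
  have := Encodable.ofCountable ι
  let 𝒟 : ι → Order.Cofinal St := fun i =>
    ⟨{s | C i s ∨ ∀ s', s ≤ s' → ¬ P i s'}, fun s => by
      by_cases hs : ∃ s', s ≤ s' ∧ P i s'
      · obtain ⟨s', h1, h2⟩ := hs
        obtain ⟨t, h3, h4⟩ := h i s' h2
        exact ⟨t, Or.inl h4, h1.trans h3⟩
      · push Not at hs
        exact ⟨s, Or.inr hs, le_refl s⟩⟩
  let I := Order.idealOfCofinals s₀ 𝒟
  refine ⟨I, Order.mem_idealOfCofinals s₀ 𝒟, fun s hs s' hs' => ?_, fun i hi => ?_⟩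
  · obtain ⟨t, h1, h2, h3⟩ := I.directed s hs s' hs'
    exact ⟨t, h1, h2, h3⟩
  · obtain ⟨s, hs, hPs⟩ := hi
    obtain ⟨t, ht, htI⟩ := Order.cofinal_meets_idealOfCofinals s₀ 𝒟 i
    rcases ht with ht | ht
    · exact ⟨t, htI, ht⟩
    · obtain ⟨z, h1, h2, h3⟩ := I.directed s hs t htI
      exact (ht z h3 (hP i _ _ h2 hPs)).elim

section
variable {M : Type} [MK M] {K : Rules}

variable (M K) in
structure St where
  q : M
  j : M
  m : ℕ
  c : Cons K q j m
instance : Preorder (St M K) where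
  le s t := s.q ⊑ t.q ∧ s.j ⊑ t.j
  le_refl s := ⟨sub_refl _, sub_refl _⟩
  le_trans s t u h h' := ⟨sub_trans h.1 h'.1, sub_trans h.2 h'.2⟩
theorem St.le_def {s t : St M K} : s ≤ t ↔ s.q ⊑ t.q ∧ s.j ⊑ t.j := Iff.rfl

theorem sub_bunl (a b : M) : a ⊑ bun a b := fun z hz => (mem_bun _ _ _).2 (Or.inl hz)
theorem mem_bun_sing (a b : M) : b ∊ bun a (sing b) := (mem_bun _ _ _).2 (Or.inr ((mem_sing _ _).2 rfl))

variable (M) in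
abbrev Task : Type := ℕ ⊕ (ℕ × M) ⊕ (ℕ × M) ⊕ (ℕ × M × M) ⊕ M ⊕ ℕ ⊕ ℕ

def Task.P (s : St M K) : Task M → Prop
  | .inl r => tT (num (K.ra r)) ∊ s.q ∧ tT (num (K.rb r)) ∊ s.q
  | .inr (.inl (r, b)) => tT (num (K.mc r)) ∊ s.q ∧ tG (num r.unpair.2) b ∊ s.q
  | .inr (.inr (.inl (r, b))) => tT (num (K.sc r)) ∊ s.q ∧ tG (num r.unpair.2) b ∊ s.q
  | .inr (.inr (.inr (.inl (r, a, b)))) => a ∊ b ∧ tG (num r.unpair.1) a ∊ s.q ∧ tG (num r.unpair.2) b ∊ s.q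
  | .inr (.inr (.inr (.inr (.inl a)))) => True
  | .inr (.inr (.inr (.inr (.inr (.inl r))))) => True
  | .inr (.inr (.inr (.inr (.inr (.inr i))))) => num i ∊ s.j

def Task.C (s : St M K) : Task M → Prop
  | .inl r => tT (num (K.rc r)) ∊ s.q ∨ tT (num (K.rd r)) ∊ s.q
  | .inr (.inl (r, b)) => ∃ a, a ∊ b ∧ tG (num r.unpair.1) a ∊ s.q
  | .inr (.inr (.inl (r, b))) => ∃ a, a ⊑ b ∧ tG (num r.unpair.1) a ∊ s.q
  | .inr (.inr (.inr (.inl (r, a, b)))) => tT (num (K.mc r)) ∊ s.q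
  | .inr (.inr (.inr (.inr (.inl a)))) => ∃ i : ℕ, tG (num i) a ∊ s.q
  | .inr (.inr (.inr (.inr (.inr (.inl r))))) => (∃ a, tG (num r) a ∊ s.q) ∨ num r ∊ s.j
  | .inr (.inr (.inr (.inr (.inr (.inr i))))) => ∃ k : ℕ, num k ∊ s.j ∧ tT (num (K.mc (Nat.pair k i))) ∊ s.q

theorem Task.mono (i : Task M) (s s' : St M K) (h : s ≤ s') (hp : i.P s) : i.P s' := by
  rcases i with r | ⟨r, b⟩ | ⟨r, b⟩ | ⟨r, a, b⟩ | a | r | i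
  · exact ⟨h.1 _ hp.1, h.1 _ hp.2⟩
  · exact ⟨h.1 _ hp.1, h.1 _ hp.2⟩
  · exact ⟨h.1 _ hp.1, h.1 _ hp.2⟩
  · exact ⟨hp.1, h.1 _ hp.2.1, h.1 _ hp.2.2⟩
  · trivial
  · trivial
  · exact h.2 _ hp

theorem Task.meet (i : Task M) (s : St M K) (hp : i.P s) : ∃ s' : St M K, s ≤ s' ∧ i.C s' := by
  rcases i with r | ⟨r, b⟩ | ⟨r, b⟩ | ⟨r, a, b⟩ | a | r | i
  · obtain ⟨m', _, h | h⟩ := s.c.st1 r hp.1 hp.2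
    · exact ⟨⟨_, _, _, h⟩, ⟨sub_bunl _ _, sub_refl _⟩, Or.inl (mem_bun_sing _ _)⟩
    · exact ⟨⟨_, _, _, h⟩, ⟨sub_bunl _ _, sub_refl _⟩, Or.inr (mem_bun_sing _ _)⟩
  · obtain ⟨m', _, a, ha, h⟩ := s.c.st2 r b hp.1 hp.2
    exact ⟨⟨_, _, _, h⟩, ⟨sub_bunl _ _, sub_refl _⟩, a, ha, mem_bun_sing _ _⟩
  · obtain ⟨m', _, a, ha, h⟩ := s.c.st3 r b hp.1 hp.2
    exact ⟨⟨_, _, _, h⟩, ⟨sub_bunl _ _, sub_refl _⟩, a, ha, mem_bun_sing _ _⟩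
  · obtain ⟨m', _, h⟩ := s.c.st4 r hp.1 hp.2.1 hp.2.2
    exact ⟨⟨_, _, _, h⟩, ⟨sub_bunl _ _, sub_refl _⟩, mem_bun_sing _ _⟩
  · obtain ⟨m', _, h⟩ := s.c.st5 a
    exact ⟨⟨_, _, _, h⟩, ⟨sub_bunl _ _, sub_refl _⟩, _, mem_bun_sing _ _⟩
  · obtain ⟨m', _, ⟨a, h⟩ | h⟩ := s.c.st6 r
    · exact ⟨⟨_, _, _, h⟩, ⟨sub_bunl _ _, sub_refl _⟩, Or.inl ⟨a, mem_bun_sing _ _⟩⟩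
    · exact ⟨⟨_, _, _, h⟩, ⟨sub_refl _, sub_bunl _ _⟩, Or.inr (mem_bun_sing _ _)⟩
  · obtain ⟨m', _, h⟩ := s.c.st7 i hp
    exact ⟨⟨_, _, _, h⟩, ⟨sub_bunl _ _, sub_bunl _ _⟩, _, mem_bun_sing _ _, mem_bun_sing _ _⟩

/-- the generic diagram -/
structure Gen (M : Type) [MK M] (K : Rules) (top : ℕ) where
  T : ℕ → Prop
  G : ℕ → M → Prop
  J : ℕ → Prop
  rule : ∀ r, T (K.ra r) → T (K.rb r) → T (K.rc r) ∨ T (K.rd r)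
  bot : ¬ T K.bot
  top : T top
  mem : ∀ i j b, T (K.mc (Nat.pair i j)) → G j b → ∃ a, a ∊ b ∧ G i a
  sub : ∀ i j b, T (K.sc (Nat.pair i j)) → G j b → ∃ a, a ⊑ b ∧ G i a
  dia : ∀ i j a b, a ∊ b → G i a → G j b → T (K.mc (Nat.pair i j))
  name : ∀ a, ∃ i, G i a
  dec : ∀ i, (∃ a, G i a) ∨ J i
  top' : ∀ i, J i → ∃ k, J k ∧ T (K.mc (Nat.pair k i))
  fn : ∀ i a b, G i a → G i b → a = b
  disj : ∀ i a, J i → ¬ G i a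
  ne : J 0

theorem Gen.ex [Countable M] (S : Sem M K) {top : ℕ} (htop : ∀ u, S.tru u top) :
    Nonempty (Gen M K top) := by
  obtain ⟨I, h0, hd, ht⟩ := generic_seq (St := St M K) (ι := Task M) (fun i s => i.P s) (fun i s => i.C s)
    (fun i s s' h => i.mono s s' h) (fun i s => i.meet s) ⟨_, _, _, Cons.init S htop⟩
  refine ⟨⟨fun k => ∃ s ∈ I, tT (num k) ∊ s.q, fun i a => ∃ s ∈ I, tG (num i) a ∊ s.q,
    fun i => ∃ s ∈ I, num i ∊ s.j, ?_, ?_, ?_, ?_, ?_, ?_, ?_, ?_, ?_, ?_, ?_, ?_⟩⟩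
  · rintro r ⟨s, hs, h1⟩ ⟨s', hs', h2⟩
    obtain ⟨t, htI, h3, h4⟩ := hd s hs s' hs'
    obtain ⟨t', ht', h⟩ := ht (.inl r) ⟨t, htI, h3.1 _ h1, h4.1 _ h2⟩
    exact h.imp (fun h => ⟨t', ht', h⟩) (fun h => ⟨t', ht', h⟩)
  · rintro ⟨s, hs, h1⟩
    exact s.c.bot h1
  · exact ⟨_, h0, (mem_sing _ _).2 rfl⟩
  · rintro i j b ⟨s, hs, h1⟩ ⟨s', hs', h2⟩
    obtain ⟨t, htI, h3, h4⟩ := hd s hs s' hs'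
    obtain ⟨t', ht', a, h5, h6⟩ := ht (.inr (.inl (Nat.pair i j, b)))
      ⟨t, htI, h3.1 _ h1, by rw [Nat.unpair_pair]; exact h4.1 _ h2⟩
    rw [Nat.unpair_pair] at h6
    exact ⟨a, h5, t', ht', h6⟩
  · rintro i j b ⟨s, hs, h1⟩ ⟨s', hs', h2⟩
    obtain ⟨t, htI, h3, h4⟩ := hd s hs s' hs'
    obtain ⟨t', ht', a, h5, h6⟩ := ht (.inr (.inr (.inl (Nat.pair i j, b))))
      ⟨t, htI, h3.1 _ h1, by rw [Nat.unpair_pair]; exact h4.1 _ h2⟩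
    rw [Nat.unpair_pair] at h6
    exact ⟨a, h5, t', ht', h6⟩
  · rintro i j a b hab ⟨s, hs, h1⟩ ⟨s', hs', h2⟩
    obtain ⟨t, htI, h3, h4⟩ := hd s hs s' hs'
    obtain ⟨t', ht', h6⟩ := ht (.inr (.inr (.inr (.inl (Nat.pair i j, a, b)))))
      ⟨t, htI, hab, by rw [Nat.unpair_pair]; exact h3.1 _ h1, by rw [Nat.unpair_pair]; exact h4.1 _ h2⟩
    exact ⟨t', ht', h6⟩
  · intro a
    obtain ⟨t', ht', i, h6⟩ := ht (.inr (.inr (.inr (.inr (.inl a))))) ⟨_, h0, trivial⟩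
    exact ⟨i, t', ht', h6⟩
  · intro i
    obtain ⟨t', ht', h6⟩ := ht (.inr (.inr (.inr (.inr (.inr (.inl i)))))) ⟨_, h0, trivial⟩
    exact h6.imp (fun ⟨a, h⟩ => ⟨a, t', ht', h⟩) (fun h => ⟨t', ht', h⟩)
  · rintro i ⟨s, hs, h1⟩
    obtain ⟨t', ht', k, h6, h7⟩ := ht (.inr (.inr (.inr (.inr (.inr (.inr i)))))) ⟨s, hs, h1⟩
    exact ⟨k, ⟨t', ht', h6⟩, t', ht', h7⟩
  · rintro i a b ⟨s, hs, h1⟩ ⟨s', hs', h2⟩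
    obtain ⟨t, htI, h3, h4⟩ := hd s hs s' hs'
    exact t.c.fn (h3.1 _ h1) (h4.1 _ h2)
  · rintro i a ⟨s, hs, h1⟩ ⟨s', hs', h2⟩
    obtain ⟨t, htI, h3, h4⟩ := hd s hs s' hs'
    exact t.c.disj (h4.1 _ h2) (h3.2 _ h1)
  · exact ⟨_, h0, (mem_sing _ _).2 rfl⟩
end
end KPP

set_option linter.unusedVariables false
set_option linter.unusedSectionVars false
set_option linter.unusedSimpArgs false
set_option linter.style.longLine false

/-! ## Part 9: the proof rules and their semantics -/
namespace KPP

def cm (i j : ℕ) : ℕ := Nat.pair 0 (Nat.pair i j)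
def ce (i j : ℕ) : ℕ := Nat.pair 1 (Nat.pair i j)
def cn (a : ℕ) : ℕ := Nat.pair 2 a
def ca (a b : ℕ) : ℕ := Nat.pair 3 (Nat.pair a b)
def c2 (t a b : ℕ) : ℕ := Nat.pair t (Nat.pair a b)
def cx (a : ℕ) : ℕ := Nat.pair 9 a
def cw (a : ℕ) : ℕ := Nat.pair 11 a
def csub (n i j : ℕ) : ℕ := cn (cx (ca (cm n i) (cn (cm n j))))
/-- the code of an atom: a formula code with a list of names -/
def atm (c : ℕ) (l : List ℕ) : ℕ := Nat.pair c (Encodable.encode l)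
def dl (k : ℕ) : List ℕ := Denumerable.ofNat (List ℕ) k.unpair.2

@[simp] theorem atm_fst (c l) : (atm c l).unpair.1 = c := by simp [atm]
@[simp] theorem dl_atm (c l) : dl (atm c l) = l := by simp [atm, dl]

theorem getD_le_encode (l : List ℕ) (i : ℕ) : l.getD i 0 ≤ Encodable.encode l := by
  induction l generalizing i with
  | nil => simp
  | cons a l ih =>
    rw [Encodable.encode_list_cons]
    cases i with
    | zero =>
      have := Nat.left_le_pair a (Encodable.encode l)
      simp only [List.getD_cons_zero, Encodable.encode_nat]; omega
    | succ i =>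
      have := Nat.right_le_pair a (Encodable.encode l)
      have := ih i
      simp only [List.getD_cons_succ, Encodable.encode_nat]; omega

theorem dl_le (k i : ℕ) : (dl k).getD i 0 ≤ k := by
  refine (getD_le_encode _ _).trans ?_
  simp only [dl, Denumerable.encode_ofNat]
  exact Nat.unpair_right_le k

theorem unpair2_lt {c : ℕ} (h : c.unpair.1 ≠ 0) : c.unpair.2 < c := by
  rcases Nat.lt_or_ge c.unpair.2 c with h1 | h1
  · exact h1
  · have h2 := Nat.pair_unpair c
    have h3 := Nat.unpair_right_le c
    have h4 : c.unpair.2 = c := le_antisymm h3 h1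
    have := Nat.add_le_pair c.unpair.1 c.unpair.2
    omega

theorem unpair21_lt {c : ℕ} (h : c.unpair.1 ≠ 0) : c.unpair.2.unpair.1 < c :=
  (Nat.unpair_left_le _).trans_lt (unpair2_lt h)
theorem unpair22_lt {c : ℕ} (h : c.unpair.1 ≠ 0) : c.unpair.2.unpair.2 < c :=
  (Nat.unpair_right_le _).trans_lt (unpair2_lt h)

section
variable {M : Type} (R : M → M → Prop)

def upd (v : ℕ → M) (n : ℕ) (x : M) : ℕ → M := Function.update v n x

/-- subset as expressed by the code `csub n i j` -/
def SubU (n i j : ℕ) (v : ℕ → M) : Prop :=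
  ¬ ∃ z, R (upd v n z n) (upd v n z i) ∧ ¬ R (upd v n z n) (upd v n z j)

def Ev (c n : ℕ) (v : ℕ → M) : Prop :=
  if h0 : c.unpair.1 = 0 then R (v c.unpair.2.unpair.1) (v c.unpair.2.unpair.2)
  else if c.unpair.1 = 1 then v c.unpair.2.unpair.1 = v c.unpair.2.unpair.2
  else if c.unpair.1 = 2 then ¬ Ev c.unpair.2 n v
  else if c.unpair.1 = 3 then Ev c.unpair.2.unpair.1 n v ∧ Ev c.unpair.2.unpair.2 n v
  else if c.unpair.1 = 4 then Ev c.unpair.2.unpair.1 n v ∨ Ev c.unpair.2.unpair.2 n v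
  else if c.unpair.1 = 5 then
    ∃ x, R (upd v n x n) (upd v n x c.unpair.2.unpair.1) ∧ Ev c.unpair.2.unpair.2 (n+1) (upd v n x)
  else if c.unpair.1 = 6 then
    ∀ x, R (upd v n x n) (upd v n x c.unpair.2.unpair.1) → Ev c.unpair.2.unpair.2 (n+1) (upd v n x)
  else if c.unpair.1 = 7 then
    ∃ x, SubU R (n+1) n c.unpair.2.unpair.1 (upd v n x) ∧ Ev c.unpair.2.unpair.2 (n+1) (upd v n x)
  else if c.unpair.1 = 8 then
    ∀ x, SubU R (n+1) n c.unpair.2.unpair.1 (upd v n x) → Ev c.unpair.2.unpair.2 (n+1) (upd v n x)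
  else if c.unpair.1 = 9 then ∃ x, Ev c.unpair.2 (n+1) (upd v n x)
  else if c.unpair.1 = 10 then ∀ x, Ev c.unpair.2 (n+1) (upd v n x)
  else if c.unpair.1 = 11 then ∃ φ : SF n, φ.encode = c.unpair.2
  else False
termination_by c
decreasing_by
  all_goals first | exact unpair2_lt h0 | exact unpair21_lt h0 | exact unpair22_lt h0

variable {R} {n : ℕ} {v : ℕ → M} {a b i j : ℕ}
theorem Ev_cm : Ev R (cm i j) n v ↔ R (v i) (v j) := by rw [Ev]; simp [cm]
theorem Ev_ce : Ev R (ce i j) n v ↔ v i = v j := by rw [Ev]; simp [ce]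
theorem Ev_cn : Ev R (cn a) n v ↔ ¬ Ev R a n v := by rw [Ev]; simp [cn]
theorem Ev_ca : Ev R (ca a b) n v ↔ Ev R a n v ∧ Ev R b n v := by rw [Ev]; simp [ca]
theorem Ev_4 : Ev R (c2 4 a b) n v ↔ Ev R a n v ∨ Ev R b n v := by rw [Ev]; simp [c2]
theorem Ev_5 : Ev R (c2 5 i a) n v ↔ ∃ x, R (upd v n x n) (upd v n x i) ∧ Ev R a (n+1) (upd v n x) := by
  rw [Ev]; simp [c2]
theorem Ev_6 : Ev R (c2 6 i a) n v ↔ ∀ x, R (upd v n x n) (upd v n x i) → Ev R a (n+1) (upd v n x) := by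
  rw [Ev]; simp [c2]
theorem Ev_7 : Ev R (c2 7 i a) n v ↔ ∃ x, SubU R (n+1) n i (upd v n x) ∧ Ev R a (n+1) (upd v n x) := by
  rw [Ev]; simp [c2]
theorem Ev_8 : Ev R (c2 8 i a) n v ↔ ∀ x, SubU R (n+1) n i (upd v n x) → Ev R a (n+1) (upd v n x) := by
  rw [Ev]; simp [c2]
theorem Ev_cx : Ev R (cx a) n v ↔ ∃ x, Ev R a (n+1) (upd v n x) := by rw [Ev]; simp [cx]
theorem Ev_10 : Ev R (Nat.pair 10 a) n v ↔ ∀ x, Ev R a (n+1) (upd v n x) := by rw [Ev]; simp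
theorem Ev_cw : Ev R (cw a) n v ↔ ∃ φ : SF n, φ.encode = a := by rw [Ev]; simp [cw]
theorem Ev_csub : Ev R (csub n i j) n v ↔ SubU R n i j v := by
  simp only [csub, SubU, Ev_cn, Ev_cx, Ev_ca, Ev_cm]

theorem upd_self (x : M) : upd v n x n = x := by simp [upd]
theorem upd_lt {x : M} (h : i < n) : upd v n x i = v i := by
  simp [upd, Function.update_of_ne (show i ≠ n by omega)]

theorem SubU_iff (hi : i < n) (hj : j < n) : SubU R n i j v ↔ SubE R (v i) (v j) := by
  simp only [SubU, SubE, upd_self, upd_lt hi, upd_lt hj]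
  push Not; rfl

theorem snoc_upd (x : M) : (Fin.snoc (fun i : Fin n => v i) x : Fin (n+1) → M) = fun i : Fin (n+1) => upd v n x i := by
  funext i
  refine Fin.lastCases ?_ (fun i => ?_) i
  · simp [upd]
  · simp [upd_lt i.2]

theorem Ev_encode : ∀ {n : ℕ} (φ : SF n) (v : ℕ → M), Ev R φ.encode n v ↔ φ.Eval R (fun i => v i)
  | _, .mem i j, v => Ev_cm
  | _, .eq i j, v => Ev_ce
  | _, .not φ, v => (Ev_cn (a := φ.encode)).trans (not_congr (Ev_encode φ v))
  | _, .and φ ψ, v => (Ev_ca (a := φ.encode)).trans (and_congr (Ev_encode φ v) (Ev_encode ψ v))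
  | _, .or φ ψ, v => (Ev_4 (a := φ.encode)).trans (or_congr (Ev_encode φ v) (Ev_encode ψ v))
  | n, .bexMem i φ, v => (Ev_5 (a := φ.encode)).trans (by
      simp only [Ev_encode φ, SF.Eval, snoc_upd, upd_self, upd_lt i.2])
  | n, .ballMem i φ, v => (Ev_6 (a := φ.encode)).trans (by
      simp only [Ev_encode φ, SF.Eval, snoc_upd, upd_self, upd_lt i.2])
  | n, .bexSub i φ, v => (Ev_7 (a := φ.encode)).trans (by
      simp only [Ev_encode φ, SF.Eval, snoc_upd, upd_self, upd_lt i.2, SubU_iff (Nat.lt_succ_self n) (Nat.lt_succ_of_lt i.2)])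
  | n, .ballSub i φ, v => (Ev_8 (a := φ.encode)).trans (by
      simp only [Ev_encode φ, SF.Eval, snoc_upd, upd_self, upd_lt i.2, SubU_iff (Nat.lt_succ_self n) (Nat.lt_succ_of_lt i.2)])
  | n, .ex φ, v => (Ev_cx (a := φ.encode)).trans (by simp only [Ev_encode φ, SF.Eval, snoc_upd])
  | n, .all φ, v => (Ev_10 (a := φ.encode)).trans (by simp only [Ev_encode φ, SF.Eval, snoc_upd])

open Classical in
noncomputable def pick (R : M → M → Prop) (a n : ℕ) (v : ℕ → M) (d : M) : M :=
  if h : ∃ x, Ev R a (n + 1) (upd v n x) then h.choose else d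

theorem pick_spec {d : M} (h : ∃ x, Ev R a (n + 1) (upd v n x)) :
    Ev R a (n + 1) (upd v n (pick R a n v d)) := by
  unfold pick; rw [dif_pos h]; exact h.choose_spec

/-- the interpretation of names -/
noncomputable def en (R : M → M → Prop) (u : ℕ → M) (k : ℕ) : M :=
  if h : k % 2 = 0 then u (k / 2)
  else pick R (k / 2).unpair.1.unpair.2 (dl (k / 2)).length (fun i => en R u ((dl (k / 2)).getD i 0)) (u 0)
termination_by k
decreasing_by
  have := dl_le (k / 2) i
  omega

/-- the assignment given by a list of names -/
noncomputable def asg (R : M → M → Prop) (u : ℕ → M) (l : List ℕ) : ℕ → M := fun i => en R u (l.getD i 0)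

theorem asg_concat (u : ℕ → M) (l : List ℕ) (k : ℕ) :
    asg R u (l ++ [k]) = upd (asg R u l) l.length (en R u k) := by
  funext i
  rcases lt_trichotomy i l.length with h | h | h
  · simp [asg, upd_lt h, List.getElem?_append_left h]
  · subst h; simp [asg, upd_self]
  · have h1 : (l ++ [k]).length ≤ i := by simp; omega
    have h2 : l.length ≤ i := h.le
    simp only [asg, upd, Function.update_of_ne (show i ≠ l.length by omega)]
    rw [List.getD_eq_default _ _ h1, List.getD_eq_default _ _ h2]

theorem en_even (u : ℕ → M) (k : ℕ) : en R u (2 * k) = u k := by rw [en]; simp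

theorem en_odd (u : ℕ → M) (a : ℕ) (l : List ℕ) (h : ∃ x, Ev R a (l.length + 1) (upd (asg R u l) l.length x)) :
    Ev R a (l.length + 1) (upd (asg R u l) l.length (en R u (2 * atm (cx a) l + 1))) := by
  have h1 : (2 * atm (cx a) l + 1) / 2 = atm (cx a) l := by omega
  have h2 : (cx a).unpair.2 = a := by simp [cx]
  have h3 : en R u (2 * atm (cx a) l + 1) = pick R a l.length (asg R u l) (u 0) := by
    rw [en, dif_neg (by omega)]
    simp only [h1, dl_atm, atm_fst, h2]
    rfl
  rw [h3]; exact pick_spec h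

theorem en_congr (u u' : ℕ → M) (m : ℕ) (h : ∀ k < m, u k = u' k) : ∀ k < m, en R u k = en R u' k := by
  intro k
  induction k using Nat.strong_induction_on with
  | _ k ih =>
    intro hk
    rw [en, en]
    by_cases h1 : k % 2 = 0
    · rw [dif_pos h1, dif_pos h1]; exact h _ (by omega)
    · rw [dif_neg h1, dif_neg h1]
      have : (fun i => en R u ((dl (k / 2)).getD i 0)) = (fun i => en R u' ((dl (k / 2)).getD i 0)) := by
        funext i
        have := dl_le (k / 2) i
        exact ih _ (by omega) (by omega)
      rw [this, h 0 (by omega)]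

def tr (R : M → M → Prop) (u : ℕ → M) (k : ℕ) : Prop := Ev R k.unpair.1 (dl k).length (asg R u (dl k))

theorem tr_atm (u : ℕ → M) (c : ℕ) (l : List ℕ) : tr R u (atm c l) ↔ Ev R c l.length (asg R u l) := by
  simp [tr]

theorem tr_congr (u u' : ℕ → M) (m : ℕ) (h : ∀ k < m, u k = u' k) (k : ℕ) (hk : k < m) (ht : tr R u k) : tr R u' k := by
  have : asg R u (dl k) = asg R u' (dl k) := by
    funext i
    have := dl_le k i
    exact en_congr u u' m h _ (by omega)
  unfold tr at *
  rwa [← this]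
end
end KPP

set_option linter.unusedVariables false
set_option linter.unusedSectionVars false
set_option linter.unusedSimpArgs false
set_option linter.style.longLine false

/-! ## Part 10: the rule families -/
namespace KPP

abbrev D := ℕ × ℕ × ℕ × List ℕ

section
variable {f g h : D → ℕ} {L : D → List ℕ}
theorem p_pair (hf : Primrec f) (hg : Primrec g) : Primrec fun x => Nat.pair (f x) (g x) :=
  Primrec₂.natPair.comp hf hg
theorem p_atm (hf : Primrec f) (hg : Primrec L) : Primrec fun x => atm (f x) (L x) :=
  Primrec₂.natPair.comp hf (Primrec.encode.comp hg)
theorem p_cm (hf : Primrec f) (hg : Primrec g) : Primrec fun x => cm (f x) (g x) :=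
  p_pair (Primrec.const 0) (p_pair hf hg)
theorem p_ce (hf : Primrec f) (hg : Primrec g) : Primrec fun x => ce (f x) (g x) :=
  p_pair (Primrec.const 1) (p_pair hf hg)
theorem p_ca (hf : Primrec f) (hg : Primrec g) : Primrec fun x => ca (f x) (g x) :=
  p_pair (Primrec.const 3) (p_pair hf hg)
theorem p_c2 (hf : Primrec f) (hg : Primrec g) (hh : Primrec h) : Primrec fun x => c2 (h x) (f x) (g x) :=
  p_pair hh (p_pair hf hg)
theorem p_cn (hf : Primrec f) : Primrec fun x => cn (f x) := p_pair (Primrec.const 2) hf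
theorem p_cx (hf : Primrec f) : Primrec fun x => cx (f x) := p_pair (Primrec.const 9) hf
theorem p_cw (hf : Primrec f) : Primrec fun x => cw (f x) := p_pair (Primrec.const 11) hf
theorem p_succ (hf : Primrec f) : Primrec fun x => f x + 1 := Primrec.succ.comp hf
theorem p_dbl (hf : Primrec f) : Primrec fun x => 2 * f x + 1 :=
  Primrec.succ.comp (Primrec.nat_mul.comp (Primrec.const 2) hf)
theorem p_csub (hh : Primrec h) (hf : Primrec f) (hg : Primrec g) : Primrec fun x => csub (h x) (f x) (g x) :=
  p_cn (p_cx (p_ca (p_cm hh hf) (p_cn (p_cm hh hg))))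
theorem p_getD (hL : Primrec L) (hf : Primrec f) : Primrec fun x => (L x).getD (f x) 0 :=
  (Primrec.list_getD 0).comp hL hf
theorem p_len (hL : Primrec L) : Primrec fun x => (L x).length := Primrec.list_length.comp hL
theorem p_concat (hL : Primrec L) (hf : Primrec f) : Primrec fun x => L x ++ [f x] :=
  Primrec.list_concat.comp hL hf
theorem p_two (hf : Primrec f) (hg : Primrec g) : Primrec fun x => [f x, g x] :=
  Primrec.list_cons.comp hf (Primrec.list_cons.comp hg (Primrec.const []))
theorem p1 : Primrec fun x : D => x.1 := Primrec.fst
theorem p2 : Primrec fun x : D => x.2.1 := Primrec.fst.comp Primrec.snd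
theorem p3 : Primrec fun x : D => x.2.2.1 := Primrec.fst.comp (Primrec.snd.comp Primrec.snd)
theorem p4 : Primrec fun x : D => x.2.2.2 := Primrec.snd.comp (Primrec.snd.comp Primrec.snd)
end

def tt : ℕ := atm (ce 0 0) []
def ff : ℕ := atm (cn (ce 0 0)) []

structure Fam where
  a : ℕ → ℕ
  b : ℕ → ℕ
  c : ℕ → ℕ
  d : ℕ → ℕ
  pa : Primrec a
  pb : Primrec b
  pc : Primrec c
  pd : Primrec d

def Fam.Closed (F : Fam) (T : ℕ → Prop) : Prop := ∀ r, T (F.a r) → T (F.b r) → T (F.c r) ∨ T (F.d r)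

def sel (f g : ℕ → ℕ) (r : ℕ) : ℕ := if r.unpair.1 = 0 then f r.unpair.2 else g r.unpair.2
theorem p_sel {f g : ℕ → ℕ} (hf : Primrec f) (hg : Primrec g) : Primrec (sel f g) :=
  Primrec.ite (Primrec.eq.comp (Primrec.fst.comp Primrec.unpair) (Primrec.const 0))
    (hf.comp (Primrec.snd.comp Primrec.unpair)) (hg.comp (Primrec.snd.comp Primrec.unpair))

def Fam.or (F G : Fam) : Fam where
  a := sel F.a G.a
  b := sel F.b G.b
  c := sel F.c G.c
  d := sel F.d G.d
  pa := p_sel F.pa G.pa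
  pb := p_sel F.pb G.pb
  pc := p_sel F.pc G.pc
  pd := p_sel F.pd G.pd

theorem Fam.or_closed {F G : Fam} {T : ℕ → Prop} : (F.or G).Closed T ↔ F.Closed T ∧ G.Closed T := by
  constructor
  · intro h
    refine ⟨fun r => ?_, fun r => ?_⟩
    · have := h (Nat.pair 0 r)
      simpa [Fam.or, sel] using this
    · have := h (Nat.pair 1 r)
      simpa [Fam.or, sel] using this
  · rintro ⟨h1, h2⟩ r
    by_cases h : r.unpair.1 = 0
    · simpa [Fam.or, sel, h] using h1 r.unpair.2
    · simpa [Fam.or, sel, h] using h2 r.unpair.2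

def Fam.mkD (a b c d : D → ℕ) (pa : Primrec a) (pb : Primrec b) (pc : Primrec c) (pd : Primrec d) : Fam where
  a r := a (Denumerable.ofNat D r)
  b r := b (Denumerable.ofNat D r)
  c r := c (Denumerable.ofNat D r)
  d r := d (Denumerable.ofNat D r)
  pa := pa.comp (Primrec.ofNat D)
  pb := pb.comp (Primrec.ofNat D)
  pc := pc.comp (Primrec.ofNat D)
  pd := pd.comp (Primrec.ofNat D)

theorem Fam.mkD_closed {a b c d : D → ℕ} {pa pb pc pd} {T : ℕ → Prop} :
    (Fam.mkD a b c d pa pb pc pd).Closed T ↔ ∀ x, T (a x) → T (b x) → T (c x) ∨ T (d x) := by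
  constructor
  · intro h x
    have := h (Encodable.encode x)
    simpa only [Fam.mkD, Denumerable.ofNat_encode] using this
  · intro h r; exact h _

def Fam.cut (c d : D → ℕ) (pc : Primrec c) (pd : Primrec d) : Fam :=
  Fam.mkD (fun _ => tt) (fun _ => tt) c d (Primrec.const tt) (Primrec.const tt) pc pd
def Fam.two (a b c : D → ℕ) (pa : Primrec a) (pb : Primrec b) (pc : Primrec c) : Fam :=
  Fam.mkD a b c c pa pb pc pc
def Fam.one (a c : D → ℕ) (pa : Primrec a) (pc : Primrec c) : Fam := Fam.mkD a a c c pa pa pc pc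
def Fam.iff (a c : D → ℕ) (pa : Primrec a) (pc : Primrec c) : Fam := (Fam.one a c pa pc).or (Fam.one c a pc pa)

theorem Fam.cut_closed {c d : D → ℕ} {pc pd} {T : ℕ → Prop} :
    (Fam.cut c d pc pd).Closed T ↔ (T tt → ∀ x, T (c x) ∨ T (d x)) := by
  simp only [Fam.cut, Fam.mkD_closed]; grind
theorem Fam.two_closed {a b c : D → ℕ} {pa pb pc} {T : ℕ → Prop} :
    (Fam.two a b c pa pb pc).Closed T ↔ ∀ x, T (a x) → T (b x) → T (c x) := by
  simp only [Fam.two, Fam.mkD_closed, or_self]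
theorem Fam.one_closed {a c : D → ℕ} {pa pc} {T : ℕ → Prop} :
    (Fam.one a c pa pc).Closed T ↔ ∀ x, T (a x) → T (c x) := by
  simp only [Fam.one, Fam.mkD_closed, or_self]; grind
theorem Fam.iff_closed {a c : D → ℕ} {pa pc} {T : ℕ → Prop} :
    (Fam.iff a c pa pc).Closed T ↔ ∀ x, T (a x) ↔ T (c x) := by
  simp only [Fam.iff, Fam.or_closed, Fam.one_closed]; grind

def FCut : Fam := .cut (fun x => atm x.1 x.2.2.2) (fun x => atm (cn x.1) x.2.2.2)
  (p_atm p1 p4) (p_atm (p_cn p1) p4)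
def FContra : Fam := .two (fun x => atm x.1 x.2.2.2) (fun x => atm (cn x.1) x.2.2.2) (fun _ => ff)
  (p_atm p1 p4) (p_atm (p_cn p1) p4) (Primrec.const ff)
def FAndI : Fam := .two (fun x => atm x.1 x.2.2.2) (fun x => atm x.2.1 x.2.2.2) (fun x => atm (ca x.1 x.2.1) x.2.2.2)
  (p_atm p1 p4) (p_atm p2 p4) (p_atm (p_ca p1 p2) p4)
def FAndL : Fam := .one (fun x => atm (ca x.1 x.2.1) x.2.2.2) (fun x => atm x.1 x.2.2.2)
  (p_atm (p_ca p1 p2) p4) (p_atm p1 p4)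
def FAndR : Fam := .one (fun x => atm (ca x.1 x.2.1) x.2.2.2) (fun x => atm x.2.1 x.2.2.2)
  (p_atm (p_ca p1 p2) p4) (p_atm p2 p4)
def FExE : Fam := .one (fun x => atm (cx x.1) x.2.2.2)
  (fun x => atm x.1 (x.2.2.2 ++ [2 * atm (cx x.1) x.2.2.2 + 1]))
  (p_atm (p_cx p1) p4) (p_atm p1 (p_concat p4 (p_dbl (p_atm (p_cx p1) p4))))
def FExI : Fam := .one (fun x => atm x.1 (x.2.2.2 ++ [x.2.1])) (fun x => atm (cx x.1) x.2.2.2)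
  (p_atm p1 (p_concat p4 p2)) (p_atm (p_cx p1) p4)
def FMem : Fam := .iff (fun x => atm (cm x.1 x.2.1) x.2.2.2)
  (fun x => atm (cm 0 1) [x.2.2.2.getD x.1 0, x.2.2.2.getD x.2.1 0])
  (p_atm (p_cm p1 p2) p4) (p_atm (Primrec.const _) (p_two (p_getD p4 p1) (p_getD p4 p2)))
def FEq : Fam := .iff (fun x => atm (ce x.1 x.2.1) x.2.2.2)
  (fun x => atm (ce 0 1) [x.2.2.2.getD x.1 0, x.2.2.2.getD x.2.1 0])
  (p_atm (p_ce p1 p2) p4) (p_atm (Primrec.const _) (p_two (p_getD p4 p1) (p_getD p4 p2)))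
def FRefl : Fam := .one (fun _ => tt) (fun x => atm (ce 0 1) [x.1, x.1])
  (Primrec.const tt) (p_atm (Primrec.const _) (p_two p1 p1))
def FTrans : Fam := .two (fun x => atm (ce 0 1) [x.1, x.2.1]) (fun x => atm (ce 0 1) [x.1, x.2.2.1])
  (fun x => atm (ce 0 1) [x.2.1, x.2.2.1])
  (p_atm (Primrec.const _) (p_two p1 p2)) (p_atm (Primrec.const _) (p_two p1 p3))
  (p_atm (Primrec.const _) (p_two p2 p3))
def FML : Fam := .two (fun x => atm (ce 0 1) [x.1, x.2.1]) (fun x => atm (cm 0 1) [x.1, x.2.2.1])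
  (fun x => atm (cm 0 1) [x.2.1, x.2.2.1])
  (p_atm (Primrec.const _) (p_two p1 p2)) (p_atm (Primrec.const _) (p_two p1 p3))
  (p_atm (Primrec.const _) (p_two p2 p3))
def FMR : Fam := .two (fun x => atm (ce 0 1) [x.1, x.2.1]) (fun x => atm (cm 0 1) [x.2.2.1, x.1])
  (fun x => atm (cm 0 1) [x.2.2.1, x.2.1])
  (p_atm (Primrec.const _) (p_two p1 p2)) (p_atm (Primrec.const _) (p_two p3 p1))
  (p_atm (Primrec.const _) (p_two p3 p2))
def F4 : Fam := .iff (fun x => atm (c2 4 x.1 x.2.1) x.2.2.2)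
  (fun x => atm (cn (ca (cn x.1) (cn x.2.1))) x.2.2.2)
  (p_atm (p_c2 p1 p2 (Primrec.const _)) p4) (p_atm (p_cn (p_ca (p_cn p1) (p_cn p2))) p4)
def F5 : Fam := .iff (fun x => atm (c2 5 x.1 x.2.1) x.2.2.2)
  (fun x => atm (cx (ca (cm x.2.2.2.length x.1) x.2.1)) x.2.2.2)
  (p_atm (p_c2 p1 p2 (Primrec.const _)) p4) (p_atm (p_cx (p_ca (p_cm (p_len p4) p1) p2)) p4)
def F6 : Fam := .iff (fun x => atm (c2 6 x.1 x.2.1) x.2.2.2)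
  (fun x => atm (cn (cx (ca (cm x.2.2.2.length x.1) (cn x.2.1)))) x.2.2.2)
  (p_atm (p_c2 p1 p2 (Primrec.const _)) p4) (p_atm (p_cn (p_cx (p_ca (p_cm (p_len p4) p1) (p_cn p2)))) p4)
def F7 : Fam := .iff (fun x => atm (c2 7 x.1 x.2.1) x.2.2.2)
  (fun x => atm (cx (ca (csub (x.2.2.2.length + 1) x.2.2.2.length x.1) x.2.1)) x.2.2.2)
  (p_atm (p_c2 p1 p2 (Primrec.const _)) p4)
  (p_atm (p_cx (p_ca (p_csub (p_succ (p_len p4)) (p_len p4) p1) p2)) p4)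
def F8 : Fam := .iff (fun x => atm (c2 8 x.1 x.2.1) x.2.2.2)
  (fun x => atm (cn (cx (ca (csub (x.2.2.2.length + 1) x.2.2.2.length x.1) (cn x.2.1)))) x.2.2.2)
  (p_atm (p_c2 p1 p2 (Primrec.const _)) p4)
  (p_atm (p_cn (p_cx (p_ca (p_csub (p_succ (p_len p4)) (p_len p4) p1) (p_cn p2)))) p4)
def F10 : Fam := .iff (fun x => atm (Nat.pair 10 x.1) x.2.2.2) (fun x => atm (cn (cx (cn x.1))) x.2.2.2)
  (p_atm (p_pair (Primrec.const _) p1) p4) (p_atm (p_cn (p_cx (p_cn p1))) p4)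
/-- well-formedness of atomic formulas -/
def FW0 (t : ℕ) : Fam := .one (fun _ => tt)
  (fun x => if x.1 < x.2.2.2.length then if x.2.1 < x.2.2.2.length then atm (cw (c2 t x.1 x.2.1)) x.2.2.2 else tt else tt)
  (Primrec.const tt)
  (Primrec.ite (Primrec.nat_lt.comp p1 (p_len p4)) (Primrec.ite (Primrec.nat_lt.comp p2 (p_len p4))
    (p_atm (p_cw (p_c2 p1 p2 (Primrec.const t))) p4) (Primrec.const tt)) (Primrec.const tt))
def FW2 : Fam := .one (fun x => atm (cw x.1) x.2.2.2) (fun x => atm (cw (cn x.1)) x.2.2.2)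
  (p_atm (p_cw p1) p4) (p_atm (p_cw (p_cn p1)) p4)
def FW3 (t : ℕ) : Fam := .two (fun x => atm (cw x.1) x.2.2.2) (fun x => atm (cw x.2.1) x.2.2.2)
  (fun x => atm (cw (c2 t x.1 x.2.1)) x.2.2.2)
  (p_atm (p_cw p1) p4) (p_atm (p_cw p2) p4) (p_atm (p_cw (p_c2 p1 p2 (Primrec.const t))) p4)
def FW5 (t : ℕ) : Fam := .one (fun x => atm (cw x.2.1) (x.2.2.2 ++ [0]))
  (fun x => if x.1 < x.2.2.2.length then atm (cw (c2 t x.1 x.2.1)) x.2.2.2 else tt)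
  (p_atm (p_cw p2) (p_concat p4 (Primrec.const 0)))
  (Primrec.ite (Primrec.nat_lt.comp p1 (p_len p4)) (p_atm (p_cw (p_c2 p1 p2 (Primrec.const t))) p4) (Primrec.const tt))
def FW9 (t : ℕ) : Fam := .one (fun x => atm (cw x.1) (x.2.2.2 ++ [0])) (fun x => atm (cw (Nat.pair t x.1)) x.2.2.2)
  (p_atm (p_cw p1) (p_concat p4 (Primrec.const 0))) (p_atm (p_cw (p_pair (Primrec.const t) p1)) p4)

/-- the axioms of the theory -/
def FAx (C : Nat.Partrec.Code) : Fam := .one (fun x => atm (cw x.1) [])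
  (fun x => if (Nat.Partrec.Code.evaln x.2.1 C x.1).isSome = true then atm x.1 [] else tt)
  (p_atm (p_cw p1) (Primrec.const []))
  (Primrec.ite (Primrec.eq.comp (Primrec.option_isSome.comp (Nat.Partrec.Code.primrec_evaln.comp
    ((p2.pair (Primrec.const C)).pair p1))) (Primrec.const true)) (p_atm p1 (Primrec.const [])) (Primrec.const tt))

def FAll (C : Nat.Partrec.Code) : Fam :=
  FCut.or (FContra.or (FAndI.or (FAndL.or (FAndR.or (FExE.or (FExI.or (FMem.or (FEq.or (FRefl.or (FTrans.or
  (FML.or (FMR.or (F4.or (F5.or (F6.or (F7.or (F8.or (F10.or ((FW0 0).or ((FW0 1).or (FW2.or ((FW3 3).or ((FW3 4).or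
  ((FW5 5).or ((FW5 6).or ((FW5 7).or ((FW5 8).or ((FW9 9).or ((FW9 10).or (FAx C))))))))))))))))))))))))))))))

def mcf (r : ℕ) : ℕ := atm (cm 0 1) [r.unpair.1, r.unpair.2]
def scf (r : ℕ) : ℕ := atm (csub 2 0 1) [r.unpair.1, r.unpair.2]

theorem p_lst (c : ℕ) : Primrec fun r : ℕ => atm c [r.unpair.1, r.unpair.2] :=
  Primrec₂.natPair.comp (Primrec.const c) (Primrec.encode.comp
    (Primrec.list_cons.comp (Primrec.fst.comp Primrec.unpair)
      (Primrec.list_cons.comp (Primrec.snd.comp Primrec.unpair) (Primrec.const []))))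

def RR (C : Nat.Partrec.Code) : Rules where
  ra := (FAll C).a
  rb := (FAll C).b
  rc := (FAll C).c
  rd := (FAll C).d
  mc := mcf
  sc := scf
  bot := ff
  pa := Primrec.nat_iff.1 (FAll C).pa
  pb := Primrec.nat_iff.1 (FAll C).pb
  pc := Primrec.nat_iff.1 (FAll C).pc
  pd := Primrec.nat_iff.1 (FAll C).pd
  pm := Primrec.nat_iff.1 (p_lst _)
  ps := Primrec.nat_iff.1 (p_lst _)

section
variable {M : Type} {R : M → M → Prop} (u : ℕ → M)

theorem tr_tt : tr R u tt := by simp [tt, tr_atm, Ev_ce]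
theorem tr_ff : ¬ tr R u ff := by simp [ff, tr_atm, Ev_ce, Ev_cn]

theorem sf_case {v : ℕ → M} (a : ℕ) (l : List ℕ) : Ev R (cw a) (l ++ [0]).length v ↔ ∃ φ : SF (l.length + 1), φ.encode = a := by
  rw [Ev_cw, List.length_append]; rfl

theorem FAll_sound (S : Set (SF 0)) (C : Nat.Partrec.Code)
    (hC : ∀ φ : SF 0, φ ∈ S ↔ φ.encode ∈ (C.eval).Dom) (hS : SatT R S) : (FAll C).Closed (tr R u) := by
  have htt := tr_tt (R := R) u
  simp only [FAll, Fam.or_closed, FCut, FContra, FAndI, FAndL, FAndR, FExE, FExI, FMem, FEq, FRefl, FTrans, FML, FMR,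
    F4, F5, F6, F7, F8, F10, FW0, FW2, FW3, FW5, FW9, FAx, Fam.cut_closed, Fam.two_closed, Fam.one_closed, Fam.iff_closed]
  refine ⟨?_, ?_, ?_, ?_, ?_, ?_, ?_, ?_, ?_, ?_, ?_, ?_, ?_, ?_, ?_, ?_, ?_, ?_, ?_, ?_, ?_, ?_, ?_, ?_, ?_, ?_, ?_, ?_, ?_, ?_, ?_⟩
  -- propositional rules
  · intro _ x; simp only [tr_atm, Ev_cn]; exact em _
  · intro x; simp only [tr_atm, Ev_cn]; intro h1 h2; exact absurd h1 h2
  · intro x; simp only [tr_atm, Ev_ca]; exact fun h1 h2 => ⟨h1, h2⟩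
  · intro x; simp only [tr_atm, Ev_ca]; exact fun h => h.1
  · intro x; simp only [tr_atm, Ev_ca]; exact fun h => h.2
  -- quantifier rules
  · intro x; simp only [tr_atm, Ev_cx, asg_concat, List.length_append, List.length_singleton]
    exact en_odd u _ _
  · intro x; simp only [tr_atm, Ev_cx, asg_concat, List.length_append, List.length_singleton]
    exact fun h => ⟨_, h⟩
  · intro x; simp only [tr_atm, Ev_cm]; rfl
  · intro x; simp only [tr_atm, Ev_ce]; rfl
  · intro x _; simp only [tr_atm, Ev_ce]; rfl
  · intro x; simp only [tr_atm, Ev_ce]; exact fun h1 h2 => h1.symm.trans h2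
  · intro x; simp only [tr_atm, Ev_ce, Ev_cm]; intro h1 h2
    change R (asg R u [x.1, x.2.1] 1) _; rw [← h1]; exact h2
  · intro x; simp only [tr_atm, Ev_ce, Ev_cm]; intro h1 h2
    change R _ (asg R u [x.1, x.2.1] 1); rw [← h1]; exact h2
  · intro x; simp only [tr_atm, Ev_4, Ev_cn, Ev_ca]; tauto
  · intro x; simp only [tr_atm, Ev_5, Ev_cn, Ev_ca, Ev_cx, Ev_cm]
  · intro x; simp only [tr_atm, Ev_6, Ev_cn, Ev_ca, Ev_cx, Ev_cm]; push Not; rfl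
  · intro x; simp only [tr_atm, Ev_7, Ev_cn, Ev_ca, Ev_cx, Ev_csub]
  · intro x; simp only [tr_atm, Ev_8, Ev_cn, Ev_ca, Ev_cx, Ev_csub]; push Not; rfl
  · intro x; simp only [tr_atm, Ev_10, Ev_cn, Ev_ca, Ev_cx, Ev_csub]; push Not; rfl
  -- well-formedness rules
  · intro x _; split_ifs with h1 h2
    · simp only [tr_atm, Ev_cw]; exact ⟨.mem ⟨_, h1⟩ ⟨_, h2⟩, rfl⟩
    · exact htt
    · exact htt
  · intro x _; split_ifs with h1 h2
    · simp only [tr_atm, Ev_cw]; exact ⟨.eq ⟨_, h1⟩ ⟨_, h2⟩, rfl⟩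
    · exact htt
    · exact htt
  · intro x; simp only [tr_atm, Ev_cw]; rintro ⟨φ, hφ⟩; exact ⟨.not φ, by rw [← hφ]; rfl⟩
  · intro x; simp only [tr_atm, Ev_cw]; rintro ⟨φ, hφ⟩ ⟨ψ, hψ⟩; exact ⟨.and φ ψ, by rw [← hφ, ← hψ]; rfl⟩
  · intro x; simp only [tr_atm, Ev_cw]; rintro ⟨φ, hφ⟩ ⟨ψ, hψ⟩; exact ⟨.or φ ψ, by rw [← hφ, ← hψ]; rfl⟩
  · intro x; simp only [tr_atm, sf_case]; rintro ⟨φ, hφ⟩; split_ifs with h1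
    · rw [tr_atm, Ev_cw]; exact ⟨.bexMem ⟨_, h1⟩ φ, by rw [← hφ]; rfl⟩
    · exact htt
  · intro x; simp only [tr_atm, sf_case]; rintro ⟨φ, hφ⟩; split_ifs with h1
    · rw [tr_atm, Ev_cw]; exact ⟨.ballMem ⟨_, h1⟩ φ, by rw [← hφ]; rfl⟩
    · exact htt
  · intro x; simp only [tr_atm, sf_case]; rintro ⟨φ, hφ⟩; split_ifs with h1
    · rw [tr_atm, Ev_cw]; exact ⟨.bexSub ⟨_, h1⟩ φ, by rw [← hφ]; rfl⟩
    · exact htt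
  · intro x; simp only [tr_atm, sf_case]; rintro ⟨φ, hφ⟩; split_ifs with h1
    · rw [tr_atm, Ev_cw]; exact ⟨.ballSub ⟨_, h1⟩ φ, by rw [← hφ]; rfl⟩
    · exact htt
  · intro x; simp only [tr_atm, sf_case]; rintro ⟨φ, hφ⟩; rw [Ev_cw]; exact ⟨.ex φ, by rw [← hφ]; rfl⟩
  · intro x; simp only [tr_atm, sf_case]; rintro ⟨φ, hφ⟩; rw [Ev_cw]; exact ⟨.all φ, by rw [← hφ]; rfl⟩
  -- axioms
  · intro x; rw [tr_atm, Ev_cw]; rintro ⟨φ, hφ⟩; split_ifs with h1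
    · obtain ⟨y, hy⟩ := Option.isSome_iff_exists.1 h1
      have h2 : φ ∈ S := (hC φ).2 (by
        rw [show φ.encode = x.1 from hφ]
        exact Part.dom_iff_mem.2 ⟨y, Nat.Partrec.Code.evaln_sound hy⟩)
      rw [tr_atm, ← hφ]
      refine (Ev_encode φ _).2 ?_
      have := hS φ h2
      exact (congrArg (SF.Eval R (n := 0) φ) (funext fun i => i.elim0)).mpr this
    · exact htt
end

section
variable {M : Type} [MK M]

noncomputable def theSem (S : Set (SF 0)) (C : Nat.Partrec.Code)
    (hC : ∀ φ : SF 0, φ ∈ S ↔ φ.encode ∈ (C.eval).Dom) (hS : SatT (MK.E (M := M)) S) : Sem M (RR C) where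
  tru := tr MK.E
  e := en MK.E
  s1 u r := FAll_sound u S C hC hS r
  s2 u r := by
    change tr MK.E u (atm _ _) ↔ _
    rw [tr_atm, Ev_cm]; rfl
  s3 u r := by
    change tr MK.E u (atm _ _) ↔ _
    rw [tr_atm]
    exact Ev_csub.trans (SubU_iff (by simp) (by simp))
  s4 u := tr_ff u
  s5 u k := en_even u k
  s6 u u' m h := en_congr u u' m h
  s7 u u' m h := tr_congr u u' m h
end
end KPP

set_option linter.unusedVariables false
set_option linter.unusedSectionVars false
set_option linter.unusedSimpArgs false
set_option linter.style.longLine false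

/-! ## Part 11: the extension -/
namespace KPP

section
variable {M N : Type} [MK M] [MK N]

theorem rank_transfer (f : M → N) (hinj : Function.Injective f) (hemb : ∀ a b : M, a ∊ b ↔ f a ∊ f b)
    (hpow : PowExtSet (MK.E (M := N)) (Set.range f)) (htop : ToplessSet (MK.E (M := N)) (Set.range f)) :
    RankExtSet (MK.E (M := N)) (Set.range f) := by
  have hend : ∀ (x : N) (b : M), x ∊ f b → ∃ a, x = f a ∧ a ∊ b := by
    intro x b h
    obtain ⟨a, rfl⟩ := hpow.1 x (f b) ⟨b, rfl⟩ h
    exact ⟨a, rfl, (hemb _ _).2 h⟩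
  have hpr : ∀ q x y : M, IsPair MK.E q x y → IsPair (MK.E (M := N)) (f q) (f x) (f y) := by
    intro q x y h z
    constructor
    · intro hz
      replace hz := hend _ _ hz; obtain ⟨z, rfl, hz⟩ := hz
      rcases (h z).1 hz with h1 | h1
      · left; intro w; constructor
        · intro hw; replace hw := hend _ _ hw; obtain ⟨w, rfl, hw⟩ := hw; rw [(h1 w).1 hw]
        · rintro rfl; exact (hemb _ _).1 ((h1 x).2 rfl)
      · right; intro w; constructor
        · intro hw; replace hw := hend _ _ hw; obtain ⟨w, rfl, hw⟩ := hw
          exact ((h1 w).1 hw).imp (congrArg f) (congrArg f)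
        · rintro (rfl | rfl)
          · exact (hemb _ _).1 ((h1 x).2 (Or.inl rfl))
          · exact (hemb _ _).1 ((h1 y).2 (Or.inr rfl))
    · intro hz
      obtain ⟨z, rfl⟩ := htop.2 z (by
        intro w hw
        rcases hz with h1 | h1
        · exact ⟨x, ((h1 w).1 hw).symm⟩
        · rcases (h1 w).1 hw with rfl | rfl
          · exact ⟨x, rfl⟩
          · exact ⟨y, rfl⟩)
      refine (hemb _ _).1 ((h z).2 ?_)
      rcases hz with h1 | h1
      · left; intro w; rw [show (MK.E w z) ↔ _ from hemb w z]; exact (h1 (f w)).trans hinj.eq_iff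
      · right; intro w; rw [show (MK.E w z) ↔ _ from hemb w z]
        exact (h1 (f w)).trans (or_congr hinj.eq_iff hinj.eq_iff)
  refine ⟨hpow, ?_⟩
  rintro x _ ⟨b, rfl⟩ hle
  obtain ⟨α, g, β, v, hrk, hβ, hv, hb⟩ := exists_IsRK b
  have hfa1 : ∀ x0 y0 : M, FunApp MK.E g x0 y0 → FunApp (MK.E (M := N)) (f g) (f x0) (f y0) := by
    rintro x0 y0 ⟨q, hq, hp⟩
    exact ⟨f q, (hemb _ _).1 hq, hpr _ _ _ hp⟩
  have hfa2 : ∀ x y : N, FunApp MK.E (f g) x y → ∃ x0 y0 : M, x = f x0 ∧ y = f y0 ∧ FunApp MK.E g x0 y0 := by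
    rintro x y ⟨q, hq, hp⟩
    replace hq := hend _ _ hq; obtain ⟨q, rfl, hq⟩ := hq
    obtain ⟨x0, y0, hp0, _⟩ := hrk.2.1.1 q hq
    have h1 := (isPair_iff _ _ _).1 hp
    have h2 := (isPair_iff _ _ _).1 (hpr _ _ _ hp0)
    obtain ⟨rfl, rfl⟩ := pr_inj (h1.symm.trans h2)
    exact ⟨x0, y0, rfl, rfl, q, hq, hp0⟩
  have htr : ∀ t : M, TransSet MK.E t → TransSet (MK.E (M := N)) (f t) := by
    intro t ht y hy z hz
    replace hy := hend _ _ hy; obtain ⟨y, rfl, hy⟩ := hy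
    replace hz := hend _ _ hz; obtain ⟨z, rfl, hz⟩ := hz
    exact (hemb _ _).1 (ht y hy z hz)
  have hrkN : IsRK (MK.E (M := N)) (f α) (f g) := by
    refine ⟨⟨htr _ hrk.1.1, ?_⟩, ⟨?_, ?_, ?_⟩, ?_⟩
    · intro y hy
      replace hy := hend _ _ hy; obtain ⟨y, rfl, hy⟩ := hy
      exact htr _ (hrk.1.2 y hy)
    · intro q hq
      replace hq := hend _ _ hq; obtain ⟨q, rfl, hq⟩ := hq
      obtain ⟨x0, y0, h1, h2⟩ := hrk.2.1.1 q hq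
      exact ⟨f x0, f y0, hpr _ _ _ h1, (hemb _ _).1 h2⟩
    · intro x y y' h1 h2
      replace h1 := hfa2 _ _ h1; obtain ⟨x0, y0, rfl, rfl, h1⟩ := h1
      replace h2 := hfa2 _ _ h2; obtain ⟨x1, y1, e, rfl, h2⟩ := h2
      obtain rfl := hinj e
      rw [hrk.2.1.2.1 _ _ _ h1 h2]
    · intro x hx
      replace hx := hend _ _ hx; obtain ⟨x, rfl, hx⟩ := hx
      obtain ⟨y, hy⟩ := hrk.2.1.2.2 x hx
      exact ⟨f y, hfa1 _ _ hy⟩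
    · intro β' v' hβ' hv' x
      obtain ⟨β0, rfl, hβ0⟩ := hend _ _ hβ'
      obtain ⟨β1, v0, e, rfl, hv0⟩ := hfa2 _ _ hv'
      obtain rfl := hinj e
      constructor
      · intro hx
        replace hx := hend _ _ hx; obtain ⟨x, rfl, hx⟩ := hx
        obtain ⟨γ, hγ, vγ, h1, h2⟩ := (hrk.2.2 _ _ hβ0 hv0 x).1 hx
        refine ⟨f γ, (hemb _ _).1 hγ, f vγ, hfa1 _ _ h1, ?_⟩
        intro z hz
        replace hz := hend _ _ hz; obtain ⟨z, rfl, hz⟩ := hz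
        exact (hemb _ _).1 (h2 z hz)
      · rintro ⟨γ, hγ, vγ, h1, h2⟩
        replace hγ := hend _ _ hγ; obtain ⟨γ, rfl, hγ⟩ := hγ
        replace h1 := hfa2 _ _ h1; obtain ⟨γ1, v1, e, rfl, h1⟩ := h1
        obtain rfl := hinj e
        obtain ⟨x, rfl⟩ := hpow.2 x _ ⟨v1, rfl⟩ h2
        refine (hemb _ _).1 ((hrk.2.2 _ _ hβ0 hv0 x).2 ⟨γ, hγ, v1, h1, ?_⟩)
        intro z hz
        exact (hemb _ _).2 (h2 _ ((hemb _ _).1 hz))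
  exact hpow.1 x (f v) ⟨v, rfl⟩ (hle _ _ _ _ hrkN ((hemb _ _).1 hβ) (hfa1 _ _ hv) ((hemb _ _).1 hb))
end

/-! The term model -/
section
structure Cl (S : Set (SF 0)) (T : ℕ → Prop) : Prop where
  neg : ∀ a l, T (atm (cn a) l) ↔ ¬ T (atm a l)
  and : ∀ a b l, T (atm (ca a b) l) ↔ T (atm a l) ∧ T (atm b l)
  ex : ∀ a l, T (atm (cx a) l) ↔ ∃ j, T (atm a (l ++ [j]))
  mem : ∀ i j l, T (atm (cm i j) l) ↔ T (atm (cm 0 1) [l.getD i 0, l.getD j 0])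
  eq : ∀ i j l, T (atm (ce i j) l) ↔ T (atm (ce 0 1) [l.getD i 0, l.getD j 0])
  refl : ∀ i, T (atm (ce 0 1) [i, i])
  trans : ∀ i j k, T (atm (ce 0 1) [i, j]) → T (atm (ce 0 1) [i, k]) → T (atm (ce 0 1) [j, k])
  ml : ∀ i j k, T (atm (ce 0 1) [i, j]) → T (atm (cm 0 1) [i, k]) → T (atm (cm 0 1) [j, k])
  mr : ∀ i j k, T (atm (ce 0 1) [i, j]) → T (atm (cm 0 1) [k, i]) → T (atm (cm 0 1) [k, j])
  f4 : ∀ a b l, T (atm (c2 4 a b) l) ↔ T (atm (cn (ca (cn a) (cn b))) l)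
  f5 : ∀ a b l, T (atm (c2 5 a b) l) ↔ T (atm (cx (ca (cm l.length a) b)) l)
  f6 : ∀ a b l, T (atm (c2 6 a b) l) ↔ T (atm (cn (cx (ca (cm l.length a) (cn b)))) l)
  f7 : ∀ a b l, T (atm (c2 7 a b) l) ↔ T (atm (cx (ca (csub (l.length + 1) l.length a) b)) l)
  f8 : ∀ a b l, T (atm (c2 8 a b) l) ↔ T (atm (cn (cx (ca (csub (l.length + 1) l.length a) (cn b)))) l)
  f10 : ∀ a l, T (atm (Nat.pair 10 a) l) ↔ T (atm (cn (cx (cn a))) l)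
  ax : ∀ φ : SF 0, φ ∈ S → T (atm φ.encode [])

theorem Cl.of_closed {S : Set (SF 0)} {C : Nat.Partrec.Code} (hC : ∀ φ : SF 0, φ ∈ S ↔ φ.encode ∈ (C.eval).Dom)
    {T : ℕ → Prop} (h : (FAll C).Closed T) (htt : T tt) (hff : ¬ T ff) : Cl S T := by
  simp only [FAll, Fam.or_closed, FCut, FContra, FAndI, FAndL, FAndR, FExE, FExI, FMem, FEq, FRefl, FTrans, FML, FMR,
    F4, F5, F6, F7, F8, F10, FW0, FW2, FW3, FW5, FW9, FAx, Fam.cut_closed, Fam.two_closed, Fam.one_closed, Fam.iff_closed] at h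
  obtain ⟨h1, h2, h3, h4, h5, h6, h7, h8, h9, h10, h11, h12, h13, h14, h15, h16, h17, h18, h19,
    w0, w1, w2, w3, w4, w5, w6, w7, w8, w9, w10, hax⟩ := h
  have wf : ∀ {n : ℕ} (φ : SF n) (l : List ℕ), l.length = n → T (atm (cw φ.encode) l) := by
    intro n φ
    induction φ with
    | mem i j =>
      rintro l rfl
      have := w0 (i, j, 0, l) htt
      rw [if_pos i.2, if_pos j.2] at this
      exact this
    | eq i j =>
      rintro l rfl
      have := w1 (i, j, 0, l) htt
      rw [if_pos i.2, if_pos j.2] at this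
      exact this
    | not φ ih => intro l hl; exact w2 (_, 0, 0, l) (ih l hl)
    | and φ ψ ih ih' => intro l hl; exact w3 (_, _, 0, l) (ih l hl) (ih' l hl)
    | or φ ψ ih ih' => intro l hl; exact w4 (_, _, 0, l) (ih l hl) (ih' l hl)
    | bexMem i φ ih =>
      rintro l rfl
      have := w5 (i, φ.encode, 0, l) (ih (l ++ [0]) (by simp))
      rw [if_pos i.2] at this
      exact this
    | ballMem i φ ih =>
      rintro l rfl
      have := w6 (i, φ.encode, 0, l) (ih (l ++ [0]) (by simp))
      rw [if_pos i.2] at this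
      exact this
    | bexSub i φ ih =>
      rintro l rfl
      have := w7 (i, φ.encode, 0, l) (ih (l ++ [0]) (by simp))
      rw [if_pos i.2] at this
      exact this
    | ballSub i φ ih =>
      rintro l rfl
      have := w8 (i, φ.encode, 0, l) (ih (l ++ [0]) (by simp))
      rw [if_pos i.2] at this
      exact this
    | ex φ ih => rintro l rfl; exact w9 (φ.encode, 0, 0, l) (ih (l ++ [0]) (by simp))
    | all φ ih => rintro l rfl; exact w10 (φ.encode, 0, 0, l) (ih (l ++ [0]) (by simp))
  exact {
    neg := fun a l => ⟨fun h h' => hff (h2 (a, 0, 0, l) h' h), fun h => (h1 htt (a, 0, 0, l)).resolve_left h⟩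
    and := fun a b l => ⟨fun h => ⟨h4 (a, b, 0, l) h, h5 (a, b, 0, l) h⟩, fun h => h3 (a, b, 0, l) h.1 h.2⟩
    ex := fun a l => ⟨fun h => ⟨_, h6 (a, 0, 0, l) h⟩, fun ⟨j, h⟩ => h7 (a, j, 0, l) h⟩
    mem := fun i j l => h8 (i, j, 0, l)
    eq := fun i j l => h9 (i, j, 0, l)
    refl := fun i => h10 (i, 0, 0, []) htt
    trans := fun i j k => h11 (i, j, k, [])
    ml := fun i j k => h12 (i, j, k, [])
    mr := fun i j k => h13 (i, j, k, [])
    f4 := fun a b l => h14 (a, b, 0, l)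
    f5 := fun a b l => h15 (a, b, 0, l)
    f6 := fun a b l => h16 (a, b, 0, l)
    f7 := fun a b l => h17 (a, b, 0, l)
    f8 := fun a b l => h18 (a, b, 0, l)
    f10 := fun a l => h19 (a, 0, 0, l)
    ax := fun φ hφ => by
      obtain ⟨y, hy⟩ := Part.dom_iff_mem.1 ((hC φ).1 hφ)
      obtain ⟨k, hk⟩ := Nat.Partrec.Code.evaln_complete.1 hy
      have := hax (φ.encode, k, 0, []) (wf φ [] rfl)
      have h' : (Nat.Partrec.Code.evaln k C φ.encode).isSome = true := Option.isSome_iff_exists.2 ⟨y, hk⟩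
      rw [if_pos h'] at this
      exact this }

variable {S : Set (SF 0)} {T : ℕ → Prop}

def Cl.setoid (h : Cl S T) : Setoid ℕ where
  r i j := T (atm (ce 0 1) [i, j])
  iseqv := ⟨h.refl, fun {i j} hh => h.trans i j i hh (h.refl i),
    fun {i j k} h1 h2 => h.trans j i k (h.trans i j i h1 (h.refl i)) h2⟩

def Cl.N (h : Cl S T) : Type := Quotient h.setoid
def Cl.q (h : Cl S T) (i : ℕ) : h.N := Quotient.mk h.setoid i
def Cl.EN (h : Cl S T) : h.N → h.N → Prop :=
  Quotient.lift₂ (s₁ := h.setoid) (s₂ := h.setoid) (fun i j => T (atm (cm 0 1) [i, j])) (by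
    intro i j i' j' (h1 : T _) (h2 : T _)
    apply propext
    constructor
    · intro h3; exact h.mr _ _ _ h2 (h.ml _ _ _ h1 h3)
    · intro h3; exact h.mr _ _ _ (h.trans _ _ _ h2 (h.refl _)) (h.ml _ _ _ (h.trans _ _ _ h1 (h.refl _)) h3))

theorem Cl.EN_iff (h : Cl S T) (i j : ℕ) : h.EN (h.q i) (h.q j) ↔ T (atm (cm 0 1) [i, j]) := Iff.rfl
theorem Cl.q_eq (h : Cl S T) (i j : ℕ) : h.q i = h.q j ↔ T (atm (ce 0 1) [i, j]) :=
  ⟨fun e => Quotient.exact e, fun e => Quotient.sound (s := h.setoid) e⟩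
theorem Cl.q_surj (h : Cl S T) (x : h.N) : ∃ i, x = h.q i := by
  obtain ⟨i, hi⟩ := Quotient.exists_rep x
  exact ⟨i, hi.symm⟩

def Cl.as (h : Cl S T) (l : List ℕ) : ℕ → h.N := fun i => h.q (l.getD i 0)

theorem Cl.as_concat (h : Cl S T) (l : List ℕ) (k : ℕ) :
    h.as (l ++ [k]) = upd (h.as l) l.length (h.q k) := by
  funext i
  rcases lt_trichotomy i l.length with h' | h' | h'
  · simp [Cl.as, upd_lt h', List.getElem?_append_left h']
  · subst h'; simp [Cl.as, upd_self]
  · have h1 : (l ++ [k]).length ≤ i := by simp; omega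
    have h2 : l.length ≤ i := h'.le
    simp only [Cl.as, upd, Function.update_of_ne (show i ≠ l.length by omega)]
    rw [List.getD_eq_default _ _ h1, List.getD_eq_default _ _ h2]

def Cl.Good (h : Cl S T) (c n : ℕ) : Prop := ∀ l : List ℕ, l.length = n → (T (atm c l) ↔ Ev h.EN c n (h.as l))

theorem Cl.g_cm (h : Cl S T) (i j n : ℕ) : h.Good (cm i j) n := by
  intro l hl; rw [Ev_cm, h.mem]; rfl
theorem Cl.g_ce (h : Cl S T) (i j n : ℕ) : h.Good (ce i j) n := by
  intro l hl; rw [Ev_ce, h.eq]; exact (h.q_eq _ _).symm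
theorem Cl.g_cn (h : Cl S T) {a n : ℕ} (ha : h.Good a n) : h.Good (cn a) n := by
  intro l hl; rw [Ev_cn, h.neg, ha l hl]
theorem Cl.g_ca (h : Cl S T) {a b n : ℕ} (ha : h.Good a n) (hb : h.Good b n) : h.Good (ca a b) n := by
  intro l hl; rw [Ev_ca, h.and, ha l hl, hb l hl]
theorem Cl.g_cx (h : Cl S T) {a n : ℕ} (ha : h.Good a (n + 1)) : h.Good (cx a) n := by
  intro l hl; subst hl; rw [Ev_cx, h.ex]
  constructor
  · rintro ⟨j, hj⟩
    refine ⟨h.q j, ?_⟩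
    rw [← h.as_concat]; exact (ha _ (by simp)).1 hj
  · rintro ⟨x, hx⟩
    obtain ⟨j, rfl⟩ := h.q_surj x
    rw [← h.as_concat] at hx
    exact ⟨j, (ha _ (by simp)).2 hx⟩
theorem Cl.g_csub (h : Cl S T) (i j n : ℕ) : h.Good (csub n i j) n :=
  h.g_cn (h.g_cx (h.g_ca (h.g_cm _ _ _) (h.g_cn (h.g_cm _ _ _))))

theorem Cl.good (h : Cl S T) : ∀ {n : ℕ} (φ : SF n), h.Good φ.encode n := by
  intro n φ
  induction φ with
  | mem i j => exact h.g_cm _ _ _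
  | eq i j => exact h.g_ce _ _ _
  | not φ ih => exact h.g_cn ih
  | and φ ψ ih ih' => exact h.g_ca ih ih'
  | or φ ψ ih ih' =>
    intro l hl
    refine (h.f4 _ _ l).trans ((h.g_cn (h.g_ca (h.g_cn ih) (h.g_cn ih')) l hl).trans (Iff.trans ?_ Ev_4.symm))
    simp only [Ev_cn, Ev_ca]; tauto
  | bexMem i φ ih =>
    intro l hl; subst hl
    refine (h.f5 _ _ l).trans ((h.g_cx (h.g_ca (h.g_cm _ _ _) ih) l rfl).trans (Iff.trans ?_ Ev_5.symm))
    simp only [Ev_cx, Ev_ca, Ev_cm]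
  | ballMem i φ ih =>
    intro l hl; subst hl
    refine (h.f6 _ _ l).trans ((h.g_cn (h.g_cx (h.g_ca (h.g_cm _ _ _) (h.g_cn ih))) l rfl).trans (Iff.trans ?_ Ev_6.symm))
    simp only [Ev_cx, Ev_ca, Ev_cm, Ev_cn]; push Not; rfl
  | bexSub i φ ih =>
    intro l hl; subst hl
    refine (h.f7 _ _ l).trans ((h.g_cx (h.g_ca (h.g_csub _ _ _) ih) l rfl).trans (Iff.trans ?_ Ev_7.symm))
    simp only [Ev_cx, Ev_ca, Ev_csub]
  | ballSub i φ ih =>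
    intro l hl; subst hl
    refine (h.f8 _ _ l).trans ((h.g_cn (h.g_cx (h.g_ca (h.g_csub _ _ _) (h.g_cn ih))) l rfl).trans (Iff.trans ?_ Ev_8.symm))
    simp only [Ev_cx, Ev_ca, Ev_csub, Ev_cn]; push Not; rfl
  | ex φ ih => exact h.g_cx ih
  | all φ ih =>
    intro l hl
    refine (h.f10 _ l).trans ((h.g_cn (h.g_cx (h.g_cn ih)) l hl).trans (Iff.trans ?_ Ev_10.symm))
    simp only [Ev_cx, Ev_cn]; push Not; rfl

theorem Cl.satT (h : Cl S T) : SatT h.EN S := by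
  intro φ hφ
  have h1 := (h.good φ [] rfl).1 (h.ax φ hφ)
  have h2 := (Ev_encode φ _).1 h1
  exact (congrArg (SF.Eval h.EN φ) (funext fun i => i.elim0)).mp h2

theorem Cl.sub_iff (h : Cl S T) (i j : ℕ) : T (atm (csub 2 0 1) [i, j]) ↔ SubE h.EN (h.q i) (h.q j) :=
  (h.g_csub 0 1 2 [i, j] rfl).trans (Ev_csub.trans (SubU_iff (by simp) (by simp)))
end
end KPP

theorem KPP.main (S : Set (SF 0)) (hre : REset S)
    (hS : ∀ (Y : Type) (EY : Y → Y → Prop), SatT EY S → ModelKPP EY)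
    (M : Type) (E : M → M → Prop) [Countable M] (hM : SatT E S) :
    ∃ (Y : Type) (EY : Y → Y → Prop) (f : M → Y),
      Function.Injective f ∧ (∀ a b : M, E a b ↔ EY (f a) (f b)) ∧
      SatT EY S ∧ RankExtSet EY (Set.range f) ∧ ToplessSet EY (Set.range f) := by
  obtain ⟨F, hF, hSF⟩ := hre
  obtain ⟨C, rfl⟩ := Nat.Partrec.Code.exists_code.1 hF
  let _ : MK M := ⟨E, hS M E hM⟩
  obtain ⟨G⟩ := Gen.ex (theSem (M := M) S C hSF hM) (top := tt) (fun u => tr_tt u)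
  have h : Cl S G.T := Cl.of_closed hSF G.rule G.top G.bot
  let _ : MK h.N := ⟨h.EN, hS _ _ h.satT⟩
  have hmem : ∀ i j b, h.EN (h.q i) (h.q j) → G.G j b → ∃ a, a ∊ b ∧ G.G i a := fun i j b h1 h2 =>
    G.mem i j b (by simpa [RR, mcf] using (h.EN_iff i j).1 h1) h2
  have hsub : ∀ i j b, SubE h.EN (h.q i) (h.q j) → G.G j b → ∃ a, a ⊑ b ∧ G.G i a := fun i j b h1 h2 =>
    G.sub i j b (by simpa [RR, scf] using (h.sub_iff i j).2 h1) h2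
  have hdia : ∀ i j a b, a ∊ b → G.G i a → G.G j b → h.EN (h.q i) (h.q j) := fun i j a b h1 h2 h3 =>
    (h.EN_iff i j).2 (by simpa [RR, mcf] using G.dia i j a b h1 h2 h3)
  choose nm hnm using G.name
  have hex : ExtensionalityAx h.EN := (hS _ _ h.satT).1.1.1
  have hwd : ∀ i i' a, G.G i a → G.G i' a → h.q i = h.q i' := by
    intro i i' a h1 h2
    apply hex
    intro z
    obtain ⟨k, rfl⟩ := h.q_surj z
    constructor
    · intro hz; obtain ⟨c, hc, hk⟩ := hmem _ _ _ hz h1; exact hdia _ _ _ _ hc hk h2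
    · intro hz; obtain ⟨c, hc, hk⟩ := hmem _ _ _ hz h2; exact hdia _ _ _ _ hc hk h1
  have hle : ∀ i i' a b, G.G i a → G.G i' b → h.q i = h.q i' → ∀ c, c ∊ a → c ∊ b := by
    intro i i' a b h1 h2 e c hc
    have h3 := hdia _ _ _ _ hc (hnm c) h1
    rw [e] at h3
    obtain ⟨c', hc', hk⟩ := hmem _ _ _ h3 h2
    rw [G.fn _ _ _ (hnm c) hk]; exact hc'
  have hinj : ∀ i i' a b, G.G i a → G.G i' b → h.q i = h.q i' → a = b := fun i i' a b h1 h2 e =>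
    KPP.ext fun c => ⟨hle i i' a b h1 h2 e c, hle i' i b a h2 h1 e.symm c⟩
  let f : M → h.N := fun a => h.q (nm a)
  have hf : ∀ a i, f a = h.q i ↔ G.G i a := by
    intro a i
    constructor
    · intro e
      obtain ⟨a', _, h2⟩ := hsub i (nm a) a (by
        have e' : h.q (nm a) = h.q i := e
        rw [e']; exact fun z hz => hz) (hnm a)
      rwa [hinj _ _ _ _ (hnm a) h2 e]
    · intro hi; exact hwd _ _ _ (hnm a) hi
  have finj : Function.Injective f := fun a b e => hinj _ _ _ _ (hnm a) (hnm b) e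
  have femb : ∀ a b : M, E a b ↔ h.EN (f a) (f b) := by
    intro a b
    constructor
    · intro hab; exact hdia _ _ _ _ hab (hnm a) (hnm b)
    · intro hab
      obtain ⟨a', h1, h2⟩ := hmem _ _ _ hab (hnm b)
      rw [G.fn _ _ _ (hnm a) h2]; exact h1
  have hpow : PowExtSet h.EN (Set.range f) := by
    constructor
    · rintro x _ ⟨b, rfl⟩ hx
      obtain ⟨i, rfl⟩ := h.q_surj x
      obtain ⟨a, _, h1⟩ := hmem _ _ _ hx (hnm b)
      exact ⟨a, (hf a i).2 h1⟩
    · rintro x _ ⟨b, rfl⟩ hx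
      obtain ⟨i, rfl⟩ := h.q_surj x
      obtain ⟨a, _, h1⟩ := hsub _ _ _ hx (hnm b)
      exact ⟨a, (hf a i).2 h1⟩
  have htop : ToplessSet h.EN (Set.range f) := by
    constructor
    · intro e
      have : h.q 0 ∈ Set.range f := by rw [e]; trivial
      obtain ⟨a, ha⟩ := this
      exact G.disj 0 a G.ne ((hf a 0).1 ha)
    · intro c hc
      obtain ⟨i, rfl⟩ := h.q_surj c
      rcases G.dec i with ⟨a, ha⟩ | hJ
      · exact ⟨a, (hf a i).2 ha⟩
      · obtain ⟨k, hk, hT⟩ := G.top' i hJ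
        obtain ⟨a, ha⟩ := hc (h.q k) ((h.EN_iff k i).2 (by simpa [RR, mcf] using hT))
        exact absurd ((hf a k).1 ha) (G.disj k a hk)
  exact ⟨h.N, h.EN, f, finj, femb, h.satT, rank_transfer f finj femb hpow htop, htop⟩

/-- every countable model of a recursively enumerable theory `S`
extending `KP^𝒫` has a topless rank extension satisfying `S`. -/
theorem topless_rank_extension_exists (S : Set (SF 0)) (hre : REset S)
    (hS : ∀ (Y : Type) (EY : Y → Y → Prop), SatT EY S → ModelKPP EY)
    (X : Type) (E : X → X → Prop) [Countable X] (hM : SatT E S) :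
    ∃ (Y : Type) (EY : Y → Y → Prop) (f : X → Y),
      Function.Injective f ∧ (∀ a b : X, E a b ↔ EY (f a) (f b)) ∧
      SatT EY S ∧ RankExtSet EY (Set.range f) ∧ ToplessSet EY (Set.range f) :=
  KPP.main S hre hS X E hM
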